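/- arXiv:1803.01563 — 2 statements merged into one kernel-verified Lean document; each statement's English description precedes it below -/
import Mathlib

section
/- Let N ≥ 3 be an integer, p ∈ (N/(N-2), p_c), and let V satisfy: |V(x)-1| ≤ c₀|x|^{τ₀} for 0 < |x| ≤ 1 with some c₀ > 0 and τ₀ > τ_p^*; condition (V₁) part (II); and condition (V_∞) with exponent α satisfying (N-2)p_c - N - 2 < α ≤ 0. Suppose (u_ν)_{ν∈(0,∞)} is a family such that each u_ν is a ν-fast decaying solution of -Δu = V u^p on ℝ^N\{0} with lim_{|x|→0} u_ν(x)|x|^{2/(p-1)} = c_p and such that ν ↦ u_ν is pointwise increasing. Then the pointwise limit u_∞(x) = lim_{ν→+∞} u_ν(x) exists for every x ≠ 0, u_∞ ∈ C²(ℝ^N\{0}) is a positive solution of -Δu = V u^p on ℝ^N\{0}, lim_{|x|→0} u_∞(x)|x|^{2/(p-1)} = c_p, and there exists c₁ > 1 such that 1/c₁ ≤ u_∞(x)|x|^{(2+α)/(p-1)} ≤ c₁ for all |x| ≥ 1. -/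
open Real MeasureTheory Filter Metric Set

noncomputable section

/-- The Euclidean Laplacian, as the sum of second directional derivatives along the
coordinate axes. -/
def lap {N : ℕ} (u : EuclideanSpace ℝ (Fin N) → ℝ) (x : EuclideanSpace ℝ (Fin N)) : ℝ :=
  ∑ i : Fin N,
    fderiv ℝ (fun y => fderiv ℝ u y (EuclideanSpace.single i (1:ℝ))) x
      (EuclideanSpace.single i (1:ℝ))

/-- `f` is locally Hölder continuous on `s`. -/
def LocHolderOn {N : ℕ} (f : EuclideanSpace ℝ (Fin N) → ℝ)
    (s : Set (EuclideanSpace ℝ (Fin N))) : Prop :=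
  ∀ x ∈ s, ∃ (C α : NNReal) (r : ℝ), 0 < r ∧ 0 < α ∧ α ≤ 1 ∧
    HolderOnWith C α f (Metric.ball x r ∩ s)

/-- The constant `c_p = ((2/(p-1))(N-2-2/(p-1)))^{1/(p-1)}`. -/
def cp (N : ℕ) (p : ℝ) : ℝ := (2 / (p - 1) * ((N:ℝ) - 2 - 2 / (p - 1))) ^ (1 / (p - 1))

/-- The Joseph–Lundgren exponent `p_c = 1 + 4/(N-4+2√(N-1))`. -/
def pc (N : ℕ) : ℝ := 1 + 4 / ((N:ℝ) - 4 + 2 * Real.sqrt ((N:ℝ) - 1))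

/-- The exponent `τ_p^*`. -/
def tauStar (N : ℕ) (p : ℝ) : ℝ :=
  (2 / (p - 1) - ((N:ℝ) - 2) / 2) -
    Real.sqrt ((2 / (p - 1) - ((N:ℝ) - 2) / 2) ^ 2 - 2 * ((N:ℝ) - 2 - 2 / (p - 1)))

/-- The surface measure `σ_{N-1}` of the unit sphere in `ℝ^N`,
expressed as `N` times the volume of the unit ball. -/
def sphereArea (N : ℕ) : ℝ :=
  (N : ℝ) * (volume (Metric.ball (0 : EuclideanSpace ℝ (Fin N)) 1)).toReal

/-- The normalizing constant `c_N = 1/((N-2)σ_{N-1})` of the fundamental solution of `-Δ`. -/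
def cGreen (N : ℕ) : ℝ := 1 / (((N:ℝ) - 2) * sphereArea N)

/-- `u` is a `ν`-fast decaying solution of `-Δ u = V u^p` in `ℝ^N \ {0}`. -/
def FastDecaySol (N : ℕ) (p : ℝ) (V u : EuclideanSpace ℝ (Fin N) → ℝ) (ν : ℝ) : Prop :=
  ContDiffOn ℝ 2 u {0}ᶜ ∧ (∀ x : EuclideanSpace ℝ (Fin N), x ≠ 0 → 0 < u x) ∧
  (∀ x : EuclideanSpace ℝ (Fin N), x ≠ 0 → -lap u x = V x * u x ^ p) ∧
  Tendsto (fun x : EuclideanSpace ℝ (Fin N) => u x * ‖x‖ ^ ((N:ℝ) - 2))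
    (Filter.comap (fun x => ‖x‖) Filter.atTop) (nhds ν)

/-- `u(x)|x|^{2/(p-1)} → c_p` as `x → 0`. -/
def SingAtOrigin (N : ℕ) (p : ℝ) (u : EuclideanSpace ℝ (Fin N) → ℝ) : Prop :=
  Tendsto (fun x : EuclideanSpace ℝ (Fin N) => u x * ‖x‖ ^ (2 / (p - 1)))
    (nhdsWithin 0 {0}ᶜ) (nhds (cp N p))

/-- Condition `(V₀)` with parameters `c₀, τ₀, c_∞, β`. -/
def V0cond (N : ℕ) (V : EuclideanSpace ℝ (Fin N) → ℝ) (c₀ τ₀ cinf β : ℝ) : Prop :=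
  LocHolderOn V {0}ᶜ ∧ 0 < c₀ ∧ 0 < τ₀ ∧
  (∀ x : EuclideanSpace ℝ (Fin N), x ≠ 0 → ‖x‖ ≤ 1 → |V x - 1| ≤ c₀ * ‖x‖ ^ τ₀) ∧
  1 ≤ cinf ∧
  ∀ x : EuclideanSpace ℝ (Fin N), x ≠ 0 → 0 ≤ V x ∧ V x ≤ cinf * (1 + ‖x‖) ^ β

section Helpers

open scoped Topology

section LapTools
variable {N : ℕ}

lemma lap_eq_D2 {f : EuclideanSpace ℝ (Fin N) → ℝ} {x : EuclideanSpace ℝ (Fin N)}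
    (h : ContDiffAt ℝ 2 f x) :
    lap f x = ∑ i : Fin N, fderiv ℝ (fderiv ℝ f) x (EuclideanSpace.single i (1:ℝ))
      (EuclideanSpace.single i (1:ℝ)) := by
  unfold lap
  refine Finset.sum_congr rfl fun i _ => ?_
  have h1 : DifferentiableAt ℝ (fderiv ℝ f) x :=
    (h.fderiv_right (m := 1) (by norm_num)).differentiableAt (by norm_num)
  rw [fderiv_clm_apply h1 (differentiableAt_const _)]
  simp

lemma D2_eq_iter (f : EuclideanSpace ℝ (Fin N) → ℝ) (x v : EuclideanSpace ℝ (Fin N)) :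
    fderiv ℝ (fderiv ℝ f) x v v = iteratedFDeriv ℝ 2 f x ![v, v] := by
  simp [iteratedFDeriv_two_apply]

lemma lap_eq_laplacian {f : EuclideanSpace ℝ (Fin N) → ℝ} {x : EuclideanSpace ℝ (Fin N)}
    (h : ContDiffAt ℝ 2 f x) : lap f x = Laplacian.laplacian f x := by
  rw [lap_eq_D2 h, InnerProductSpace.laplacian_eq_iteratedFDeriv_orthonormalBasis f
    (EuclideanSpace.basisFun (Fin N) ℝ)]
  simp [D2_eq_iter]

lemma lap_eq_basis {f : EuclideanSpace ℝ (Fin N) → ℝ} {x : EuclideanSpace ℝ (Fin N)}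
    (h : ContDiffAt ℝ 2 f x) (b : OrthonormalBasis (Fin N) ℝ (EuclideanSpace ℝ (Fin N))) :
    lap f x = ∑ i, fderiv ℝ (fderiv ℝ f) x (b i) (b i) := by
  rw [lap_eq_laplacian h, InnerProductSpace.laplacian_eq_iteratedFDeriv_orthonormalBasis f b]
  simp [D2_eq_iter]

lemma lap_congr {f g : EuclideanSpace ℝ (Fin N) → ℝ} {x : EuclideanSpace ℝ (Fin N)}
    (h : f =ᶠ[𝓝 x] g) : lap f x = lap g x := by
  unfold lap
  refine Finset.sum_congr rfl fun i _ => ?_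
  have : (fun y => fderiv ℝ f y (EuclideanSpace.single i (1:ℝ))) =ᶠ[𝓝 x]
      (fun y => fderiv ℝ g y (EuclideanSpace.single i (1:ℝ))) := by
    filter_upwards [h.fderiv (𝕜 := ℝ)] with y hy
    rw [hy]
  rw [this.fderiv_eq]

lemma lap_add {f g : EuclideanSpace ℝ (Fin N) → ℝ} {x : EuclideanSpace ℝ (Fin N)}
    (hf : ContDiffAt ℝ 2 f x) (hg : ContDiffAt ℝ 2 g x) :
    lap (fun y => f y + g y) x = lap f x + lap g x := by
  rw [lap_eq_laplacian hf, lap_eq_laplacian hg, lap_eq_laplacian (hf.add hg)]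
  exact hf.laplacian_add hg

lemma lap_sub {f g : EuclideanSpace ℝ (Fin N) → ℝ} {x : EuclideanSpace ℝ (Fin N)}
    (hf : ContDiffAt ℝ 2 f x) (hg : ContDiffAt ℝ 2 g x) :
    lap (fun y => f y - g y) x = lap f x - lap g x := by
  rw [lap_eq_laplacian hf, lap_eq_laplacian hg, lap_eq_laplacian (hf.sub hg)]
  exact hf.laplacian_sub hg

lemma lap_const_mul {f : EuclideanSpace ℝ (Fin N) → ℝ} {x : EuclideanSpace ℝ (Fin N)} (c : ℝ)
    (hf : ContDiffAt ℝ 2 f x) :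
    lap (fun y => c * f y) x = c * lap f x := by
  rw [lap_eq_laplacian hf, lap_eq_laplacian (contDiffAt_const.mul hf)]
  exact InnerProductSpace.laplacian_smul c hf

lemma lap_mul {f g : EuclideanSpace ℝ (Fin N) → ℝ} {x : EuclideanSpace ℝ (Fin N)}
    (hf : ContDiffAt ℝ 2 f x) (hg : ContDiffAt ℝ 2 g x) :
    lap (fun y => f y * g y) x = f x * lap g x + g x * lap f x +
      2 * ∑ i, fderiv ℝ f x (EuclideanSpace.single i (1:ℝ)) *
        fderiv ℝ g x (EuclideanSpace.single i (1:ℝ)) := by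
  unfold lap
  rw [Finset.mul_sum, Finset.mul_sum, Finset.mul_sum, ← Finset.sum_add_distrib,
    ← Finset.sum_add_distrib]
  refine Finset.sum_congr rfl fun i _ => ?_
  set e := EuclideanSpace.single i (1:ℝ) with he
  have hfd : ∀ᶠ y in 𝓝 x, DifferentiableAt ℝ f y :=
    (hf.eventually (by simp)).mono fun y hy => hy.differentiableAt (by norm_num)
  have hgd : ∀ᶠ y in 𝓝 x, DifferentiableAt ℝ g y :=
    (hg.eventually (by simp)).mono fun y hy => hy.differentiableAt (by norm_num)
  have hev : (fun y => fderiv ℝ (fun y => f y * g y) y e) =ᶠ[𝓝 x]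
      (fun y => f y * fderiv ℝ g y e + g y * fderiv ℝ f y e) := by
    filter_upwards [hfd, hgd] with y h1 h2
    rw [fderiv_fun_mul h1 h2]
    simp
  have hf1 : DifferentiableAt ℝ (fun y => fderiv ℝ f y e) x :=
    ((hf.fderiv_right (m := 1) (by norm_num)).differentiableAt (by norm_num)).clm_apply
      (differentiableAt_const _)
  have hg1 : DifferentiableAt ℝ (fun y => fderiv ℝ g y e) x :=
    ((hg.fderiv_right (m := 1) (by norm_num)).differentiableAt (by norm_num)).clm_apply
      (differentiableAt_const _)
  have hf0 := hfd.self_of_nhds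
  have hg0 := hgd.self_of_nhds
  rw [hev.fderiv_eq, fderiv_fun_add (hf0.fun_mul hg1) (hg0.fun_mul hf1), fderiv_fun_mul hf0 hg1,
    fderiv_fun_mul hg0 hf1]
  simp
  ring

lemma lap_comp_isometry {f : EuclideanSpace ℝ (Fin N) → ℝ} {x : EuclideanSpace ℝ (Fin N)}
    (R : EuclideanSpace ℝ (Fin N) ≃ₗᵢ[ℝ] EuclideanSpace ℝ (Fin N))
    (hf : ContDiffAt ℝ 2 f (R x)) :
    lap (fun y => f (R y)) x = lap f (R x) := by
  have hR : ContDiff ℝ 2 (fun y => R y) := R.contDiff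
  have hc : ContDiffAt ℝ 2 (fun y => f (R y)) x :=
    ContDiffAt.comp x hf hR.contDiffAt
  rw [lap_eq_D2 hc, lap_eq_basis hf ((EuclideanSpace.basisFun (Fin N) ℝ).map R)]
  refine Finset.sum_congr rfl fun i _ => ?_
  set e := EuclideanSpace.single i (1:ℝ) with he
  have hfd : ∀ᶠ y in 𝓝 (R x), DifferentiableAt ℝ f y :=
    (hf.eventually (by simp)).mono fun y hy => hy.differentiableAt (by norm_num)
  have hfd' : ∀ᶠ y in 𝓝 x, DifferentiableAt ℝ f (R y) :=
    R.continuous.continuousAt.eventually hfd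
  let L : EuclideanSpace ℝ (Fin N) →L[ℝ] EuclideanSpace ℝ (Fin N) :=
    (R.toContinuousLinearEquiv : EuclideanSpace ℝ (Fin N) →L[ℝ] EuclideanSpace ℝ (Fin N))
  have hL : ∀ y, HasFDerivAt (fun y => R y) L y := fun y => L.hasFDerivAt
  have hev : fderiv ℝ (fun y => f (R y)) =ᶠ[𝓝 x] fun y => (fderiv ℝ f (R y)).comp L := by
    filter_upwards [hfd'] with y hy
    exact (hy.hasFDerivAt.comp y (hL y)).fderiv
  rw [hev.fderiv_eq]
  have h2 : DifferentiableAt ℝ (fderiv ℝ f) (R x) :=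
    (hf.fderiv_right (m := 1) (by norm_num)).differentiableAt (by norm_num)
  have h3 : HasFDerivAt (fun y => fderiv ℝ f (R y)) ((fderiv ℝ (fderiv ℝ f) (R x)).comp L) x :=
    h2.hasFDerivAt.comp x (hL x)
  have h4 := h3.clm_comp (hasFDerivAt_const L x)
  rw [h4.fderiv]
  simp [L, he]

lemma D2_nonpos_of_isLocalMax {f : EuclideanSpace ℝ (Fin N) → ℝ} {x : EuclideanSpace ℝ (Fin N)}
    (h : ContDiffAt ℝ 2 f x) (hm : IsLocalMax f x) (e : EuclideanSpace ℝ (Fin N)) :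
    fderiv ℝ (fun y => fderiv ℝ f y e) x e ≤ 0 := by
  by_contra hcon
  push Not at hcon
  let l : ℝ → EuclideanSpace ℝ (Fin N) := fun t => x + t • e
  have hl : ∀ t, HasDerivAt l e t := fun t => by
    simpa [l] using ((hasDerivAt_id t).smul_const e).const_add x
  have hl0 : l 0 = x := by simp [l]
  have hlc : ContinuousAt l 0 := (hl 0).continuousAt
  have hlt : Tendsto l (𝓝 0) (𝓝 x) := by simpa [hl0] using hlc.tendsto
  have hfd : ∀ᶠ y in 𝓝 x, DifferentiableAt ℝ f y :=
    (h.eventually (by simp)).mono fun y hy => hy.differentiableAt (by norm_num)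
  have hd1 : deriv (fun t => f (l t)) =ᶠ[𝓝 0] fun t => fderiv ℝ f (l t) e := by
    filter_upwards [hlt.eventually hfd] with t ht
    exact (ht.hasFDerivAt.comp_hasDerivAt t (hl t)).deriv
  have h1 : DifferentiableAt ℝ (fun y => fderiv ℝ f y e) (l 0) := by
    rw [hl0]
    exact ((h.fderiv_right (m := 1) (by norm_num)).differentiableAt (by norm_num)).clm_apply
      (differentiableAt_const _)
  have hd2 : deriv (deriv (fun t => f (l t))) 0 = fderiv ℝ (fun y => fderiv ℝ f y e) x e := by
    rw [hd1.deriv_eq]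
    have := (h1.hasFDerivAt.comp_hasDerivAt 0 (hl 0)).deriv
    rw [hl0] at this
    exact this
  have hmax : IsLocalMax (fun t => f (l t)) 0 := by
    have : ∀ᶠ y in 𝓝 x, f y ≤ f x := hm
    have := hlt.eventually this
    filter_upwards [this] with t ht
    simpa [hl0] using ht
  have hcont : ContinuousAt (fun t => f (l t)) 0 := by
    have : ContinuousAt f (l 0) := by rw [hl0]; exact h.continuousAt
    exact ContinuousAt.comp (f := l) this hlc
  have hmin := isLocalMin_of_deriv_deriv_pos (f := fun t => f (l t)) (x₀ := 0) (by rw [hd2]; exact hcon)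
    hmax.deriv_eq_zero hcont
  have hconst : (fun t => f (l t)) =ᶠ[𝓝 0] fun _ => f (l 0) := by
    filter_upwards [hmin, hmax] with t h1 h2
    exact le_antisymm h2 h1
  have : deriv (deriv (fun t => f (l t))) 0 = 0 := by
    rw [hconst.deriv.deriv_eq]
    simp
  rw [hd2] at this
  linarith

lemma lap_nonpos_of_isLocalMax {f : EuclideanSpace ℝ (Fin N) → ℝ} {x : EuclideanSpace ℝ (Fin N)}
    (h : ContDiffAt ℝ 2 f x) (hm : IsLocalMax f x) : lap f x ≤ 0 :=
  Finset.sum_nonpos fun _ _ => D2_nonpos_of_isLocalMax h hm _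

lemma lap_continuousOn {f : EuclideanSpace ℝ (Fin N) → ℝ} {s : Set (EuclideanSpace ℝ (Fin N))}
    (hs : IsOpen s) (h : ContDiffOn ℝ 2 f s) : ContinuousOn (lap f) s := by
  unfold lap
  refine continuousOn_finsetSum _ fun i _ => ?_
  have h1 : ContDiffOn ℝ 1 (fun y => fderiv ℝ f y (EuclideanSpace.single i (1:ℝ))) s :=
    (h.fderiv_of_isOpen hs (by norm_num)).clm_apply contDiffOn_const
  exact (h1.continuousOn_fderiv_of_isOpen hs (by norm_num)).clm_apply continuousOn_const

end LapTools

section Radial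
variable {N : ℕ}

lemma hasFDerivAt_norm' {x : EuclideanSpace ℝ (Fin N)} (hx : x ≠ 0) :
    HasFDerivAt (fun y : EuclideanSpace ℝ (Fin N) => ‖y‖) (‖x‖⁻¹ • innerSL ℝ x) x := by
  have h1 : HasFDerivAt (fun y : EuclideanSpace ℝ (Fin N) => ‖y‖ ^ 2) (2 • innerSL ℝ x) x :=
    (hasStrictFDerivAt_norm_sq x).hasFDerivAt
  have hn : ‖x‖ ≠ 0 := norm_ne_zero_iff.mpr hx
  have h2 := h1.sqrt (by positivity)
  have h3 : (fun y : EuclideanSpace ℝ (Fin N) => √(‖y‖ ^ 2)) = fun y => ‖y‖ := by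
    ext y; exact Real.sqrt_sq (norm_nonneg y)
  rw [h3, Real.sqrt_sq (norm_nonneg x)] at h2
  have h4 : ‖x‖⁻¹ • innerSL ℝ x = (1 / (2 * ‖x‖)) • 2 • innerSL ℝ x := by
    rw [two_smul, ← two_smul ℝ (innerSL ℝ x), smul_smul]
    congr 1
    field_simp
  rw [h4]
  exact h2

lemma hasFDerivAt_radial {x : EuclideanSpace ℝ (Fin N)} (hx : x ≠ 0) {y : ℝ → ℝ} {y' : ℝ}
    (hy : HasDerivAt y y' ‖x‖) :
    HasFDerivAt (fun z : EuclideanSpace ℝ (Fin N) => y ‖z‖) (y' • (‖x‖⁻¹ • innerSL ℝ x)) x :=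
  hy.comp_hasFDerivAt x (hasFDerivAt_norm' hx)

lemma inner_single' (x : EuclideanSpace ℝ (Fin N)) (i : Fin N) :
    inner ℝ x (EuclideanSpace.single i (1:ℝ)) = x i := by
  simp [EuclideanSpace.inner_single_right]

lemma sum_sq_coord (x : EuclideanSpace ℝ (Fin N)) : ∑ i, x i * x i = ‖x‖ ^ 2 := by
  rw [EuclideanSpace.norm_sq_eq]
  refine Finset.sum_congr rfl fun i _ => ?_
  rw [Real.norm_eq_abs, sq_abs]; ring

lemma sum_coord_mul (x z : EuclideanSpace ℝ (Fin N)) : ∑ i, x i * z i = inner ℝ x z := by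
  simp [PiLp.inner_apply, mul_comm]

lemma lap_radial {x : EuclideanSpace ℝ (Fin N)} (hx : x ≠ 0) {y y1 : ℝ → ℝ} {y2 : ℝ}
    (hy : ∀ s, 0 < s → HasDerivAt y (y1 s) s) (h1 : HasDerivAt y1 y2 ‖x‖) :
    lap (fun z : EuclideanSpace ℝ (Fin N) => y ‖z‖) x = y2 + ((N:ℝ) - 1) / ‖x‖ * y1 ‖x‖ := by
  have hn : 0 < ‖x‖ := norm_pos_iff.mpr hx
  have hne : ∀ᶠ z in 𝓝 x, z ≠ 0 := isOpen_ne.mem_nhds hx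
  have hkey : ∀ i : Fin N,
      fderiv ℝ (fun z => fderiv ℝ (fun z : EuclideanSpace ℝ (Fin N) => y ‖z‖) z
        (EuclideanSpace.single i (1:ℝ))) x (EuclideanSpace.single i (1:ℝ)) =
      (y2 * ‖x‖⁻¹ - y1 ‖x‖ * (‖x‖ ^ 2)⁻¹) * ‖x‖⁻¹ * (x i * x i) + y1 ‖x‖ * ‖x‖⁻¹ := by
    intro i
    have hev : (fun z => fderiv ℝ (fun z : EuclideanSpace ℝ (Fin N) => y ‖z‖) z
        (EuclideanSpace.single i (1:ℝ))) =ᶠ[𝓝 x]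
        fun z => (y1 ‖z‖ * ‖z‖⁻¹) * inner ℝ (EuclideanSpace.single i (1:ℝ)) z := by
      filter_upwards [hne] with z hz
      rw [(hasFDerivAt_radial hz (hy _ (norm_pos_iff.mpr hz))).fderiv]
      simp
      try rw [real_inner_comm]
      try ring
    rw [hev.fderiv_eq]
    have hΦ : HasDerivAt (fun s => y1 s * s⁻¹) (y2 * ‖x‖⁻¹ + y1 ‖x‖ * (-(‖x‖ ^ 2)⁻¹)) ‖x‖ :=
      h1.mul (hasDerivAt_inv hn.ne')
    have hA := hasFDerivAt_radial hx hΦ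
    have hB : HasFDerivAt (fun z => inner ℝ (EuclideanSpace.single i (1:ℝ)) z)
        (innerSL ℝ (EuclideanSpace.single i (1:ℝ))) x :=
      (innerSL ℝ (EuclideanSpace.single i (1:ℝ))).hasFDerivAt
    rw [(hA.fun_mul hB).fderiv]
    have e1 : inner ℝ (EuclideanSpace.single i (1:ℝ)) x = x i := by
      rw [real_inner_comm, inner_single']
    simp [e1, inner_single']
    ring
  unfold lap
  rw [Finset.sum_congr rfl fun i _ => hkey i, Finset.sum_add_distrib, ← Finset.mul_sum,
    sum_sq_coord]
  simp
  field_simp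
  ring

lemma lap_rpow_norm {x : EuclideanSpace ℝ (Fin N)} (hx : x ≠ 0) (k : ℝ) :
    lap (fun z : EuclideanSpace ℝ (Fin N) => ‖z‖ ^ k) x =
      k * (k + N - 2) * ‖x‖ ^ (k - 2) := by
  have hn : 0 < ‖x‖ := norm_pos_iff.mpr hx
  rw [lap_radial hx (y := fun s => s ^ k) (y1 := fun s => k * s ^ (k - 1))
    (y2 := k * ((k - 1) * ‖x‖ ^ (k - 2)))]
  · have : ‖x‖ ^ (k - 1) = ‖x‖ ^ (k - 2) * ‖x‖ := by
      rw [← Real.rpow_add_one hn.ne']; congr 1; ring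
    rw [this]
    field_simp
    ring
  · intro s hs
    exact Real.hasDerivAt_rpow_const (Or.inl hs.ne')
  · have := (Real.hasDerivAt_rpow_const (x := ‖x‖) (p := k - 1) (Or.inl hn.ne')).const_mul k
    rw [show k - 1 - 1 = k - 2 by ring] at this
    exact this

lemma contDiffAt_rpow_norm {x : EuclideanSpace ℝ (Fin N)} (hx : x ≠ 0) (k : ℝ) :
    ContDiffAt ℝ 2 (fun z : EuclideanSpace ℝ (Fin N) => ‖z‖ ^ k) x :=
  (contDiffAt_norm ℝ hx).rpow_const_of_ne (norm_ne_zero_iff.mpr hx)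

lemma fderiv_rpow_norm {x : EuclideanSpace ℝ (Fin N)} (hx : x ≠ 0) (k : ℝ)
    (v : EuclideanSpace ℝ (Fin N)) :
    fderiv ℝ (fun z : EuclideanSpace ℝ (Fin N) => ‖z‖ ^ k) x v =
      k * ‖x‖ ^ (k - 2) * inner ℝ x v := by
  have hn : 0 < ‖x‖ := norm_pos_iff.mpr hx
  rw [(hasFDerivAt_radial hx (y := fun s => s ^ k)
    (Real.hasDerivAt_rpow_const (Or.inl hn.ne'))).fderiv]
  have : ‖x‖ ^ (k - 1) = ‖x‖ ^ (k - 2) * ‖x‖ := by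
    rw [← Real.rpow_add_one hn.ne']; congr 1; ring
  simp [this]
  field_simp

lemma lap_inner (e x : EuclideanSpace ℝ (Fin N)) :
    lap (fun z : EuclideanSpace ℝ (Fin N) => inner ℝ e z) x = 0 := by
  unfold lap
  have : ∀ z, fderiv ℝ (fun z : EuclideanSpace ℝ (Fin N) => inner ℝ e z) z = innerSL ℝ e :=
    fun z => (innerSL ℝ e).fderiv
  simp [this]

lemma contDiff_inner_e (e : EuclideanSpace ℝ (Fin N)) :
    ContDiff ℝ 2 (fun z : EuclideanSpace ℝ (Fin N) => inner ℝ e z) :=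
  (innerSL ℝ e).contDiff

lemma fderiv_inner_e (e x v : EuclideanSpace ℝ (Fin N)) :
    fderiv ℝ (fun z : EuclideanSpace ℝ (Fin N) => inner ℝ e z) x v = inner ℝ e v := by
  have : fderiv ℝ (fun z : EuclideanSpace ℝ (Fin N) => inner ℝ e z) x = innerSL ℝ e :=
    (innerSL ℝ e).fderiv
  simp [this]

lemma lap_inner_mul_rpow {x : EuclideanSpace ℝ (Fin N)} (hx : x ≠ 0)
    (e : EuclideanSpace ℝ (Fin N)) (k : ℝ) :
    lap (fun z : EuclideanSpace ℝ (Fin N) => inner ℝ e z * ‖z‖ ^ k) x =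
      k * (k + N) * ‖x‖ ^ (k - 2) * inner ℝ e x := by
  rw [lap_mul (contDiff_inner_e e).contDiffAt (contDiffAt_rpow_norm hx k), lap_inner,
    lap_rpow_norm hx]
  have : ∑ i, fderiv ℝ (fun z : EuclideanSpace ℝ (Fin N) => inner ℝ e z) x
      (EuclideanSpace.single i (1:ℝ)) * fderiv ℝ (fun z : EuclideanSpace ℝ (Fin N) => ‖z‖ ^ k) x
        (EuclideanSpace.single i (1:ℝ)) = k * ‖x‖ ^ (k - 2) * inner ℝ e x := by
    simp only [fderiv_inner_e, fderiv_rpow_norm hx, inner_single']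
    rw [← sum_coord_mul, Finset.mul_sum]
    refine Finset.sum_congr rfl fun i _ => by ring
  rw [this]
  ring

lemma lap_inner_sq_mul_rpow {x : EuclideanSpace ℝ (Fin N)} (hx : x ≠ 0)
    {e : EuclideanSpace ℝ (Fin N)} (he : ‖e‖ = 1) (k : ℝ) :
    lap (fun z : EuclideanSpace ℝ (Fin N) => inner ℝ e z * (inner ℝ e z * ‖z‖ ^ k)) x =
      2 * ‖x‖ ^ k + k * (k + N + 2) * ‖x‖ ^ (k - 2) * (inner ℝ e x) ^ 2 := by
  have hc := (contDiff_inner_e e).contDiffAt (x := x)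
  have hc2 := contDiffAt_rpow_norm hx k
  rw [lap_mul hc (hc.mul hc2), lap_inner, lap_inner_mul_rpow hx]
  have hd : ∀ v, fderiv ℝ (fun z : EuclideanSpace ℝ (Fin N) => inner ℝ e z * ‖z‖ ^ k) x v =
      inner ℝ e x * (k * ‖x‖ ^ (k - 2) * inner ℝ x v) + ‖x‖ ^ k * inner ℝ e v := by
    intro v
    rw [fderiv_fun_mul (hc.differentiableAt (by norm_num)) (hc2.differentiableAt (by norm_num))]
    simp [fderiv_inner_e, fderiv_rpow_norm hx]
  have : ∑ i, fderiv ℝ (fun z : EuclideanSpace ℝ (Fin N) => inner ℝ e z) x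
      (EuclideanSpace.single i (1:ℝ)) *
      fderiv ℝ (fun z : EuclideanSpace ℝ (Fin N) => inner ℝ e z * ‖z‖ ^ k) x
        (EuclideanSpace.single i (1:ℝ)) =
      inner ℝ e x * k * ‖x‖ ^ (k - 2) * inner ℝ e x + ‖x‖ ^ k * ‖e‖ ^ 2 := by
    simp only [hd, fderiv_inner_e, inner_single']
    rw [← sum_sq_coord e]
    conv_rhs => rw [← sum_coord_mul e x, Finset.mul_sum, Finset.mul_sum, ← Finset.sum_add_distrib]
    rw [sum_coord_mul]
    refine Finset.sum_congr rfl fun i _ => by ring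
  rw [this, he]
  ring

/-- angular barrier -/
def barr (ε lam m : ℝ) (e : EuclideanSpace ℝ (Fin N)) (x : EuclideanSpace ℝ (Fin N)) : ℝ :=
  ε * ‖x‖ ^ (-m) + inner ℝ e x * ‖x‖ ^ (-m - 1) -
    (lam * ε) * (inner ℝ e x * (inner ℝ e x * ‖x‖ ^ (-m - 2)))

lemma barr_contDiffAt (ε lam m : ℝ) (e : EuclideanSpace ℝ (Fin N)) {x : EuclideanSpace ℝ (Fin N)}
    (hx : x ≠ 0) : ContDiffAt ℝ 2 (barr ε lam m e) x := by
  have hc := (contDiff_inner_e e).contDiffAt (x := x)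
  exact ((contDiffAt_const.mul (contDiffAt_rpow_norm hx _)).add
    (hc.mul (contDiffAt_rpow_norm hx _))).sub
    (contDiffAt_const.mul (hc.mul (hc.mul (contDiffAt_rpow_norm hx _))))

/-- `barr` in terms of `θ = ⟪e,x⟫/‖x‖`. -/
lemma barr_eq (ε lam m : ℝ) (e : EuclideanSpace ℝ (Fin N)) {x : EuclideanSpace ℝ (Fin N)}
    (hx : x ≠ 0) : barr ε lam m e x = ‖x‖ ^ (-m) * (ε + inner ℝ e x / ‖x‖ -
      lam * ε * (inner ℝ e x / ‖x‖) ^ 2) := by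
  have hn : 0 < ‖x‖ := norm_pos_iff.mpr hx
  unfold barr
  rw [Real.rpow_sub_one hn.ne', show -m - 2 = -m - 1 - 1 by ring, Real.rpow_sub_one hn.ne',
    Real.rpow_sub_one hn.ne']
  field_simp

lemma lap_barr (ε lam m : ℝ) {e : EuclideanSpace ℝ (Fin N)} (he : ‖e‖ = 1)
    {x : EuclideanSpace ℝ (Fin N)} (hx : x ≠ 0) :
    lap (barr ε lam m e) x = ‖x‖ ^ (-m - 2) * (- ε * (m * (N - 2 - m))
      - (m + 1) * (N - 1 - m) * (inner ℝ e x / ‖x‖)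
      - lam * ε * (2 - (m + 2) * (N - m) * (inner ℝ e x / ‖x‖) ^ 2)) := by
  have hn : 0 < ‖x‖ := norm_pos_iff.mpr hx
  have hc := (contDiff_inner_e e).contDiffAt (x := x)
  have h1 := contDiffAt_rpow_norm hx (-m)
  have h2 := contDiffAt_rpow_norm hx (-m-1)
  have h3 := contDiffAt_rpow_norm hx (-m-2)
  unfold barr
  rw [lap_sub ((contDiffAt_const.mul h1).add (hc.mul h2)) (contDiffAt_const.mul (hc.mul (hc.mul h3))),
    lap_add (contDiffAt_const.mul h1) (hc.mul h2), lap_const_mul _ h1,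
    lap_const_mul _ (hc.mul (hc.mul h3)), lap_rpow_norm hx, lap_inner_mul_rpow hx,
    lap_inner_sq_mul_rpow hx he]
  have e1 : ‖x‖ ^ (-m - 1 - 2) = ‖x‖ ^ (-m - 2) / ‖x‖ := by
    rw [← Real.rpow_sub_one hn.ne']; congr 1; ring
  have e2 : ‖x‖ ^ (-m - 2 - 2) = ‖x‖ ^ (-m - 2) / ‖x‖ / ‖x‖ := by
    rw [← Real.rpow_sub_one hn.ne', ← Real.rpow_sub_one hn.ne']; congr 1; ring
  rw [e1, e2]
  field_simp
  ring

end Radial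

section Sym
variable {N : ℕ}

lemma rpow_convex_lt {a b p : ℝ} (ha : 0 < a) (hb : 0 < b) (hp : 1 < p) (hab : a ≠ b) :
    a ^ p + p * a ^ (p - 1) * (b - a) < b ^ p := by
  have hs : b / a - 1 ≠ 0 := by
    intro h
    apply hab
    field_simp at h
    linarith
  have h1 := one_add_mul_self_lt_rpow_one_add (s := b / a - 1) (p := p)
    (by have : 0 < b / a := by positivity
        linarith) hs hp
  rw [show 1 + (b / a - 1) = b / a by ring, Real.div_rpow hb.le ha.le, lt_div_iff₀ (by positivity)] at h1
  have h2 : a ^ p = a ^ (p - 1) * a := by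
    rw [← Real.rpow_add_one ha.ne']; congr 1; ring
  have h3 : (1 + p * (b / a - 1)) * a ^ p = a ^ p + p * a ^ (p - 1) * (b - a) := by
    rw [h2]; field_simp
  linarith

lemma rpow_convex_le {a b p : ℝ} (ha : 0 < a) (hb : 0 < b) (hp : 1 < p) :
    a ^ p + p * a ^ (p - 1) * (b - a) ≤ b ^ p := by
  rcases eq_or_ne a b with h | h
  · subst h; simp
  · exact (rpow_convex_lt ha hb hp h).le

lemma contDiffAt_of_off0 {f : EuclideanSpace ℝ (Fin N) → ℝ} (hf : ContDiffOn ℝ 2 f {0}ᶜ)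
    {x : EuclideanSpace ℝ (Fin N)} (hx : x ≠ 0) : ContDiffAt ℝ 2 f x :=
  hf.contDiffAt (isOpen_compl_singleton.mem_nhds hx)

lemma annulus_compact (ρ R : ℝ) : IsCompact {x : EuclideanSpace ℝ (Fin N) | ρ ≤ ‖x‖ ∧ ‖x‖ ≤ R} := by
  have h1 : IsClosed {x : EuclideanSpace ℝ (Fin N) | ρ ≤ ‖x‖} :=
    isClosed_le continuous_const continuous_norm
  have h2 := (isCompact_closedBall (0 : EuclideanSpace ℝ (Fin N)) R).inter_left h1
  have h3 : {x : EuclideanSpace ℝ (Fin N) | ρ ≤ ‖x‖ ∧ ‖x‖ ≤ R} =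
      {x : EuclideanSpace ℝ (Fin N) | ρ ≤ ‖x‖} ∩ closedBall 0 R := by
    apply Set.ext
    intro x
    simp
  rw [h3]
  exact h2

lemma ev_infty {P : EuclideanSpace ℝ (Fin N) → Prop}
    (h : ∀ᶠ x in Filter.comap (fun x : EuclideanSpace ℝ (Fin N) => ‖x‖) Filter.atTop, P x) :
    ∃ R : ℝ, ∀ x, R ≤ ‖x‖ → P x := by
  rw [Filter.eventually_comap] at h
  obtain ⟨R, hR⟩ := Filter.eventually_atTop.mp h
  exact ⟨R, fun x hx => hR _ hx x rfl⟩

lemma ev_zero {P : EuclideanSpace ℝ (Fin N) → Prop}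
    (h : ∀ᶠ x in 𝓝[{0}ᶜ] (0 : EuclideanSpace ℝ (Fin N)), P x) :
    ∃ r : ℝ, 0 < r ∧ ∀ x, x ≠ 0 → ‖x‖ < r → P x := by
  rw [eventually_nhdsWithin_iff, Metric.eventually_nhds_iff] at h
  obtain ⟨r, hr, h⟩ := h
  refine ⟨r, hr, fun x hx hxr => h (by simpa using hxr) hx⟩

lemma pos_of_superharmonic {ψ : EuclideanSpace ℝ (Fin N) → ℝ} {M a : ℝ} (hM : M = (N:ℝ) - 2)
    (hM0 : 0 < M) (ha : 0 < a)
    (hψ : ContDiffOn ℝ 2 ψ {0}ᶜ) (h0 : ∀ x, x ≠ 0 → 0 ≤ ψ x) (hl : ∀ x, x ≠ 0 → lap ψ x ≤ 0)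
    (hlim : Tendsto (fun x : EuclideanSpace ℝ (Fin N) => ψ x * ‖x‖ ^ M)
      (Filter.comap (fun x => ‖x‖) Filter.atTop) (𝓝 a)) :
    ∀ x, x ≠ 0 → 0 < ψ x := by
  intro x1 hx1
  obtain ⟨R0, hR0⟩ := ev_infty (hlim.eventually (lt_mem_nhds (half_lt_self ha)))
  have hn1 : 0 < ‖x1‖ := norm_pos_iff.mpr hx1
  set ρ := ‖x1‖ / 2 with hρ
  have hρ0 : 0 < ρ := by positivity
  set R := max R0 (2 * ‖x1‖) with hR
  have hRx : 2 * ‖x1‖ ≤ R := le_max_right _ _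
  have hR0' : 0 < R := by linarith
  set q := M / 2 with hq
  have hq0 : 0 < q := by positivity
  set κ := (a / 2) * R ^ (-M) * ρ ^ q with hκ
  have hκ0 : 0 < κ := by positivity
  let φ : EuclideanSpace ℝ (Fin N) → ℝ := fun x => κ * ρ ^ (-q) - κ * ‖x‖ ^ (-q)
  have hφc : ∀ x, x ≠ 0 → ContDiffAt ℝ 2 φ x := fun x hx =>
    contDiffAt_const.sub (contDiffAt_const.mul (contDiffAt_rpow_norm hx _))
  have hφl : ∀ x, x ≠ 0 → 0 < lap φ x := by
    intro x hx
    have hnx : 0 < ‖x‖ := norm_pos_iff.mpr hx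
    have : lap φ x = κ * (q * (M - q)) * ‖x‖ ^ (-q - 2) := by
      have e0 : lap (fun _ : EuclideanSpace ℝ (Fin N) => κ * ρ ^ (-q)) x = 0 := by
        unfold lap; simp
      show lap (fun x => κ * ρ ^ (-q) - κ * ‖x‖ ^ (-q)) x = _
      rw [lap_sub contDiffAt_const (contDiffAt_const.mul (contDiffAt_rpow_norm hx _)), e0,
        lap_const_mul _ (contDiffAt_rpow_norm hx _), lap_rpow_norm hx, hM]
      ring
    rw [this]
    have : 0 < M - q := by rw [hq]; linarith
    positivity
  have hφ1 : 0 < φ x1 := by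
    have : ‖x1‖ ^ (-q) < ρ ^ (-q) :=
      Real.rpow_lt_rpow_of_neg hρ0 (by rw [hρ]; linarith) (by linarith)
    show 0 < κ * ρ ^ (-q) - κ * ‖x1‖ ^ (-q)
    nlinarith
  by_contra hcon
  have hψ1 : ψ x1 = 0 := le_antisymm (not_lt.mp hcon) (h0 x1 hx1)
  set K := {x : EuclideanSpace ℝ (Fin N) | ρ ≤ ‖x‖ ∧ ‖x‖ ≤ R} with hK
  have hKne : ∀ x ∈ K, x ≠ 0 := fun x hx => norm_pos_iff.mp (lt_of_lt_of_le hρ0 hx.1)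
  have hfc : ∀ x, x ≠ 0 → ContDiffAt ℝ 2 (fun x => φ x - ψ x) x := fun x hx =>
    (hφc x hx).sub (contDiffAt_of_off0 hψ hx)
  have hx1K : x1 ∈ K := ⟨by rw [hρ]; linarith, by linarith⟩
  obtain ⟨x0, hx0K, hmax⟩ := (annulus_compact (N := N) ρ R).exists_isMaxOn ⟨x1, hx1K⟩
    (f := fun x => φ x - ψ x) (fun x hx => (hfc x (hKne x hx)).continuousAt.continuousWithinAt)
  have hx0 := hKne x0 hx0K
  have hpos : 0 < φ x0 - ψ x0 := by
    have := hmax hx1K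
    simp only [hψ1, mem_ofPred_eq] at this
    linarith
  have hn0 : 0 < ‖x0‖ := norm_pos_iff.mpr hx0
  have hlt1 : ρ < ‖x0‖ := by
    rcases hx0K.1.lt_or_eq with h | h
    · exact h
    · exfalso
      have : φ x0 = 0 := by
        show κ * ρ ^ (-q) - κ * ‖x0‖ ^ (-q) = 0
        rw [← h]; ring
      have := h0 x0 hx0
      linarith
  have hlt2 : ‖x0‖ < R := by
    rcases hx0K.2.lt_or_eq with h | h
    · exact h
    · exfalso
      have h3 := hR0 x0 (by rw [h]; exact le_max_left _ _)
      rw [h] at h3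
      have h4 : φ x0 ≤ a / 2 * R ^ (-M) := by
        have : κ * ρ ^ (-q) = a / 2 * R ^ (-M) := by
          rw [hκ, mul_assoc, ← Real.rpow_add hρ0]; simp
        show κ * ρ ^ (-q) - κ * ‖x0‖ ^ (-q) ≤ _
        rw [this]
        have : 0 < κ * ‖x0‖ ^ (-q) := by positivity
        linarith
      have h5 : ψ x0 * R ^ M * R ^ (-M) = ψ x0 := by
        rw [mul_assoc, ← Real.rpow_add hR0']; simp
      have h6 : a / 2 * R ^ (-M) < ψ x0 := by
        rw [← h5]
        exact mul_lt_mul_of_pos_right h3 (by positivity)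
      linarith
  have hnhds : K ∈ 𝓝 x0 := by
    have : {x : EuclideanSpace ℝ (Fin N) | ρ < ‖x‖ ∧ ‖x‖ < R} ∈ 𝓝 x0 :=
      ((isOpen_lt continuous_const continuous_norm).inter
        (isOpen_lt continuous_norm continuous_const)).mem_nhds ⟨hlt1, hlt2⟩
    exact mem_of_superset this fun x hx => ⟨hx.1.le, hx.2.le⟩
  have hloc : IsLocalMax (fun x => φ x - ψ x) x0 := hmax.isLocalMax hnhds
  have h7 := lap_nonpos_of_isLocalMax (hfc x0 hx0) hloc
  rw [lap_sub (hφc x0 hx0) (contDiffAt_of_off0 hψ hx0)] at h7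
  have := hφl x0 hx0
  have := hl x0 hx0
  linarith

end Sym

section Cmp
variable {N : ℕ}

/-- linearized operator -/
def Lop (p : ℝ) (V U w : EuclideanSpace ℝ (Fin N) → ℝ) (x : EuclideanSpace ℝ (Fin N)) : ℝ :=
  -lap w x - p * V x * U x ^ (p - 1) * w x

lemma Lop_continuousOn {p : ℝ} {V U w : EuclideanSpace ℝ (Fin N) → ℝ}
    (hV : ContinuousOn V {0}ᶜ) (hU : ContDiffOn ℝ 2 U {0}ᶜ) (hUp : ∀ x, x ≠ 0 → 0 < U x)
    (hw : ContDiffOn ℝ 2 w {0}ᶜ) : ContinuousOn (Lop p V U w) {0}ᶜ := by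
  unfold Lop
  refine ContinuousOn.sub (lap_continuousOn isOpen_compl_singleton hw).neg ?_
  refine ContinuousOn.mul (ContinuousOn.mul (continuousOn_const.mul hV) ?_) hw.continuousOn
  exact hU.continuousOn.rpow_const fun x hx => Or.inl (hUp x hx).ne'

lemma barr_alg {m M ε lam θ a η : ℝ} (hm0 : 0 < m) (hmM : m < M) (hm2 : M < 2 * m)
    (hlam : lam = 2 * (M - m)) (hε : 0 < ε) (hle : lam * ε * (m + 2) = 1 / 4)
    (hη1 : η ≤ lam / 2) (hη2 : η ≤ 1 / 2) (hη0 : 0 < η) (hθ0 : 0 ≤ θ) (hθ1 : θ ≤ 1)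
    (ha : a ≤ (m + 2) * (M - m) + η) :
    0 < ε * (m * (M - m)) + (m + 1) * (M + 1 - m) * θ
      + lam * ε * (2 - (m + 2) * (M + 2 - m) * θ ^ 2) - a * (ε + θ - lam * ε * θ ^ 2) := by
  have hlam0 : 0 < lam := by rw [hlam]; linarith
  have ht : lam * ε ≤ 1 := by
    have : 0 < lam * ε := by positivity
    nlinarith
  have hB : ε ≤ ε + θ - lam * ε * θ ^ 2 := by nlinarith
  have hB2 : ε + θ - lam * ε * θ ^ 2 ≤ ε + θ := by
    have : 0 ≤ lam * ε * θ ^ 2 := by positivity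
    linarith
  have h1 : a * (ε + θ - lam * ε * θ ^ 2) ≤
      ((m + 2) * (M - m)) * (ε + θ - lam * ε * θ ^ 2) + η * (ε + θ) := by
    have := mul_le_mul_of_nonneg_right ha (by linarith : 0 ≤ ε + θ - lam * ε * θ ^ 2)
    have := mul_le_mul_of_nonneg_left hB2 hη0.le
    nlinarith
  have h2 : ε * (m * (M - m)) + (m + 1) * (M + 1 - m) * θ
      + lam * ε * (2 - (m + 2) * (M + 2 - m) * θ ^ 2) -
      ((m + 2) * (M - m)) * (ε + θ - lam * ε * θ ^ 2) =
      lam * ε + (1 + 2 * m - M) * θ - 1 / 2 * θ ^ 2 := by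
    have : (1:ℝ) / 2 * θ ^ 2 = 2 * (lam * ε * (m + 2)) * θ ^ 2 := by rw [hle]; ring
    rw [this, hlam]; ring
  have h3 : η * ε ≤ lam / 2 * ε := mul_le_mul_of_nonneg_right hη1 hε.le
  have h4 : η * θ ≤ 1 / 2 * θ := mul_le_mul_of_nonneg_right hη2 hθ0
  have h5 : θ ≤ (1 + 2 * m - M) * θ := by nlinarith
  have h6 : θ ^ 2 ≤ θ := by nlinarith
  have h7 : 0 < lam * ε := by positivity
  nlinarith

lemma theta_bounds {e x : EuclideanSpace ℝ (Fin N)} (he : ‖e‖ = 1) (hx : x ≠ 0)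
    (h : 0 ≤ inner ℝ e x) : 0 ≤ inner ℝ e x / ‖x‖ ∧ inner ℝ e x / ‖x‖ ≤ 1 := by
  have hn : 0 < ‖x‖ := norm_pos_iff.mpr hx
  refine ⟨by positivity, ?_⟩
  rw [div_le_one hn]
  have := real_inner_le_norm e x
  rwa [he, one_mul] at this

lemma barr_lower {m ε lam : ℝ} (hε : 0 < ε) (ht : lam * ε ≤ 1) 
    {e x : EuclideanSpace ℝ (Fin N)} (he : ‖e‖ = 1) (hx : x ≠ 0)
    (h : 0 ≤ inner ℝ e x) : ε * ‖x‖ ^ (-m) ≤ barr ε lam m e x := by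
  have hn : 0 < ‖x‖ := norm_pos_iff.mpr hx
  rw [barr_eq _ _ _ _ hx, mul_comm]
  obtain ⟨h1, h2⟩ := theta_bounds he hx h
  apply mul_le_mul_of_nonneg_left _ (by positivity)
  nlinarith

lemma Lop_barr_pos {p m M c : ℝ} (hM : M = (N:ℝ) - 2) (hm0 : 0 < m) (hmM : m < M)
    (hm2 : M < 2 * m) (hp : 1 < p) (hpm : p * m = m + 2) (hc0 : 0 < c)
    (hc : c ^ (p - 1) = m * (M - m)) {V U : EuclideanSpace ℝ (Fin N) → ℝ}
    (hV0 : ∀ x, x ≠ 0 → 0 < V x) (hV1 : ∀ x, x ≠ 0 → V x ≤ 1)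
    (hUp : ∀ x, x ≠ 0 → 0 < U x)
    (hU0 : Tendsto (fun x : EuclideanSpace ℝ (Fin N) => U x * ‖x‖ ^ m) (𝓝[{0}ᶜ] 0) (𝓝 c))
    {e : EuclideanSpace ℝ (Fin N)} (he : ‖e‖ = 1) :
    ∃ ε lam r : ℝ, 0 < ε ∧ lam * ε ≤ 1 ∧ 0 < r ∧ ∀ x, x ≠ 0 → ‖x‖ < r → 0 ≤ inner ℝ e x →
      0 < Lop p V U (barr ε lam m e) x := by
  set lam := 2 * (M - m) with hlam
  have hlam0 : 0 < lam := by rw [hlam]; linarith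
  set ε := 1 / (4 * lam * (m + 2)) with hε
  have hε0 : 0 < ε := by positivity
  have hle : lam * ε * (m + 2) = 1 / 4 := by rw [hε]; field_simp
  set η := min (lam / 2) (1 / 2) with hη
  have hη0 : 0 < η := by rw [hη]; positivity
  have htend : Tendsto (fun x : EuclideanSpace ℝ (Fin N) => p * (U x * ‖x‖ ^ m) ^ (p - 1))
      (𝓝[{0}ᶜ] 0) (𝓝 (p * c ^ (p - 1))) :=
    (hU0.rpow_const (Or.inl hc0.ne')).const_mul p
  have hK : p * c ^ (p - 1) = (m + 2) * (M - m) := by rw [hc, ← hpm]; ring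
  rw [hK] at htend
  obtain ⟨r, hr0, hr⟩ := ev_zero (htend.eventually (gt_mem_nhds (lt_add_of_pos_right _ hη0)))
  refine ⟨ε, lam, r, hε0, ?_, hr0, ?_⟩
  · have : 0 < lam * ε := by positivity
    nlinarith
  intro x hx hxr hin
  have hn : 0 < ‖x‖ := norm_pos_iff.mpr hx
  obtain ⟨hθ0, hθ1⟩ := theta_bounds he hx hin
  have h1 := hr x hx hxr
  have hUx := hUp x hx
  rw [Real.mul_rpow hUx.le (by positivity), ← Real.rpow_mul hn.le,
    show m * (p - 1) = 2 by linarith, Real.rpow_two] at h1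
  set a := p * V x * U x ^ (p - 1) * ‖x‖ ^ 2 with ha
  have hale : a ≤ (m + 2) * (M - m) + η := by
    have h2 : a ≤ p * (U x ^ (p - 1) * ‖x‖ ^ 2) := by
      rw [ha]
      have : 0 < p * (U x ^ (p - 1) * ‖x‖ ^ 2) := by positivity
      nlinarith [hV1 x hx]
    linarith
  have key := barr_alg hm0 hmM hm2 hlam hε0 hle (min_le_left _ _) (min_le_right _ _) hη0 hθ0 hθ1 hale
  unfold Lop
  rw [lap_barr _ _ _ he hx, barr_eq _ _ _ _ hx]
  have e1 : ‖x‖ ^ (-m) = ‖x‖ ^ (-m - 2) * ‖x‖ ^ 2 := by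
    rw [← Real.rpow_two, ← Real.rpow_add hn]; congr 1; ring
  have hpos : 0 < ‖x‖ ^ (-m - 2) := by positivity
  have := mul_pos hpos key
  rw [e1]
  have hNM : (N:ℝ) = M + 2 := by linarith
  rw [hNM]
  refine this.trans_eq ?_
  rw [ha]
  ring

lemma exists_superfun {p m M c : ℝ} (hM : M = (N:ℝ) - 2) (hm0 : 0 < m) (hmM : m < M)
    (hm2 : M < 2 * m) (hp : 1 < p) (hpm : p * m = m + 2) (hc0 : 0 < c)
    (hc : c ^ (p - 1) = m * (M - m)) {V U W : EuclideanSpace ℝ (Fin N) → ℝ}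
    (hVc : ContinuousOn V {0}ᶜ)
    (hV0 : ∀ x, x ≠ 0 → 0 < V x) (hV1 : ∀ x, x ≠ 0 → V x ≤ 1)
    (hU : ContDiffOn ℝ 2 U {0}ᶜ) (hW : ContDiffOn ℝ 2 W {0}ᶜ)
    (hUp : ∀ x, x ≠ 0 → 0 < U x) (hUW : ∀ x, x ≠ 0 → U x < W x)
    (hUe : ∀ x, x ≠ 0 → -lap U x = V x * U x ^ p)
    (hWe : ∀ x, x ≠ 0 → -lap W x = V x * W x ^ p)
    (hU0 : Tendsto (fun x : EuclideanSpace ℝ (Fin N) => U x * ‖x‖ ^ m) (𝓝[{0}ᶜ] 0) (𝓝 c))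
    {e : EuclideanSpace ℝ (Fin N)} (he : ‖e‖ = 1) :
    ∃ G : EuclideanSpace ℝ (Fin N) → ℝ, ContDiffOn ℝ 2 G {0}ᶜ ∧
      (∀ x, x ≠ 0 → 0 ≤ inner ℝ e x → W x - U x ≤ G x) ∧
      (∀ x, x ≠ 0 → 0 ≤ inner ℝ e x → 0 < Lop p V U G x) ∧
      ∃ ε r : ℝ, 0 < ε ∧ 0 < r ∧ ∀ x, x ≠ 0 → 0 ≤ inner ℝ e x → ‖x‖ < r →
        ε * ‖x‖ ^ (-m) ≤ G x := by
  obtain ⟨ε, lam, r, hε, hle, hr, hL⟩ := Lop_barr_pos hM hm0 hmM hm2 hp hpm hc0 hc hV0 hV1 hUp hU0 he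
  let χ : ContDiffBump (0 : EuclideanSpace ℝ (Fin N)) := ⟨r / 2, r, by positivity, by linarith⟩
  let B : EuclideanSpace ℝ (Fin N) → ℝ := fun x => χ x * barr ε lam m e x
  let Ψ : EuclideanSpace ℝ (Fin N) → ℝ := fun x => W x - U x
  have hBc : ContDiffOn ℝ 2 B {0}ᶜ := fun x hx =>
    (χ.contDiff.contDiffAt.mul (barr_contDiffAt ε lam m e hx)).contDiffWithinAt
  have hΨc : ContDiffOn ℝ 2 Ψ {0}ᶜ := hW.sub hU
  have hLΨ : ∀ x, x ≠ 0 → 0 < Lop p V U Ψ x := by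
    intro x hx
    show 0 < -lap (fun y => W y - U y) x - p * V x * U x ^ (p - 1) * (W x - U x)
    rw [lap_sub (contDiffAt_of_off0 hW hx) (contDiffAt_of_off0 hU hx)]
    have h1 := hUe x hx
    have h2 := hWe x hx
    have h3 := rpow_convex_lt (hUp x hx) ((hUp x hx).trans (hUW x hx)) hp (hUW x hx).ne
    have := mul_pos (hV0 x hx) (sub_pos.mpr h3)
    nlinarith
  have hBnn : ∀ x, x ≠ 0 → 0 ≤ inner ℝ e x → 0 ≤ B x := by
    intro x hx hin
    have hn : 0 < ‖x‖ := norm_pos_iff.mpr hx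
    exact mul_nonneg χ.nonneg (le_trans (by positivity) (barr_lower hε hle he hx hin))
  -- compact annulus
  have hKne : ∀ x ∈ {x : EuclideanSpace ℝ (Fin N) | r / 2 ≤ ‖x‖ ∧ ‖x‖ ≤ r}, x ≠ 0 := fun x hx =>
    norm_pos_iff.mp (lt_of_lt_of_le (by positivity) hx.1)
  have hKc := annulus_compact (N := N) (r / 2) r
  obtain ⟨C, hC⟩ := hKc.exists_bound_of_continuousOn
    ((Lop_continuousOn (p := p) hVc hU hUp hBc).mono hKne)
  have hlow : ∃ c1 : ℝ, 0 < c1 ∧ ∀ x ∈ {x : EuclideanSpace ℝ (Fin N) | r / 2 ≤ ‖x‖ ∧ ‖x‖ ≤ r},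
      c1 ≤ Lop p V U Ψ x := by
    rcases Set.eq_empty_or_nonempty {x : EuclideanSpace ℝ (Fin N) | r / 2 ≤ ‖x‖ ∧ ‖x‖ ≤ r} with h | h
    · exact ⟨1, one_pos, fun x hx => by rw [h] at hx; exact hx.elim⟩
    · obtain ⟨x0, hx0, hmin⟩ := hKc.exists_isMinOn h
        ((Lop_continuousOn (p := p) hVc hU hUp hΨc).mono hKne)
      exact ⟨_, hLΨ x0 (hKne _ hx0), fun x hx => hmin hx⟩
  obtain ⟨c1, hc1, hlow⟩ := hlow
  set δ := c1 / (2 * (|C| + 1)) with hδ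
  have hδ0 : 0 < δ := by positivity
  have hLG : ∀ x, x ≠ 0 → Lop p V U (fun y => Ψ y + δ * B y) x =
      Lop p V U Ψ x + δ * Lop p V U B x := by
    intro x hx
    have h1 := contDiffAt_of_off0 hΨc hx
    have h2 := contDiffAt_of_off0 hBc hx
    unfold Lop
    rw [lap_add h1 (contDiffAt_const.mul h2), lap_const_mul _ h2]
    ring
  refine ⟨fun y => Ψ y + δ * B y, hΨc.add (contDiffOn_const.mul hBc), ?_, ?_,
    δ * ε, r / 2, by positivity, by positivity, ?_⟩
  · intro x hx hin
    have := mul_nonneg hδ0.le (hBnn x hx hin)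
    show W x - U x ≤ (W x - U x) + δ * B x
    linarith
  · intro x hx hin
    rw [hLG x hx]
    have hn : 0 < ‖x‖ := norm_pos_iff.mpr hx
    rcases lt_or_ge ‖x‖ (r / 2) with h | h
    · have hev : B =ᶠ[𝓝 x] barr ε lam m e := by
        have : {y : EuclideanSpace ℝ (Fin N) | ‖y‖ < r / 2} ∈ 𝓝 x :=
          (isOpen_lt continuous_norm continuous_const).mem_nhds h
        filter_upwards [this] with y hy
        have : χ y = 1 := χ.one_of_mem_closedBall (by simpa using (le_of_lt hy))
        show χ y * barr ε lam m e y = _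
        rw [this, one_mul]
      have h1 : Lop p V U B x = Lop p V U (barr ε lam m e) x := by
        unfold Lop
        rw [lap_congr hev, hev.eq_of_nhds]
      rw [h1]
      exact add_pos (hLΨ x hx) (mul_pos hδ0 (hL x hx (by linarith) hin))
    · rcases le_or_gt ‖x‖ r with h' | h'
      · have h1 := hlow x ⟨h, h'⟩
        have h2 := hC x ⟨h, h'⟩
        rw [Real.norm_eq_abs] at h2
        have h3 : δ * (|C| + 1) = c1 / 2 := by rw [hδ]; field_simp
        have h4 : -(|C| + 1) ≤ Lop p V U B x := by
          have := neg_abs_le (Lop p V U B x)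
          have := le_abs_self C
          linarith
        have := mul_le_mul_of_nonneg_left h4 hδ0.le
        linarith
      · have hev : B =ᶠ[𝓝 x] fun _ => 0 := by
          have : {y : EuclideanSpace ℝ (Fin N) | r < ‖y‖} ∈ 𝓝 x :=
            (isOpen_lt continuous_const continuous_norm).mem_nhds h'
          filter_upwards [this] with y hy
          have : χ y = 0 := χ.zero_of_le_dist (by simpa using (le_of_lt hy))
          show χ y * barr ε lam m e y = _
          rw [this, zero_mul]
        have h1 : Lop p V U B x = 0 := by
          unfold Lop
          rw [lap_congr hev, hev.eq_of_nhds]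
          unfold lap
          simp
        rw [h1]
        have := hLΨ x hx
        linarith
  · intro x hx hin hxr
    have h1 : χ x = 1 := χ.one_of_mem_closedBall (by simpa using (le_of_lt hxr))
    have h2 := barr_lower (m := m) hε hle he hx hin
    have h3 := hUW x hx
    show δ * ε * ‖x‖ ^ (-m) ≤ (W x - U x) + δ * (χ x * barr ε lam m e x)
    rw [h1, one_mul]
    have := mul_le_mul_of_nonneg_left h2 hδ0.le
    nlinarith

end Cmp

section Cmp2
variable {N : ℕ}

lemma compare_half {p m M c ν ν2 : ℝ} (hM : M = (N:ℝ) - 2) (hm0 : 0 < m) (hmM : m < M)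
    (hm2 : M < 2 * m) (hp : 1 < p) (hpm : p * m = m + 2) (hc0 : 0 < c)
    (hc : c ^ (p - 1) = m * (M - m)) {V U W w : EuclideanSpace ℝ (Fin N) → ℝ}
    (hVc : ContinuousOn V {0}ᶜ)
    (hV0 : ∀ x, x ≠ 0 → 0 < V x) (hV1 : ∀ x, x ≠ 0 → V x ≤ 1)
    (hU : ContDiffOn ℝ 2 U {0}ᶜ) (hW : ContDiffOn ℝ 2 W {0}ᶜ) (hw : ContDiffOn ℝ 2 w {0}ᶜ)
    (hUp : ∀ x, x ≠ 0 → 0 < U x) (hwp : ∀ x, x ≠ 0 → 0 < w x) (hUW : ∀ x, x ≠ 0 → U x < W x)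
    (hUe : ∀ x, x ≠ 0 → -lap U x = V x * U x ^ p)
    (hWe : ∀ x, x ≠ 0 → -lap W x = V x * W x ^ p)
    (hwe : ∀ x, x ≠ 0 → -lap w x = V x * w x ^ p)
    (hU0 : Tendsto (fun x : EuclideanSpace ℝ (Fin N) => U x * ‖x‖ ^ m) (𝓝[{0}ᶜ] 0) (𝓝 c))
    (hw0 : Tendsto (fun x : EuclideanSpace ℝ (Fin N) => w x * ‖x‖ ^ m) (𝓝[{0}ᶜ] 0) (𝓝 c))
    (hUi : Tendsto (fun x : EuclideanSpace ℝ (Fin N) => U x * ‖x‖ ^ M)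
      (Filter.comap (fun x => ‖x‖) Filter.atTop) (𝓝 ν))
    (hwi : Tendsto (fun x : EuclideanSpace ℝ (Fin N) => w x * ‖x‖ ^ M)
      (Filter.comap (fun x => ‖x‖) Filter.atTop) (𝓝 ν))
    (hWi : Tendsto (fun x : EuclideanSpace ℝ (Fin N) => W x * ‖x‖ ^ M)
      (Filter.comap (fun x => ‖x‖) Filter.atTop) (𝓝 ν2)) (hν : ν < ν2)
    {e : EuclideanSpace ℝ (Fin N)} (he : ‖e‖ = 1)
    (hbd : ∀ x, x ≠ 0 → inner ℝ e x = 0 → U x = w x) :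
    ∀ x, x ≠ 0 → 0 ≤ inner ℝ e x → U x ≤ w x := by
  obtain ⟨G, hGc, hGlow, hLG, ε, r, hε, hr, hGr⟩ := exists_superfun hM hm0 hmM hm2 hp hpm hc0 hc hVc
    hV0 hV1 hU hW hUp hUW hUe hWe hU0 he
  have hGpos : ∀ x, x ≠ 0 → 0 ≤ inner ℝ e x → 0 < G x := fun x hx hin =>
    lt_of_lt_of_le (sub_pos.mpr (hUW x hx)) (hGlow x hx hin)
  intro x1 hx1 hin1
  by_contra hcon
  push Not at hcon
  set s := (U x1 - w x1) / G x1 with hs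
  have hs0 : 0 < s := div_pos (sub_pos.mpr hcon) (hGpos x1 hx1 hin1)
  -- near zero
  have hz0 : Tendsto (fun x : EuclideanSpace ℝ (Fin N) => U x * ‖x‖ ^ m - w x * ‖x‖ ^ m)
      (𝓝[{0}ᶜ] 0) (𝓝 0) := by simpa using hU0.sub hw0
  obtain ⟨r1, hr1, hz1⟩ := ev_zero (hz0.eventually (gt_mem_nhds (mul_pos hs0 hε)))
  have hsmall : ∀ x, x ≠ 0 → 0 ≤ inner ℝ e x → ‖x‖ < min r r1 → U x - w x < s * G x := by
    intro x hx hin hxr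
    have hn : 0 < ‖x‖ := norm_pos_iff.mpr hx
    have h1 := hz1 x hx (lt_of_lt_of_le hxr (min_le_right _ _))
    have h2 := hGr x hx hin (lt_of_lt_of_le hxr (min_le_left _ _))
    have h3 : U x - w x = (U x * ‖x‖ ^ m - w x * ‖x‖ ^ m) * ‖x‖ ^ (-m) := by
      rw [← sub_mul, mul_assoc, ← Real.rpow_add hn]; simp
    calc U x - w x = (U x * ‖x‖ ^ m - w x * ‖x‖ ^ m) * ‖x‖ ^ (-m) := h3
      _ < (s * ε) * ‖x‖ ^ (-m) := mul_lt_mul_of_pos_right h1 (by positivity)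
      _ = s * (ε * ‖x‖ ^ (-m)) := by ring
      _ ≤ s * G x := mul_le_mul_of_nonneg_left h2 hs0.le
  -- near infinity
  have hzi : Tendsto (fun x : EuclideanSpace ℝ (Fin N) => s * (W x * ‖x‖ ^ M - U x * ‖x‖ ^ M) -
      (U x * ‖x‖ ^ M - w x * ‖x‖ ^ M))
      (Filter.comap (fun x => ‖x‖) Filter.atTop) (𝓝 (s * (ν2 - ν) - (ν - ν))) :=
    ((hWi.sub hUi).const_mul s).sub (hUi.sub hwi)
  have hpos2 : 0 < s * (ν2 - ν) - (ν - ν) := by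
    have := mul_pos hs0 (sub_pos.mpr hν)
    linarith
  obtain ⟨R1, hR1⟩ := ev_infty (hzi.eventually (lt_mem_nhds hpos2))
  have hbig : ∀ x, x ≠ 0 → 0 ≤ inner ℝ e x → R1 ≤ ‖x‖ → U x - w x < s * G x := by
    intro x hx hin hxr
    have hn : 0 < ‖x‖ := norm_pos_iff.mpr hx
    have h1 := hR1 x hxr
    have h2 := hGlow x hx hin
    have h3 : 0 < (s * (W x - U x) - (U x - w x)) * ‖x‖ ^ M := by
      refine h1.trans_eq ?_
      ring
    have h4 := pos_of_mul_pos_left h3 (by positivity)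
    have := mul_le_mul_of_nonneg_left h2 hs0.le
    linarith
  set ρ := min r r1 with hρ
  have hρ0 : 0 < ρ := lt_min hr hr1
  set K := {x : EuclideanSpace ℝ (Fin N) | ρ ≤ ‖x‖ ∧ ‖x‖ ≤ R1} ∩
    {x : EuclideanSpace ℝ (Fin N) | 0 ≤ inner ℝ e x} with hK
  have hKc : IsCompact K := (annulus_compact (N := N) ρ R1).inter_right
    (isClosed_le continuous_const (innerSL ℝ e).continuous)
  have hKne : ∀ x ∈ K, x ≠ 0 := fun x hx => norm_pos_iff.mp (lt_of_lt_of_le hρ0 hx.1.1)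
  have hs1 : s * G x1 = U x1 - w x1 := by
    rw [hs]; field_simp [(hGpos x1 hx1 hin1).ne']
  have hmemK : ∀ x, x ≠ 0 → 0 ≤ inner ℝ e x → s * G x ≤ U x - w x → x ∈ K := by
    intro x hx hin h
    refine ⟨⟨?_, ?_⟩, hin⟩
    · by_contra h'
      exact absurd (hsmall x hx hin (not_le.mp h')) (not_lt.mpr h)
    · by_contra h'
      exact absurd (hbig x hx hin (not_le.mp h').le) (not_lt.mpr h)
  have hx1K : x1 ∈ K := hmemK x1 hx1 hin1 hs1.le
  have hqc : ContinuousOn (fun x => (U x - w x) / G x) K := by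
    refine ContinuousOn.div ((hU.continuousOn.sub hw.continuousOn).mono hKne)
      (hGc.continuousOn.mono hKne) fun x hx => (hGpos x (hKne x hx) hx.2).ne'
  obtain ⟨x0, hx0K, hmax⟩ := hKc.exists_isMaxOn ⟨x1, hx1K⟩ hqc
  have hx0 := hKne x0 hx0K
  have hG0 := hGpos x0 hx0 hx0K.2
  set μ := (U x0 - w x0) / G x0 with hμ
  have hsμ : s ≤ μ := hmax hx1K
  have hμ0 : 0 < μ := lt_of_lt_of_le hs0 hsμ
  have hμ1 : μ * G x0 = U x0 - w x0 := by
    rw [hμ]; field_simp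
  have hall : ∀ x, x ≠ 0 → 0 ≤ inner ℝ e x → U x - w x ≤ μ * G x := by
    intro x hx hin
    have hGx := hGpos x hx hin
    by_contra h
    push Not at h
    have h1 : s * G x ≤ U x - w x :=
      (mul_le_mul_of_nonneg_right hsμ hGx.le).trans h.le
    have h2 : (U x - w x) / G x ≤ μ := hmax (hmemK x hx hin h1)
    rw [div_le_iff₀ hGx] at h2
    linarith
  have hUw0 : w x0 < U x0 := by
    have := mul_pos hμ0 hG0
    linarith
  have hin0 : 0 < inner ℝ e x0 := by
    rcases (show 0 ≤ inner ℝ e x0 from hx0K.2).lt_or_eq with h | h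
    · exact h
    · have := hbd x0 hx0 h.symm
      linarith
  have hGa := contDiffAt_of_off0 hGc hx0
  have hUa := contDiffAt_of_off0 hU hx0
  have hwa := contDiffAt_of_off0 hw hx0
  have hloc : IsLocalMax (fun x => (U x - w x) - μ * G x) x0 := by
    have hn : {x : EuclideanSpace ℝ (Fin N) | 0 < inner ℝ e x} ∈ 𝓝 x0 :=
      (isOpen_lt continuous_const (innerSL ℝ e).continuous).mem_nhds hin0
    filter_upwards [hn, isOpen_ne.mem_nhds hx0] with x hx hxne
    have := hall x hxne (le_of_lt hx)
    linarith
  have hlap := lap_nonpos_of_isLocalMax ((hUa.sub hwa).sub (contDiffAt_const.mul hGa)) hloc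
  rw [lap_sub (hUa.sub hwa) (contDiffAt_const.mul hGa), lap_sub hUa hwa, lap_const_mul _ hGa] at hlap
  have h1 := hUe x0 hx0
  have h2 := hwe x0 hx0
  have h3 := hLG x0 hx0 hx0K.2
  unfold Lop at h3
  have h4 := rpow_convex_le (hUp x0 hx0) (hwp x0 hx0) hp
  have h5 := mul_le_mul_of_nonneg_left h4 (hV0 x0 hx0).le
  have h6 := mul_pos hμ0 h3
  have h7 : V x0 * U x0 ^ p - V x0 * w x0 ^ p ≤ p * V x0 * U x0 ^ (p - 1) * (μ * G x0) := by
    rw [hμ1]; nlinarith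
  nlinarith

lemma radial_sym {p m M c ν ν2 : ℝ} (hM : M = (N:ℝ) - 2) (hm0 : 0 < m) (hmM : m < M)
    (hm2 : M < 2 * m) (hp : 1 < p) (hpm : p * m = m + 2) (hc0 : 0 < c)
    (hc : c ^ (p - 1) = m * (M - m)) {V W w : EuclideanSpace ℝ (Fin N) → ℝ}
    (hVc : ContinuousOn V {0}ᶜ)
    (hV0 : ∀ x, x ≠ 0 → 0 < V x) (hV1 : ∀ x, x ≠ 0 → V x ≤ 1)
    (hVr : ∀ x y : EuclideanSpace ℝ (Fin N), x ≠ 0 → ‖x‖ = ‖y‖ → V x = V y)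
    (hW : ContDiffOn ℝ 2 W {0}ᶜ) (hw : ContDiffOn ℝ 2 w {0}ᶜ)
    (hwp : ∀ x, x ≠ 0 → 0 < w x) (hwW : ∀ x, x ≠ 0 → w x < W x)
    (hWe : ∀ x, x ≠ 0 → -lap W x = V x * W x ^ p)
    (hwe : ∀ x, x ≠ 0 → -lap w x = V x * w x ^ p)
    (hw0 : Tendsto (fun x : EuclideanSpace ℝ (Fin N) => w x * ‖x‖ ^ m) (𝓝[{0}ᶜ] 0) (𝓝 c))
    (hwi : Tendsto (fun x : EuclideanSpace ℝ (Fin N) => w x * ‖x‖ ^ M)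
      (Filter.comap (fun x => ‖x‖) Filter.atTop) (𝓝 ν))
    (hWi : Tendsto (fun x : EuclideanSpace ℝ (Fin N) => W x * ‖x‖ ^ M)
      (Filter.comap (fun x => ‖x‖) Filter.atTop) (𝓝 ν2)) (hν : ν < ν2) :
    ∀ x y : EuclideanSpace ℝ (Fin N), x ≠ 0 → ‖x‖ = ‖y‖ → w x = w y := by
  have key : ∀ x y : EuclideanSpace ℝ (Fin N), x ≠ 0 → ‖x‖ = ‖y‖ → w y ≤ w x := by
    intro x y hx hxy
    rcases eq_or_ne x y with h | hne
    · rw [h]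
    have hd : 0 < ‖x - y‖ := norm_pos_iff.mpr (sub_ne_zero.mpr hne)
    set e : EuclideanSpace ℝ (Fin N) := ‖x - y‖⁻¹ • (x - y) with he
    have he1 : ‖e‖ = 1 := by rw [he, norm_smul]; field_simp; simp [hd.ne']
    let R := (ℝ ∙ (x - y))ᗮ.reflection
    have hRn : ∀ z, ‖R z‖ = ‖z‖ := fun z => R.norm_map z
    have hRne : ∀ z, z ≠ 0 → R z ≠ 0 := fun z hz => by
      rw [← norm_pos_iff, hRn]; exact norm_pos_iff.mpr hz
    have hRx : R x = y := Submodule.reflection_sub hxy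
    have hRc : ∀ f : EuclideanSpace ℝ (Fin N) → ℝ, ContDiffOn ℝ 2 f {0}ᶜ →
        ContDiffOn ℝ 2 (fun z => f (R z)) {0}ᶜ := fun f hf z hz =>
      ((contDiffAt_of_off0 hf (hRne z hz)).comp z R.contDiff.contDiffAt).contDiffWithinAt
    have hReq : ∀ f : EuclideanSpace ℝ (Fin N) → ℝ, ContDiffOn ℝ 2 f {0}ᶜ →
        (∀ x, x ≠ 0 → -lap f x = V x * f x ^ p) →
        ∀ z, z ≠ 0 → -lap (fun z => f (R z)) z = V z * f (R z) ^ p := by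
      intro f hf hfe z hz
      rw [lap_comp_isometry R (contDiffAt_of_off0 hf (hRne z hz)), hfe _ (hRne z hz),
        hVr (R z) z (hRne z hz) (hRn z)]
    have hRinf : ∀ (f : EuclideanSpace ℝ (Fin N) → ℝ) (k a : ℝ),
        Tendsto (fun x : EuclideanSpace ℝ (Fin N) => f x * ‖x‖ ^ k)
          (Filter.comap (fun x => ‖x‖) Filter.atTop) (𝓝 a) →
        Tendsto (fun x : EuclideanSpace ℝ (Fin N) => f (R x) * ‖x‖ ^ k)
          (Filter.comap (fun x => ‖x‖) Filter.atTop) (𝓝 a) := by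
      intro f k a hf
      have h1 : Tendsto (fun z => R z) (Filter.comap (fun x : EuclideanSpace ℝ (Fin N) => ‖x‖) Filter.atTop)
          (Filter.comap (fun x : EuclideanSpace ℝ (Fin N) => ‖x‖) Filter.atTop) := by
        rw [tendsto_comap_iff]
        refine tendsto_comap.congr fun z => (hRn z).symm
      refine (hf.comp h1).congr fun z => ?_
      simp [hRn]
    have hR0 : Tendsto (fun x : EuclideanSpace ℝ (Fin N) => w (R x) * ‖x‖ ^ m) (𝓝[{0}ᶜ] 0) (𝓝 c) := by
      have h1 : Tendsto (fun z => R z) (𝓝[{0}ᶜ] (0 : EuclideanSpace ℝ (Fin N))) (𝓝[{0}ᶜ] 0) := by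
        refine tendsto_nhdsWithin_of_tendsto_nhds_of_eventually_within _ ?_ ?_
        · have : Tendsto (fun z => R z) (𝓝 0) (𝓝 (R 0)) := R.continuous.tendsto 0
          rw [map_zero] at this
          exact this.mono_left nhdsWithin_le_nhds
        · filter_upwards [self_mem_nhdsWithin] with z hz using hRne z hz
      refine (hw0.comp h1).congr fun z => ?_
      simp [hRn]
    have hin : 0 ≤ inner ℝ e x := by
      rw [he, real_inner_smul_left, inner_sub_left, real_inner_self_eq_norm_sq]
      have := real_inner_le_norm y x
      rw [← hxy] at this
      have : 0 ≤ ‖x‖ ^ 2 - inner ℝ y x := by nlinarith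
      positivity
    have hfin := compare_half (U := fun z => w (R z)) (W := fun z => W (R z)) (w := w) (V := V)
      hM hm0 hmM hm2 hp hpm hc0 hc hVc hV0 hV1 (hRc w hw) (hRc W hW) hw
      (fun z hz => hwp _ (hRne z hz)) hwp (fun z hz => hwW _ (hRne z hz))
      (hReq w hw hwe) (hReq W hW hWe) hwe hR0 hw0 (hRinf w M ν hwi) hwi (hRinf W M ν2 hWi) hν he1
      (by
        intro z hz hez
        have hmem : z ∈ (ℝ ∙ (x - y))ᗮ := by
          rw [Submodule.mem_orthogonal_singleton_iff_inner_right]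
          rw [he, real_inner_smul_left] at hez
          rcases mul_eq_zero.mp hez with h | h
          · exact absurd h (by positivity)
          · exact h
        have : R z = z := Submodule.reflection_mem_subspace_eq_self hmem
        simp only [this]) x hx hin
    simpa [hRx] using hfin
  intro x y hx hxy
  have hy : y ≠ 0 := by rw [← norm_pos_iff, ← hxy]; exact norm_pos_iff.mpr hx
  exact le_antisymm (key y x hy hxy.symm) (key x y hx hxy)

end Cmp2

section ODE

/-- coefficient hypotheses -/
structure Coef (M p : ℝ) (v : ℝ → ℝ) : Prop where
  M0 : 0 < M
  p1 : 1 < p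
  vc : Continuous v
  va : Antitone v
  v0 : ∀ t, 0 < v t

/-- positive solution of `Y'' + M Y' + e^{2t} v Y^p = 0`. -/
structure Sol (M p : ℝ) (v Y Y1 : ℝ → ℝ) : Prop where
  pos : ∀ t, 0 < Y t
  d0 : ∀ t, HasDerivAt Y (Y1 t) t
  d1 : ∀ t, HasDerivAt Y1 (-M * Y1 t - exp (2 * t) * v t * Y t ^ p) t

lemma hasDerivAt_expc (k t : ℝ) : HasDerivAt (fun s => exp (k * s)) (exp (k * t) * k) t := by
  simpa using ((hasDerivAt_id t).const_mul k).exp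

lemma antitone_of_hasDerivAt {f f' : ℝ → ℝ} (h : ∀ t, HasDerivAt f (f' t) t) (h' : ∀ t, f' t ≤ 0) :
    Antitone f :=
  antitone_of_deriv_nonpos (fun t => (h t).differentiableAt) fun t => by rw [(h t).deriv]; exact h' t

lemma antitoneOn_of_hasDerivAt {f f' : ℝ → ℝ} {s : Set ℝ} (hs : Convex ℝ s)
    (h : ∀ t, HasDerivAt f (f' t) t) (h' : ∀ t ∈ s, f' t ≤ 0) : AntitoneOn f s :=
  antitoneOn_of_deriv_nonpos hs (fun t _ => (h t).continuousAt.continuousWithinAt)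
    (fun t _ => (h t).differentiableAt.differentiableWithinAt)
    fun t ht => by rw [(h t).deriv]; exact h' t (interior_subset ht)

/-- `(e^{Mt} f')' ≤ 0` and `f > 0` on `ℝ` gives `f' ≤ 0`. -/
lemma deriv_nonpos_of_super {M : ℝ} (hM : 0 < M) {f f1 f2 : ℝ → ℝ} (hpos : ∀ t, 0 < f t)
    (h0 : ∀ t, HasDerivAt f (f1 t) t) (h1 : ∀ t, HasDerivAt f1 (f2 t) t)
    (h2 : ∀ t, f2 t + M * f1 t ≤ 0) (t : ℝ) : f1 t ≤ 0 := by
  by_contra hcon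
  push Not at hcon
  have hF : Antitone (fun t => exp (M * t) * f1 t) :=
    antitone_of_hasDerivAt (fun t => (hasDerivAt_expc M t).fun_mul (h1 t)) fun t => by
      have := mul_nonpos_of_nonneg_of_nonpos (exp_pos (M * t)).le (h2 t)
      linarith
  have h3 : ∀ s, s ≤ t → f1 t ≤ f1 s := by
    intro s hs
    have h4 : exp (M * t) * f1 t ≤ exp (M * s) * f1 s := hF hs
    have h5 : exp (M * s) ≤ exp (M * t) := exp_le_exp.mpr (by nlinarith)
    have h6 : exp (M * s) * f1 t ≤ exp (M * s) * f1 s :=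
      (mul_le_mul_of_nonneg_right h5 hcon.le).trans h4
    exact le_of_mul_le_mul_left h6 (exp_pos _)
  have hG : AntitoneOn (fun s => f1 t * s - f s) (Iic t) :=
    antitoneOn_of_hasDerivAt (convex_Iic t)
      (fun s => ((hasDerivAt_id s).const_mul (f1 t)).sub (h0 s)) fun s hs => by
      have := h3 s hs
      simp only [mul_one]
      linarith
  set s := t - f t / f1 t with hs
  have hst : s ≤ t := by
    have : 0 < f t / f1 t := div_pos (hpos t) hcon
    linarith
  have h7 : f1 t * t - f t ≤ f1 t * s - f s := hG hst (le_refl t) hst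
  have h8 : f1 t * s = f1 t * t - f t := by rw [hs]; field_simp
  have := hpos s
  linarith

variable {M p : ℝ} {v Y Y1 Z Z1 : ℝ → ℝ}

lemma Sol.Y1_nonpos (hc : Coef M p v) (h : Sol M p v Y Y1) (t : ℝ) : Y1 t ≤ 0 :=
  deriv_nonpos_of_super hc.M0 h.pos h.d0 h.d1 (fun t => by
    have := h.pos t
    have := hc.v0 t
    have : 0 < exp (2 * t) * v t * Y t ^ p := by positivity
    linarith) t

lemma Sol.anti (hc : Coef M p v) (h : Sol M p v Y Y1) : Antitone Y :=
  antitone_of_hasDerivAt h.d0 (h.Y1_nonpos hc)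

lemma tendsto_exp_atBot' {k : ℝ} (hk : 0 < k) : Tendsto (fun s => exp (k * s)) atBot (𝓝 0) :=
  tendsto_exp_atBot.comp (tendsto_id.const_mul_atBot hk)

lemma Sol.O2 (hc : Coef M p v) (h : Sol M p v Y Y1) (t : ℝ) :
    exp (2 * t) * v t * Y t ^ p / (M + 2) ≤ - Y1 t := by
  have hM := hc.M0
  set A := v t * Y t ^ p / (M + 2) with hA
  have hF : ∀ s, HasDerivAt (fun s => exp (M * s) * Y1 s + A * exp ((M + 2) * s))
      (exp (M * s) * M * Y1 s + exp (M * s) * (-M * Y1 s - exp (2 * s) * v s * Y s ^ p) +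
        A * (exp ((M + 2) * s) * (M + 2))) s := fun s =>
    ((hasDerivAt_expc M s).fun_mul (h.d1 s)).fun_add ((hasDerivAt_expc (M + 2) s).const_mul A)
  have hF2 : AntitoneOn (fun s => exp (M * s) * Y1 s + A * exp ((M + 2) * s)) (Iic t) := by
    refine antitoneOn_of_hasDerivAt (convex_Iic t) hF fun s hs => ?_
    have e1 : exp ((M + 2) * s) = exp (M * s) * exp (2 * s) := by rw [← exp_add]; ring_nf
    have h1 : v t * Y t ^ p ≤ v s * Y s ^ p := by
      have hYt := h.pos t
      have := hc.v0 s
      exact mul_le_mul (hc.va hs) (Real.rpow_le_rpow hYt.le (h.anti hc hs) (by linarith [hc.p1]))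
        (by positivity) this.le
    have h2 : A * (M + 2) = v t * Y t ^ p := by rw [hA]; field_simp
    have : exp (M * s) * M * Y1 s + exp (M * s) * (-M * Y1 s - exp (2 * s) * v s * Y s ^ p) +
        A * (exp ((M + 2) * s) * (M + 2)) =
        exp (M * s) * exp (2 * s) * (v t * Y t ^ p - v s * Y s ^ p) := by
      rw [e1, ← h2]; ring
    rw [this]
    exact mul_nonpos_of_nonneg_of_nonpos (by positivity) (by linarith)
  have hle : exp (M * t) * Y1 t + A * exp ((M + 2) * t) ≤ 0 := by
    have hlim : Tendsto (fun s => A * exp ((M + 2) * s)) atBot (𝓝 (A * 0)) :=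
      (tendsto_exp_atBot' (by linarith)).const_mul A
    rw [mul_zero] at hlim
    refine ge_of_tendsto hlim ?_
    filter_upwards [eventually_le_atBot t] with s hs
    have h1 : exp (M * t) * Y1 t + A * exp ((M + 2) * t) ≤ exp (M * s) * Y1 s + A * exp ((M + 2) * s) :=
      hF2 hs (le_refl t) hs
    have := mul_nonpos_of_nonneg_of_nonpos (exp_pos (M * s)).le (h.Y1_nonpos hc s)
    linarith
  have e1 : exp ((M + 2) * t) = exp (M * t) * exp (2 * t) := by rw [← exp_add]; ring_nf
  have h3 : exp (M * t) * (Y1 t + A * exp (2 * t)) ≤ 0 := by rw [e1] at hle; linarith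
  have h4 : Y1 t + A * exp (2 * t) ≤ 0 := by
    by_contra h5
    have := mul_pos (exp_pos (M * t)) (not_le.mp h5)
    linarith
  have h5 : exp (2 * t) * v t * Y t ^ p / (M + 2) = A * exp (2 * t) := by rw [hA]; ring
  linarith

lemma rpow_pm {y p : ℝ} (hy : 0 < y) : y ^ p = y ^ (p - 1) * y := by
  rw [← Real.rpow_add_one hy.ne']; congr 1; ring

lemma Sol.O3 (hc : Coef M p v) (h : Sol M p v Y Y1) (t : ℝ) :
    exp (2 * t) * v t * Y t ^ (p - 1) ≤ 2 * (M + 2) / (p - 1) := by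
  have hM := hc.M0
  have hp := hc.p1
  set A := (p - 1) * v t / (2 * (M + 2)) with hA
  have hF : ∀ s, HasDerivAt (fun s => A * exp (2 * s) - Y s ^ (1 - p))
      (A * (exp (2 * s) * 2) - Y1 s * (1 - p) * Y s ^ (1 - p - 1)) s := fun s =>
    ((hasDerivAt_expc 2 s).const_mul A).fun_sub ((h.d0 s).rpow_const (Or.inl (h.pos s).ne'))
  have hF2 : AntitoneOn (fun s => A * exp (2 * s) - Y s ^ (1 - p)) (Iic t) := by
    refine antitoneOn_of_hasDerivAt (convex_Iic t) hF fun s hs => ?_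
    have hYs := h.pos s
    have h1 := h.O2 hc s
    have e1 : Y s ^ p * Y s ^ (1 - p - 1) = 1 := by
      rw [← Real.rpow_add hYs]; simp
    have h2 : exp (2 * s) * v t / (M + 2) ≤ - Y1 s * Y s ^ (1 - p - 1) := by
      have h3 : exp (2 * s) * v s / (M + 2) ≤ - Y1 s * Y s ^ (1 - p - 1) := by
        have := mul_le_mul_of_nonneg_right h1 (by positivity : 0 ≤ Y s ^ (1 - p - 1))
        calc exp (2 * s) * v s / (M + 2)
            = exp (2 * s) * v s / (M + 2) * (Y s ^ p * Y s ^ (1 - p - 1)) := by rw [e1, mul_one]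
          _ = exp (2 * s) * v s * Y s ^ p / (M + 2) * Y s ^ (1 - p - 1) := by ring
          _ ≤ _ := this
      refine le_trans ?_ h3
      have := hc.va hs
      gcongr
    have h4 : A * (exp (2 * s) * 2) = (p - 1) * (exp (2 * s) * v t / (M + 2)) := by
      rw [hA]; field_simp
    rw [h4]
    have := mul_le_mul_of_nonneg_left h2 (by linarith : 0 ≤ p - 1)
    linarith
  have hle : A * exp (2 * t) - Y t ^ (1 - p) ≤ 0 := by
    have hlim : Tendsto (fun s => A * exp (2 * s)) atBot (𝓝 (A * 0)) :=
      (tendsto_exp_atBot' (by norm_num)).const_mul A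
    rw [mul_zero] at hlim
    refine ge_of_tendsto hlim ?_
    filter_upwards [eventually_le_atBot t] with s hs
    have h1 : A * exp (2 * t) - Y t ^ (1 - p) ≤ A * exp (2 * s) - Y s ^ (1 - p) :=
      hF2 hs (le_refl t) hs
    have : 0 < Y s ^ (1 - p) := Real.rpow_pos_of_pos (h.pos s) _
    linarith
  have hYt := h.pos t
  have e2 : Y t ^ (1 - p) * Y t ^ (p - 1) = 1 := by
    rw [← Real.rpow_add hYt]; simp
  have h5 := mul_le_mul_of_nonneg_right hle (by positivity : 0 ≤ Y t ^ (p - 1))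
  rw [sub_mul, e2, zero_mul, hA] at h5
  rw [le_div_iff₀ (by linarith)]
  have h6 : (p - 1) * v t / (2 * (M + 2)) * exp (2 * t) * Y t ^ (p - 1) =
      (exp (2 * t) * v t * Y t ^ (p - 1) * (p - 1)) / (2 * (M + 2)) := by ring
  rw [h6, sub_nonpos, div_le_one (by positivity)] at h5
  exact h5

lemma Sol.O4 (hc : Coef M p v) (h : Sol M p v Y Y1) (t : ℝ) : 0 ≤ M * Y t + Y1 t := by
  have hM := hc.M0
  by_contra hcon
  push Not at hcon
  have hκ : Antitone (fun t => M * Y t + Y1 t) :=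
    antitone_of_hasDerivAt (fun t => ((h.d0 t).const_mul M).fun_add (h.d1 t)) fun t => by
      have := h.pos t
      have := hc.v0 t
      have : 0 < exp (2 * t) * v t * Y t ^ p := by positivity
      linarith
  set k := exp (M * t) * (M * Y t + Y1 t) with hk
  have hk0 : k < 0 := mul_neg_of_pos_of_neg (exp_pos _) hcon
  have hG : AntitoneOn (fun s => exp (M * s) * Y s - k * s) (Ici t) :=
    antitoneOn_of_hasDerivAt (convex_Ici t)
      (fun s => ((hasDerivAt_expc M s).fun_mul (h.d0 s)).fun_sub ((hasDerivAt_id s).const_mul k))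
      fun s hs => by
      have h1 : M * Y s + Y1 s ≤ M * Y t + Y1 t := hκ hs
      have h2 : exp (M * t) ≤ exp (M * s) := exp_le_exp.mpr (mul_le_mul_of_nonneg_left hs hM.le)
      have h3 : exp (M * s) * (M * Y s + Y1 s) ≤ k :=
        calc exp (M * s) * (M * Y s + Y1 s) ≤ exp (M * s) * (M * Y t + Y1 t) :=
              mul_le_mul_of_nonneg_left h1 (exp_pos _).le
          _ ≤ k := mul_le_mul_of_nonpos_right h2 hcon.le
      simp only [mul_one]
      linarith
  set s := t + exp (M * t) * Y t / (-k) with hs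
  have hYt := h.pos t
  have hst : t ≤ s := by
    have : 0 < exp (M * t) * Y t / (-k) := div_pos (by positivity) (by linarith)
    linarith
  have h7 : exp (M * s) * Y s - k * s ≤ exp (M * t) * Y t - k * t := hG (le_refl t) hst hst
  have h8 : k * s = k * t - exp (M * t) * Y t := by
    rw [hs]; field_simp [hk0.ne]; ring
  have : 0 < exp (M * s) * Y s := mul_pos (exp_pos _) (h.pos s)
  linarith

/-- logarithmic derivative -/
def bb (Y Y1 : ℝ → ℝ) (t : ℝ) : ℝ := -Y1 t / Y t

/-- the coefficient `q Y^{p-1}` -/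
def cc (p : ℝ) (v Y : ℝ → ℝ) (t : ℝ) : ℝ := exp (2 * t) * v t * Y t ^ (p - 1)

lemma Sol.b_nonneg (hc : Coef M p v) (h : Sol M p v Y Y1) (t : ℝ) : 0 ≤ bb Y Y1 t :=
  div_nonneg (by linarith [h.Y1_nonpos hc t]) (h.pos t).le

lemma Sol.b_le (hc : Coef M p v) (h : Sol M p v Y Y1) (t : ℝ) : bb Y Y1 t ≤ M := by
  unfold bb
  rw [div_le_iff₀ (h.pos t)]
  linarith [h.O4 hc t]

lemma Sol.c_pos (hc : Coef M p v) (h : Sol M p v Y Y1) (t : ℝ) : 0 < cc p v Y t := by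
  have := h.pos t
  have := hc.v0 t
  unfold cc; positivity

lemma Sol.db (h : Sol M p v Y Y1) (t : ℝ) :
    HasDerivAt (bb Y Y1) (bb Y Y1 t ^ 2 - M * bb Y Y1 t + cc p v Y t) t := by
  have hY := h.pos t
  have h1 := (h.d1 t).fun_neg.fun_div (h.d0 t) hY.ne'
  refine HasDerivAt.congr_deriv (f := bb Y Y1) h1 ?_
  unfold bb cc
  rw [rpow_pm (p := p) hY]
  field_simp
  ring

lemma Sol.Y1_eq (h : Sol M p v Y Y1) (t : ℝ) : Y1 t = - bb Y Y1 t * Y t := by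
  unfold bb; field_simp [(h.pos t).ne']

end ODE

section ODE2

/-- an ordered pair of fast decaying solutions -/
structure Pair (M p : ℝ) (v Y Y1 Z Z1 : ℝ → ℝ) (ν ν2 : ℝ) : Prop where
  co : Coef M p v
  sY : Sol M p v Y Y1
  sZ : Sol M p v Z Z1
  lt : ∀ t, Y t < Z t
  lY : Tendsto (fun t => Y t * exp (M * t)) atTop (𝓝 ν)
  lZ : Tendsto (fun t => Z t * exp (M * t)) atTop (𝓝 ν2)
  hν : ν < ν2

variable {M p ν ν2 : ℝ} {v Y Y1 Z Z1 : ℝ → ℝ}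

/-- log derivative of the difference -/
def aa (Y Y1 Z Z1 : ℝ → ℝ) (t : ℝ) : ℝ := -(Z1 t - Y1 t) / (Z t - Y t)

/-- `e = p b - a` -/
def ee (p : ℝ) (Y Y1 Z Z1 : ℝ → ℝ) (t : ℝ) : ℝ := p * bb Y Y1 t - aa Y Y1 Z Z1 t

lemma Pair.da (h : Pair M p v Y Y1 Z Z1 ν ν2) (t : ℝ) :
    HasDerivAt (aa Y Y1 Z Z1) (aa Y Y1 Z Z1 t ^ 2 - M * aa Y Y1 Z Z1 t +
      exp (2 * t) * v t * (Z t ^ p - Y t ^ p) / (Z t - Y t)) t := by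
  have hpos : 0 < Z t - Y t := sub_pos.mpr (h.lt t)
  have h1 := ((h.sZ.d1 t).fun_sub (h.sY.d1 t)).fun_neg.fun_div
    ((h.sZ.d0 t).fun_sub (h.sY.d0 t)) hpos.ne'
  refine HasDerivAt.congr_deriv (f := aa Y Y1 Z Z1) h1 ?_
  unfold aa
  field_simp
  ring

lemma Pair.a_nonneg (h : Pair M p v Y Y1 Z Z1 ν ν2) (t : ℝ) : 0 ≤ aa Y Y1 Z Z1 t := by
  have hpos : ∀ t, 0 < Z t - Y t := fun t => sub_pos.mpr (h.lt t)
  have h1 := deriv_nonpos_of_super h.co.M0 hpos (fun t => (h.sZ.d0 t).fun_sub (h.sY.d0 t))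
    (fun t => (h.sZ.d1 t).fun_sub (h.sY.d1 t)) (fun t => by
      have h2 : Y t ^ p ≤ Z t ^ p :=
        Real.rpow_le_rpow (h.sY.pos t).le (h.lt t).le (by linarith [h.co.p1])
      have h3 := h.co.v0 t
      have : exp (2 * t) * v t * Y t ^ p ≤ exp (2 * t) * v t * Z t ^ p := by gcongr
      linarith) t
  exact div_nonneg (by linarith) (hpos t).le

lemma Pair.de (h : Pair M p v Y Y1 Z Z1 ν ν2) (t : ℝ) :
    ∃ D : ℝ, HasDerivAt (ee p Y Y1 Z Z1) D t ∧
      D ≤ -(ee p Y Y1 Z Z1 t ^ 2 + (M - 2 * p * bb Y Y1 t) * ee p Y Y1 Z Z1 t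
        + p * (p - 1) * bb Y Y1 t ^ 2) := by
  refine ⟨_, ((h.sY.db t).const_mul p).fun_sub (h.da t), ?_⟩
  have hpos : 0 < Z t - Y t := sub_pos.mpr (h.lt t)
  have hY := h.sY.pos t
  have hv := h.co.v0 t
  have h1 := rpow_convex_le hY (hY.trans (h.lt t)) h.co.p1
  have h2 : p * cc p v Y t ≤ exp (2 * t) * v t * (Z t ^ p - Y t ^ p) / (Z t - Y t) := by
    rw [le_div_iff₀ hpos]
    have : exp (2 * t) * v t * (p * Y t ^ (p - 1) * (Z t - Y t)) ≤
      exp (2 * t) * v t * (Z t ^ p - Y t ^ p) := by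
      apply mul_le_mul_of_nonneg_left _ (by positivity)
      linarith
    unfold cc
    linarith
  unfold ee
  nlinarith

lemma Pair.e_nonneg (h : Pair M p v Y Y1 Z Z1 ν ν2) (t0 : ℝ) : 0 ≤ ee p Y Y1 Z Z1 t0 := by
  by_contra hcon
  push Not at hcon
  have hp := h.co.p1
  have hM := h.co.M0
  choose D hD hD2 using h.de
  set e := ee p Y Y1 Z Z1 with he
  set b := bb Y Y1 with hb
  -- `F = e * (e^{Mt} Y^{2p})` is antitone
  have hw : ∀ t, HasDerivAt (fun t => exp (M * t) * Y t ^ (2 * p))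
      ((M - 2 * p * b t) * (exp (M * t) * Y t ^ (2 * p))) t := by
    intro t
    have hY := h.sY.pos t
    have h1 := (hasDerivAt_expc M t).fun_mul ((h.sY.d0 t).rpow_const (p := 2 * p) (Or.inl hY.ne'))
    refine h1.congr_deriv ?_
    rw [h.sY.Y1_eq, rpow_pm (p := 2 * p) hY]
    ring
  have hF : Antitone (fun t => e t * (exp (M * t) * Y t ^ (2 * p))) := by
    refine antitone_of_hasDerivAt (fun t => (hD t).fun_mul (hw t)) fun t => ?_
    have hpos : 0 < exp (M * t) * Y t ^ (2 * p) := by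
      have := h.sY.pos t
      positivity
    have h1 : D t + (M - 2 * p * b t) * e t ≤ 0 := by
      have := hD2 t
      have : 0 ≤ p * (p - 1) * b t ^ 2 := by
        have : 0 < p - 1 := by linarith
        positivity
      nlinarith [sq_nonneg (e t)]
    nlinarith
  have hneg : ∀ t, t0 ≤ t → e t < 0 := by
    intro t ht
    have h1 : e t * (exp (M * t) * Y t ^ (2 * p)) ≤ e t0 * (exp (M * t0) * Y t0 ^ (2 * p)) := hF ht
    have hpos : ∀ t, 0 < exp (M * t) * Y t ^ (2 * p) := fun t => by
      have := h.sY.pos t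
      positivity
    have h2 := mul_neg_of_neg_of_pos hcon (hpos t0)
    by_contra h3
    have := mul_nonneg (not_lt.mp h3) (hpos t).le
    linarith
  -- `g = Y^p/(Z-Y)` increasing
  have hg : ∀ t, HasDerivAt (fun t => -(Y t ^ p / (Z t - Y t)))
      (e t * (Y t ^ p / (Z t - Y t))) t := by
    intro t
    have hY := h.sY.pos t
    have hpos : 0 < Z t - Y t := sub_pos.mpr (h.lt t)
    have h1 := (((h.sY.d0 t).rpow_const (p := p) (Or.inl hY.ne')).fun_div
      ((h.sZ.d0 t).fun_sub (h.sY.d0 t)) hpos.ne').fun_neg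
    refine h1.congr_deriv ?_
    rw [he]
    unfold ee aa bb
    rw [rpow_pm (p := p) hY]
    field_simp
    ring
  have hga : AntitoneOn (fun t => -(Y t ^ p / (Z t - Y t))) (Ici t0) :=
    antitoneOn_of_hasDerivAt (convex_Ici t0) hg fun t ht => by
      have hY := h.sY.pos t
      have hpos : 0 < Z t - Y t := sub_pos.mpr (h.lt t)
      exact mul_nonpos_of_nonpos_of_nonneg (hneg t ht).le (by positivity)
  have hlim : Tendsto (fun t => (Y t * exp (M * t)) ^ p / (Z t * exp (M * t) - Y t * exp (M * t))
      * exp (-(M * (p - 1)) * t)) atTop (𝓝 (ν ^ p / (ν2 - ν) * 0)) := by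
    have hν := h.hν
    have h1 : Tendsto (fun t => (Y t * exp (M * t)) ^ p) atTop (𝓝 (ν ^ p)) :=
      h.lY.rpow_const (Or.inr (by linarith))
    refine (h1.div (h.lZ.sub h.lY) (by linarith)).mul ?_
    refine tendsto_exp_atBot.comp ?_
    have : 0 < M * (p - 1) := mul_pos hM (by linarith)
    exact tendsto_id.const_mul_atTop_of_neg (by linarith)
  rw [mul_zero] at hlim
  have hge : Y t0 ^ p / (Z t0 - Y t0) ≤ 0 := by
    refine ge_of_tendsto hlim ?_
    filter_upwards [eventually_ge_atTop t0] with t ht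
    have h1 : -(Y t ^ p / (Z t - Y t)) ≤ -(Y t0 ^ p / (Z t0 - Y t0)) := hga (le_refl t0) ht ht
    have hpos : 0 < Z t - Y t := sub_pos.mpr (h.lt t)
    have hY := h.sY.pos t
    have h2 : (Y t * exp (M * t)) ^ p / (Z t * exp (M * t) - Y t * exp (M * t))
      * exp (-(M * (p - 1)) * t) = Y t ^ p / (Z t - Y t) := by
      rw [Real.mul_rpow hY.le (exp_pos _).le, ← Real.exp_mul, ← sub_mul,
        show exp (M * t * p) = exp (M * t) * exp (M * (p - 1) * t) by rw [← exp_add]; ring_nf,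
        show -(M * (p - 1)) * t = -(M * (p - 1) * t) by ring, exp_neg]
      field_simp
    rw [h2]
    linarith
  have hpos : 0 < Z t0 - Y t0 := sub_pos.mpr (h.lt t0)
  have hY := h.sY.pos t0
  have : 0 < Y t0 ^ p / (Z t0 - Y t0) := by positivity
  linarith

lemma Pair.e_le (h : Pair M p v Y Y1 Z Z1 ν ν2) (t : ℝ) : ee p Y Y1 Z Z1 t ≤ p * M := by
  have h1 := h.a_nonneg t
  have h2 := h.sY.b_le h.co t
  have := mul_le_mul_of_nonneg_left h2 (by linarith [h.co.p1] : 0 ≤ p)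
  unfold ee
  linarith

/-- `b` must exceed any level below `M` arbitrarily late. -/
lemma Pair.b_exceeds (h : Pair M p v Y Y1 Z Z1 ν ν2) {k : ℝ} (hk : k < M) (t0 : ℝ) :
    ∃ t, t0 ≤ t ∧ k < bb Y Y1 t := by
  by_contra hcon
  push Not at hcon
  have hd : ∀ t, HasDerivAt (fun t => -(Y t * exp (k * t)))
      (-((k - bb Y Y1 t) * (Y t * exp (k * t)))) t := by
    intro t
    refine ((h.sY.d0 t).fun_mul (hasDerivAt_expc k t)).fun_neg.congr_deriv ?_
    rw [h.sY.Y1_eq]; ring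
  have ha : AntitoneOn (fun t => -(Y t * exp (k * t))) (Ici t0) :=
    antitoneOn_of_hasDerivAt (convex_Ici t0) hd fun t ht => by
      have hY := h.sY.pos t
      have := mul_nonneg (sub_nonneg.mpr (hcon t ht)) (by positivity : 0 ≤ Y t * exp (k * t))
      linarith
  have hY0 := h.sY.pos t0
  have htop : Tendsto (fun t => Y t0 * exp (k * t0) * exp ((M - k) * t)) atTop atTop :=
    (tendsto_exp_atTop.comp (tendsto_id.const_mul_atTop (by linarith))).const_mul_atTop
      (by positivity)
  have htop2 : Tendsto (fun t => Y t * exp (M * t)) atTop atTop := by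
    refine tendsto_atTop_mono' _ ?_ htop
    filter_upwards [eventually_ge_atTop t0] with t ht
    have h1 : -(Y t * exp (k * t)) ≤ -(Y t0 * exp (k * t0)) := ha (le_refl t0) ht ht
    have e1 : exp (M * t) = exp (k * t) * exp ((M - k) * t) := by rw [← exp_add]; ring_nf
    rw [e1, ← mul_assoc]
    exact mul_le_mul_of_nonneg_right (by linarith) (exp_pos _).le
  exact not_tendsto_nhds_of_tendsto_atTop htop2 _ h.lY

/-- uniform waiting time -/
lemma exists_T0 {M p : ℝ} (hM : 0 < M) (hp : 1 < p) : ∃ T0 : ℝ, 0 < T0 ∧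
    ∀ (v Y Y1 Z Z1 : ℝ → ℝ) (ν ν2 : ℝ), Pair M p v Y Y1 Z Z1 ν ν2 → ∀ t1 : ℝ,
      ∃ t, t1 ≤ t ∧ t ≤ t1 + T0 ∧ M / (4 * p) < bb Y Y1 t := by
  set β := M / (4 * p) with hβ
  have hp0 : 0 < p - 1 := by linarith
  have hβ0 : 0 < β := by positivity
  have h4 : 4 * p * β = M := by rw [hβ]; field_simp
  set C0 := 2 * (M + 2) / (p - 1) with hC0
  have hC00 : 0 < C0 := by positivity
  set k := p * (p - 1) / (3 * C0) with hk
  have hk0 : 0 < k := by positivity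
  have htend : Tendsto (fun T => p * M * exp (-(M / 2) * T)) atTop (𝓝 (p * M * 0)) :=
    (tendsto_exp_atBot.comp (tendsto_id.const_mul_atTop_of_neg (by linarith))).const_mul _
  rw [mul_zero] at htend
  obtain ⟨T0, hT0, hTpos⟩ := ((htend.eventually (gt_mem_nhds (by positivity : 0 < 7 * k * β ^ 3))).and
    (eventually_gt_atTop 0)).exists
  refine ⟨T0, hTpos, ?_⟩
  intro v Y Y1 Z Z1 ν ν2 h t1
  by_contra hcon
  push Not at hcon
  choose D hD hD2 using h.de
  have he0 := h.e_nonneg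
  set e := ee p Y Y1 Z Z1 with he
  set b := bb Y Y1 with hb
  have hb0 : ∀ t, 0 ≤ b t := h.sY.b_nonneg h.co
  have hbM : ∀ t, b t ≤ M := h.sY.b_le h.co
  set t4 := t1 + T0 with ht4
  have h14 : t1 ≤ t4 := by linarith
  -- decay of e
  have hdec : e t4 < 7 * k * β ^ 3 := by
    have ha : AntitoneOn (fun t => e t * exp (M / 2 * t)) (Icc t1 t4) := by
      refine antitoneOn_of_hasDerivAt (convex_Icc t1 t4)
        (fun t => (hD t).fun_mul (hasDerivAt_expc (M / 2) t)) fun t ht => ?_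
      have h1 := hcon t ht.1 ht.2
      have h2 : D t + M / 2 * e t ≤ 0 := by
        have h3 := hD2 t
        have h5 : 0 ≤ p * (p - 1) * b t ^ 2 := by positivity
        have h6 : 2 * p * b t ≤ M / 2 := by nlinarith
        have := mul_nonneg (sub_nonneg.mpr h6) (he0 t)
        nlinarith [sq_nonneg (e t)]
      have := mul_nonpos_of_nonneg_of_nonpos (exp_pos (M / 2 * t)).le h2
      linarith
    have h1 : e t4 * exp (M / 2 * t4) ≤ e t1 * exp (M / 2 * t1) :=
      ha ⟨le_refl _, h14⟩ ⟨h14, le_refl _⟩ h14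
    have h2 : e t1 ≤ p * M := h.e_le t1
    have e1 : exp (M / 2 * t1) = exp (M / 2 * t4) * exp (-(M / 2) * T0) := by
      rw [← exp_add, ht4]; ring_nf
    have h3 : e t4 ≤ e t1 * exp (-(M / 2) * T0) := by
      rw [e1] at h1
      have : e t4 * exp (M / 2 * t4) ≤ (e t1 * exp (-(M / 2) * T0)) * exp (M / 2 * t4) := by
        linarith
      exact le_of_mul_le_mul_right this (exp_pos _)
    have := mul_le_mul_of_nonneg_right h2 (exp_pos (-(M / 2) * T0)).le
    linarith
  -- first time reaching 2β
  have hbc : Continuous b := continuous_iff_continuousAt.mpr fun t => (h.sY.db t).continuousAt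
  set S := {t : ℝ | t4 ≤ t ∧ 2 * β ≤ b t} with hS
  have hSc : IsClosed S := (isClosed_le continuous_const continuous_id).inter
    (isClosed_le continuous_const hbc)
  have hSne : S.Nonempty := by
    obtain ⟨t, ht, ht2⟩ := h.b_exceeds (k := 2 * β) (by nlinarith) t4
    exact ⟨t, ht, ht2.le⟩
  have hSb : BddBelow S := ⟨t4, fun t ht => ht.1⟩
  set t3 := sInf S with ht3
  have ht3S : t3 ∈ S := hSc.csInf_mem hSne hSb
  have hlt : ∀ t, t4 ≤ t → t < t3 → b t < 2 * β := by
    intro t ht htt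
    by_contra hc
    exact absurd (csInf_le hSb (⟨ht, not_lt.mp hc⟩ : t ∈ S)) (not_le.mpr htt)
  have hQ : AntitoneOn (fun t => e t + k * b t ^ 3) (Icc t4 t3) := by
    refine antitoneOn_of_deriv_nonpos (convex_Icc t4 t3) ?_ ?_ ?_
    · intro t _
      exact ((hD t).continuousAt.add (continuousAt_const.mul
        ((h.sY.db t).continuousAt.pow 3))).continuousWithinAt
    · intro t _
      exact ((hD t).differentiableAt.add ((h.sY.db t).differentiableAt.pow 3 |>.const_mul k)).differentiableWithinAt
    · intro t ht
      rw [interior_Icc] at ht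
      have hder := (hD t).fun_add (((h.sY.db t).fun_pow 3).const_mul k)
      rw [hder.deriv]
      have h1 := (hlt t ht.1.le ht.2).le
      have h2 := hD2 t
      have h3 : bb Y Y1 t ^ 2 - M * bb Y Y1 t + cc p v Y t ≤ C0 := by
        have h5 : cc p v Y t ≤ C0 := h.sY.O3 h.co t
        have := hb0 t
        have := hbM t
        have : b t ^ 2 - M * b t ≤ 0 := by nlinarith
        have h6 : b t = bb Y Y1 t := rfl
        rw [h6] at this
        linarith
      have h5 : k * (3 * b t ^ 2 * C0) = p * (p - 1) * b t ^ 2 := by rw [hk]; field_simp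
      have h6 : k * (3 * b t ^ 2 * (bb Y Y1 t ^ 2 - M * bb Y Y1 t + cc p v Y t)) ≤
          k * (3 * b t ^ 2 * C0) := by
        apply mul_le_mul_of_nonneg_left _ hk0.le
        exact mul_le_mul_of_nonneg_left h3 (by positivity)
      have h7 : 0 ≤ (M - 2 * p * b t) * e t := by
        apply mul_nonneg _ (he0 t)
        nlinarith
      have h8 : ((3:ℕ):ℝ) = 3 := by norm_num
      have h9 : bb Y Y1 t ^ (3 - 1) = b t ^ 2 := by norm_num [hb]
      rw [h8, h9]
      have := sq_nonneg (e t)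
      linarith
  have h43 : t4 ≤ t3 := ht3S.1
  have h1 : e t3 + k * b t3 ^ 3 ≤ e t4 + k * b t4 ^ 3 :=
    hQ ⟨le_refl _, h43⟩ ⟨h43, le_refl _⟩ h43
  have h2 : (2 * β) ^ 3 ≤ b t3 ^ 3 := pow_le_pow_left₀ (by positivity) ht3S.2 3
  have h3 : b t4 ^ 3 ≤ β ^ 3 := pow_le_pow_left₀ (hb0 t4) (hcon t4 h14 (le_refl _)) 3
  have h5 := mul_le_mul_of_nonneg_left h2 hk0.le
  have h6 := mul_le_mul_of_nonneg_left h3 hk0.le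
  have := he0 t3
  nlinarith

end ODE2

section ODE3

/-- barrier: if `f t1 ≤ L` and `f' < 0` whenever `f = L` then `f ≤ L` later. -/
lemma barrier_le {f f' : ℝ → ℝ} {L t1 t2 : ℝ} (h : ∀ t, HasDerivAt f (f' t) t) (h0 : f t1 ≤ L)
    (hb : ∀ t, t1 ≤ t → t < t2 → f t = L → f' t < 0) : ∀ t, t1 ≤ t → t ≤ t2 → f t ≤ L := by
  intro t ht1 ht2
  exact image_le_of_deriv_right_lt_deriv_boundary' (f := f) (f' := f') (a := t1) (b := t2)
    (B := fun _ => L) (B' := fun _ => 0)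
    (fun s _ => (h s).continuousAt.continuousWithinAt) (fun s _ => (h s).hasDerivWithinAt) h0
    continuousOn_const (fun s _ => hasDerivWithinAt_const _ _ _)
    (fun s hs hs2 => hb s hs.1 hs.2 hs2) ⟨ht1, ht2⟩

lemma exists_T1 {M p σ0 : ℝ} (hM : 0 < M) (hp : 1 < p) (hσ : 0 < σ0) (hσ2 : σ0 ≤ M / 2) :
    ∃ c1 T1 : ℝ, 0 < c1 ∧ 0 < T1 ∧
    ∀ (v Y Y1 Z Z1 : ℝ → ℝ) (ν ν2 : ℝ), Pair M p v Y Y1 Z Z1 ν ν2 → ∀ t1 : ℝ,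
      (∀ t, t1 ≤ t → t ≤ t1 + T1 → cc p v Y t ≤ c1) → M - σ0 < bb Y Y1 t1 := by
  obtain ⟨T0, hT0, hT⟩ := exists_T0 hM hp
  set β := M / (4 * p) with hβ
  have hβ0 : 0 < β := by positivity
  have h4 : 4 * p * β = M := by rw [hβ]; field_simp
  have hβM : β < M / 4 := by nlinarith
  set c1 := min (β * (M - β)) ((M - σ0) * σ0) / 2 with hc1
  have hc10 : 0 < c1 := by
    rw [hc1]
    have h1 : 0 < β * (M - β) := mul_pos hβ0 (by linarith)
    have h2 : 0 < (M - σ0) * σ0 := mul_pos (by linarith) hσ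
    have := lt_min h1 h2
    linarith
  have hlow : ∀ x, β ≤ x → x ≤ M - σ0 → 2 * c1 ≤ x * (M - x) := by
    intro x h1 h2
    have h3 : min (β * (M - β)) ((M - σ0) * σ0) ≤ x * (M - x) := by
      rcases le_total x (M / 2) with h | h
      · refine (min_le_left _ _).trans ?_
        nlinarith
      · refine (min_le_right _ _).trans ?_
        nlinarith
    rw [hc1]; linarith
  refine ⟨c1, M / c1 + T0, hc10, by positivity, ?_⟩
  intro v Y Y1 Z Z1 ν ν2 h t1 hcc
  by_contra hcon
  push Not at hcon
  have hb0 : ∀ t, 0 ≤ bb Y Y1 t := h.sY.b_nonneg h.co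
  have hder := h.sY.db
  have hMc : 0 < M / c1 := by positivity
  have hb1 : ∀ t, t1 ≤ t → t ≤ t1 + (M / c1 + T0) → bb Y Y1 t ≤ M - σ0 := by
    refine barrier_le hder hcon fun t h1 h2 h3 => ?_
    have h5 := hlow (M - σ0) (by linarith) le_rfl
    have h6 := hcc t h1 h2.le
    rw [h3]
    nlinarith
  have hex : ∃ t, t1 ≤ t ∧ t ≤ t1 + M / c1 ∧ bb Y Y1 t ≤ β := by
    by_contra hno
    push Not at hno
    have ha : AntitoneOn (fun t => bb Y Y1 t + c1 * t) (Icc t1 (t1 + M / c1)) := by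
      refine antitoneOn_of_hasDerivAt (convex_Icc _ _)
        (fun t => (hder t).fun_add ((hasDerivAt_id t).const_mul c1)) fun t ht => ?_
      have h1 := hno t ht.1 ht.2
      have h2 := hlow _ h1.le (hb1 t ht.1 (by linarith [ht.2]))
      have h3 := hcc t ht.1 (by linarith [ht.2])
      simp only [mul_one]
      nlinarith
    have h1 : bb Y Y1 (t1 + M / c1) + c1 * (t1 + M / c1) ≤ bb Y Y1 t1 + c1 * t1 :=
      ha ⟨le_rfl, by linarith⟩ ⟨by linarith, le_rfl⟩ (by linarith)
    have h2 : c1 * (t1 + M / c1) = c1 * t1 + M := by field_simp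
    have := hb0 (t1 + M / c1)
    linarith
  obtain ⟨t2, ht21, ht22, ht2b⟩ := hex
  have hb2 : ∀ t, t2 ≤ t → t ≤ t1 + (M / c1 + T0) → bb Y Y1 t ≤ β := by
    refine barrier_le hder ht2b fun t h1 h2 h3 => ?_
    have h5 := hlow β le_rfl (by linarith)
    have h6 := hcc t (by linarith) h2.le
    rw [h3]
    nlinarith
  obtain ⟨t, ha, hb, hc⟩ := hT v Y Y1 Z Z1 ν ν2 h t2
  have := hb2 t ha (by linarith)
  linarith

/-- uniform lower bound mechanism -/
lemma lower_mech {M p α γ m' : ℝ} (hM : 0 < M) (hp : 1 < p) (hγ : 0 < γ) (hm0 : 0 < m')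
    (hmM : m' < M) (hm : m' * (p - 1) = 2 + α) :
    ∃ ε0 K : ℝ, 0 < ε0 ∧ 
    ∀ (v Y Y1 Z Z1 : ℝ → ℝ) (ν ν2 : ℝ), Pair M p v Y Y1 Z Z1 ν ν2 →
      (∀ t, 0 ≤ t → v t ≤ γ * exp (α * t)) → ∀ t1 : ℝ, 0 ≤ t1 →
      Y t1 * exp (m' * t1) ≤ ε0 → ν ≤ K * exp (M * t1) * Y t1 := by
  set d := M - m' with hd
  have hd0 : 0 < d := by rw [hd]; linarith
  set σ0 := d / 2 with hσ0
  have hp0 : 0 < p - 1 := by linarith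
  obtain ⟨c1, T1, hc1, hT1, hT⟩ := exists_T1 (σ0 := σ0) hM hp (by positivity) (by rw [hσ0, hd]; linarith)
  set ε0 := (c1 / γ) ^ (1 / (p - 1)) * exp (-(m' * T1)) with hε0
  have hε00 : 0 < ε0 := by positivity
  have hMσ : 0 < M - σ0 := by rw [hσ0, hd]; linarith
  set k := σ0 * (p - 1) with hk
  have hk0 : 0 < k := by positivity
  refine ⟨ε0, exp ((σ0 + γ * ε0 ^ (p - 1) / k) / (M - σ0)), hε00, ?_⟩
  intro v Y Y1 Z Z1 ν ν2 h hv
  have hcw : ∀ t, 0 ≤ t → cc p v Y t ≤ γ * (Y t * exp (m' * t)) ^ (p - 1) := by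
    intro t ht
    have hY := h.sY.pos t
    rw [Real.mul_rpow hY.le (exp_pos _).le, ← Real.exp_mul,
      show m' * t * (p - 1) = 2 * t + α * t by rw [mul_right_comm, hm]; ring, exp_add]
    unfold cc
    have := mul_le_mul_of_nonneg_left (hv t ht) (by positivity : 0 ≤ exp (2 * t) * Y t ^ (p - 1))
    linarith
  have hdw : ∀ t, HasDerivAt (fun t => Y t * exp (m' * t))
      ((m' - bb Y Y1 t) * (Y t * exp (m' * t))) t := by
    intro t
    refine ((h.sY.d0 t).fun_mul (hasDerivAt_expc m' t)).congr_deriv ?_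
    rw [h.sY.Y1_eq]; ring
  have hstep : ∀ t1, 0 ≤ t1 → Y t1 * exp (m' * t1) ≤ ε0 → M - σ0 < bb Y Y1 t1 := by
    intro t1 ht1 hw1
    refine hT v Y Y1 Z Z1 ν ν2 h t1 fun t h1 h2 => ?_
    refine (hcw t (by linarith)).trans ?_
    have hY := h.sY.pos t
    have h3 : Y t * exp (m' * t) ≤ (c1 / γ) ^ (1 / (p - 1)) := by
      have h4 : Y t ≤ Y t1 := h.sY.anti h.co h1
      calc Y t * exp (m' * t) ≤ Y t1 * exp (m' * (t1 + T1)) := by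
            gcongr
            exact (h.sY.pos t1).le
        _ = Y t1 * exp (m' * t1) * exp (m' * T1) := by
            rw [mul_add, exp_add]; ring
        _ ≤ ε0 * exp (m' * T1) := by gcongr
        _ = (c1 / γ) ^ (1 / (p - 1)) := by
            rw [hε0, mul_assoc, ← exp_add]; simp
    have h5 : (Y t * exp (m' * t)) ^ (p - 1) ≤ c1 / γ := by
      have := Real.rpow_le_rpow (by positivity) h3 hp0.le
      rwa [← Real.rpow_mul (by positivity), one_div_mul_cancel hp0.ne', Real.rpow_one] at this
    calc γ * (Y t * exp (m' * t)) ^ (p - 1) ≤ γ * (c1 / γ) := by gcongr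
      _ = c1 := by field_simp
  intro t1 ht1 hw1
  have hwle : ∀ t, t1 ≤ t → Y t * exp (m' * t) ≤ ε0 := by
    intro t ht
    refine barrier_le hdw hw1 (fun s h1 h2 h3 => ?_) t ht le_rfl
    have h4 := hstep s (by linarith) h3.le
    have : m' - bb Y Y1 s < 0 := by
      have : m' < M - σ0 := by rw [hσ0, hd]; linarith
      linarith
    rw [h3]
    exact mul_neg_of_neg_of_pos this hε00
  have hbt : ∀ t, t1 ≤ t → M - σ0 < bb Y Y1 t := fun t ht =>
    hstep t (by linarith) (hwle t ht)
  -- exponential decay of w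
  have hwdec : ∀ t, t1 ≤ t → Y t * exp (m' * t) ≤ ε0 * exp (-(σ0 * (t - t1))) := by
    intro t ht
    have ha : AntitoneOn (fun t => Y t * exp (m' * t) * exp (σ0 * t)) (Ici t1) := by
      refine antitoneOn_of_hasDerivAt (convex_Ici t1)
        (fun t => (hdw t).fun_mul (hasDerivAt_expc σ0 t)) fun s hs => ?_
      have h1 := hbt s hs
      have hY := h.sY.pos s
      have h2 : m' - bb Y Y1 s + σ0 ≤ 0 := by
        rw [hσ0, hd] at *
        linarith
      have := mul_nonpos_of_nonpos_of_nonneg h2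
        (by positivity : 0 ≤ Y s * exp (m' * s) * exp (σ0 * s))
      linarith
    have h1 : Y t * exp (m' * t) * exp (σ0 * t) ≤ Y t1 * exp (m' * t1) * exp (σ0 * t1) :=
      ha (le_refl t1) ht ht
    have h2 : Y t * exp (m' * t) * exp (σ0 * t) ≤ ε0 * exp (σ0 * t1) :=
      h1.trans (mul_le_mul_of_nonneg_right hw1 (exp_pos _).le)
    have e1 : exp (σ0 * t1) = exp (-(σ0 * (t - t1))) * exp (σ0 * t) := by
      rw [← exp_add]; ring_nf
    rw [e1, ← mul_assoc] at h2
    exact le_of_mul_le_mul_right h2 (exp_pos _)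
  have hcdec : ∀ t, t1 ≤ t → cc p v Y t ≤ γ * ε0 ^ (p - 1) * exp (-(k * (t - t1))) := by
    intro t ht
    have hY := h.sY.pos t
    refine (hcw t (by linarith)).trans ?_
    have h1 := Real.rpow_le_rpow (by positivity) (hwdec t ht) hp0.le
    rw [Real.mul_rpow hε00.le (exp_pos _).le, ← Real.exp_mul,
      show -(σ0 * (t - t1)) * (p - 1) = -(k * (t - t1)) by rw [hk]; ring] at h1
    have := mul_le_mul_of_nonneg_left h1 hγ.le
    linarith
  -- Lyapunov function
  set A := γ * ε0 ^ (p - 1) with hA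
  have hA0 : 0 < A := by positivity
  let D : ℝ → ℝ := fun t => A / k * exp (-(k * (t - t1)))
  have hD : ∀ t, HasDerivAt D (-(A * exp (-(k * (t - t1))))) t := by
    intro t
    have h1 : HasDerivAt (fun t => -(k * (t - t1))) (-(k * 1)) t :=
      (((hasDerivAt_id t).sub_const t1).const_mul k).fun_neg
    refine (h1.exp.const_mul (A / k)).congr_deriv ?_
    field_simp
  have hlog : ∀ t, HasDerivAt (fun t => log (Y t) + M * t) (M - bb Y Y1 t) t := by
    intro t
    refine (((h.sY.d0 t).log (h.sY.pos t).ne').fun_add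
      ((hasDerivAt_id t).const_mul M)).congr_deriv ?_
    unfold bb; ring
  have hL : AntitoneOn (fun t => (log (Y t) + M * t) + (bb Y Y1 t + D t) / (M - σ0)) (Ici t1) := by
    refine antitoneOn_of_hasDerivAt (convex_Ici t1)
      (fun t => (hlog t).fun_add (((h.sY.db t).fun_add (hD t)).div_const (M - σ0))) fun t ht => ?_
    have h1 := hcdec t ht
    have h2 := (hbt t ht).le
    have h3 := h.sY.b_le h.co t
    have h4 : (M - bb Y Y1 t) * (M - σ0) ≤ (M - bb Y Y1 t) * bb Y Y1 t :=
      mul_le_mul_of_nonneg_left h2 (by linarith)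
    have h5 : (bb Y Y1 t ^ 2 - M * bb Y Y1 t + cc p v Y t + -(A * exp (-(k * (t - t1))))) / (M - σ0)
        ≤ -(M - bb Y Y1 t) := by
      rw [div_le_iff₀ hMσ]
      nlinarith
    linarith
  have hYt1 := h.sY.pos t1
  have hbound : ∀ t, t1 ≤ t → Y t * exp (M * t) ≤
      exp ((σ0 + A / k) / (M - σ0)) * exp (M * t1) * Y t1 := by
    intro t ht
    have h1 : (log (Y t) + M * t) + (bb Y Y1 t + D t) / (M - σ0) ≤
      (log (Y t1) + M * t1) + (bb Y Y1 t1 + D t1) / (M - σ0) := hL (le_refl t1) ht ht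
    have h2 : D t1 = A / k := by simp [D]
    have h3 : 0 < D t := by positivity
    have h4 : (bb Y Y1 t1 + D t1) / (M - σ0) - (bb Y Y1 t + D t) / (M - σ0) ≤
        (σ0 + A / k) / (M - σ0) := by
      rw [← sub_div]
      apply div_le_div_of_nonneg_right _ hMσ.le
      have := h.sY.b_le h.co t1
      have := hbt t ht
      linarith
    have h5 : log (Y t) + M * t ≤ (σ0 + A / k) / (M - σ0) + M * t1 + log (Y t1) := by linarith
    have h6 := exp_le_exp.mpr h5
    rwa [exp_add, exp_add, exp_add, exp_log (h.sY.pos t), exp_log hYt1] at h6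
  refine le_of_tendsto h.lY ?_
  filter_upwards [eventually_ge_atTop t1] with t ht using hbound t ht

end ODE3

section ODE4

lemma kappa_nonneg_of_super {M : ℝ} (hM : 0 < M) {f f1 f2 : ℝ → ℝ} (hpos : ∀ t, 0 < f t)
    (h0 : ∀ t, HasDerivAt f (f1 t) t) (h1 : ∀ t, HasDerivAt f1 (f2 t) t)
    (h2 : ∀ t, f2 t + M * f1 t ≤ 0) (t : ℝ) : 0 ≤ M * f t + f1 t := by
  by_contra hcon
  push Not at hcon
  have hκ : Antitone (fun t => M * f t + f1 t) :=
    antitone_of_hasDerivAt (fun t => ((h0 t).const_mul M).fun_add (h1 t)) fun t => by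
      linarith [h2 t]
  set k := exp (M * t) * (M * f t + f1 t) with hk
  have hk0 : k < 0 := mul_neg_of_pos_of_neg (exp_pos _) hcon
  have hG : AntitoneOn (fun s => exp (M * s) * f s - k * s) (Ici t) :=
    antitoneOn_of_hasDerivAt (convex_Ici t)
      (fun s => ((hasDerivAt_expc M s).fun_mul (h0 s)).fun_sub ((hasDerivAt_id s).const_mul k))
      fun s hs => by
      have h1 : M * f s + f1 s ≤ M * f t + f1 t := hκ hs
      have h2 : exp (M * t) ≤ exp (M * s) := exp_le_exp.mpr (mul_le_mul_of_nonneg_left hs hM.le)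
      have h3 : exp (M * s) * (M * f s + f1 s) ≤ k :=
        calc exp (M * s) * (M * f s + f1 s) ≤ exp (M * s) * (M * f t + f1 t) :=
              mul_le_mul_of_nonneg_left h1 (exp_pos _).le
          _ ≤ k := mul_le_mul_of_nonpos_right h2 hcon.le
      simp only [mul_one]
      linarith
  set s := t + exp (M * t) * f t / (-k) with hs
  have hYt := hpos t
  have hst : t ≤ s := by
    have : 0 < exp (M * t) * f t / (-k) := div_pos (by positivity) (by linarith)
    linarith
  have h7 : exp (M * s) * f s - k * s ≤ exp (M * t) * f t - k * t := hG (le_refl t) hst hst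
  have h8 : k * s = k * t - exp (M * t) * f t := by
    rw [hs]; field_simp [hk0.ne]; ring
  have : 0 < exp (M * s) * f s := mul_pos (exp_pos _) (hpos s)
  linarith

variable {M p ν ν2 : ℝ} {v Y Y1 Z Z1 : ℝ → ℝ}

lemma Pair.super (h : Pair M p v Y Y1 Z Z1 ν ν2) (t : ℝ) :
    (-M * Z1 t - exp (2 * t) * v t * Z t ^ p - (-M * Y1 t - exp (2 * t) * v t * Y t ^ p)) +
      M * (Z1 t - Y1 t) ≤ 0 := by
  have h2 : Y t ^ p ≤ Z t ^ p :=
    Real.rpow_le_rpow (h.sY.pos t).le (h.lt t).le (by linarith [h.co.p1])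
  have h3 := h.co.v0 t
  have : exp (2 * t) * v t * Y t ^ p ≤ exp (2 * t) * v t * Z t ^ p := by gcongr
  linarith

lemma Pair.d_nonpos (h : Pair M p v Y Y1 Z Z1 ν ν2) (t : ℝ) : Z1 t ≤ Y1 t := by
  have := deriv_nonpos_of_super h.co.M0 (fun t => sub_pos.mpr (h.lt t))
    (fun t => (h.sZ.d0 t).fun_sub (h.sY.d0 t))
    (fun t => (h.sZ.d1 t).fun_sub (h.sY.d1 t)) h.super t
  linarith

lemma Pair.k_nonneg (h : Pair M p v Y Y1 Z Z1 ν ν2) (t : ℝ) : M * Y t + Y1 t ≤ M * Z t + Z1 t := by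
  have := kappa_nonneg_of_super h.co.M0 (fun t => sub_pos.mpr (h.lt t))
    (fun t => (h.sZ.d0 t).fun_sub (h.sY.d0 t))
    (fun t => (h.sZ.d1 t).fun_sub (h.sY.d1 t)) h.super t
  linarith

lemma Pair.anti (h : Pair M p v Y Y1 Z Z1 ν ν2) : Antitone (fun t => Z t - Y t) :=
  antitone_of_hasDerivAt (fun t => (h.sZ.d0 t).fun_sub (h.sY.d0 t)) fun t => by
    linarith [h.d_nonpos t]

lemma Pair.q_le (h : Pair M p v Y Y1 Z Z1 ν ν2) (t : ℝ) :
    exp (2 * t) * v t * Z t ^ p - exp (2 * t) * v t * Y t ^ p ≤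
      p * (2 * (M + 2) / (p - 1)) * (Z t - Y t) := by
  have h1 := rpow_convex_le (h.sZ.pos t) (h.sY.pos t) h.co.p1
  have h2 := h.sZ.O3 h.co t
  have hv := h.co.v0 t
  have h3 : exp (2 * t) * v t * (Z t ^ p - Y t ^ p) ≤
      exp (2 * t) * v t * (p * Z t ^ (p - 1) * (Z t - Y t)) := by
    apply mul_le_mul_of_nonneg_left _ (by positivity)
    linarith
  have h4 : exp (2 * t) * v t * Z t ^ (p - 1) * (p * (Z t - Y t)) ≤
      2 * (M + 2) / (p - 1) * (p * (Z t - Y t)) := by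
    apply mul_le_mul_of_nonneg_right h2
    exact mul_nonneg (by linarith [h.co.p1]) (by linarith [h.lt t])
  linarith

/-- limit along `ν → ∞` of a function nondecreasing and bounded for `ν > 0`. -/
lemma exists_lim {f : ℝ → ℝ} {B : ℝ} (hm : ∀ ν ν', 0 < ν → ν < ν' → f ν ≤ f ν')
    (hB : ∀ ν, 0 < ν → f ν ≤ B) : ∃ L, Tendsto f atTop (𝓝 L) ∧ ∀ ν, 0 < ν → f ν ≤ L := by
  have hmono : Monotone (fun ν => f (max ν 1)) := by
    intro a b hab
    rcases (max_le_max_right (1:ℝ) hab).lt_or_eq with h | h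
    · exact hm _ _ (by positivity) h
    · simp only [h, le_refl]
  have hbdd : BddAbove (range fun ν => f (max ν 1)) :=
    ⟨B, by rintro _ ⟨ν, rfl⟩; exact hB _ (by positivity)⟩
  have ht := tendsto_atTop_ciSup hmono hbdd
  have ht2 : Tendsto f atTop (𝓝 (⨆ ν, f (max ν 1))) := by
    refine ht.congr' ?_
    filter_upwards [eventually_ge_atTop 1] with ν hν
    rw [max_eq_left hν]
  refine ⟨_, ht2, fun ν hν => ?_⟩
  refine ge_of_tendsto ht2 ?_
  filter_upwards [eventually_gt_atTop ν] with ν' h' using hm ν ν' hν h'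

lemma limit_sol {M p : ℝ} {v : ℝ → ℝ} {Y Y1 : ℝ → ℝ → ℝ}
    (hP : ∀ ν ν', 0 < ν → ν < ν' → Pair M p v (Y ν) (Y1 ν) (Y ν') (Y1 ν') ν ν') :
    ∃ Yi Yi1 : ℝ → ℝ, (∀ t, Tendsto (fun ν => Y ν t) atTop (𝓝 (Yi t))) ∧
      Sol M p v Yi Yi1 ∧ ∀ ν, 0 < ν → ∀ t, Y ν t ≤ Yi t := by
  have hco : Coef M p v := (hP 1 2 one_pos one_lt_two).co
  have hp := hco.p1
  have hp0 : 0 < p - 1 := by linarith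
  have hM := hco.M0
  have hS : ∀ ν, 0 < ν → Sol M p v (Y ν) (Y1 ν) := fun ν hν => (hP ν (ν + 1) hν (by linarith)).sY
  set C0 := 2 * (M + 2) / (p - 1) with hC0
  have hC00 : 0 < C0 := by positivity
  have hbd : ∀ t ν, 0 < ν → Y ν t ≤ (C0 / (exp (2 * t) * v t)) ^ (1 / (p - 1)) := by
    intro t ν hν
    have hv := hco.v0 t
    have hY := (hS ν hν).pos t
    have h1 : Y ν t ^ (p - 1) ≤ C0 / (exp (2 * t) * v t) := by
      rw [le_div_iff₀ (by positivity)]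
      linarith [(hS ν hν).O3 hco t]
    have h2 := Real.rpow_le_rpow (by positivity) h1 (by positivity : 0 ≤ 1 / (p - 1))
    rwa [← Real.rpow_mul hY.le, mul_one_div_cancel hp0.ne', Real.rpow_one] at h2
  choose Yi hYi hYle using fun t => exists_lim (f := fun ν => Y ν t)
    (fun ν ν' h1 h2 => ((hP ν ν' h1 h2).lt t).le) (hbd t)
  choose Ki hKi hKle using fun t => exists_lim (f := fun ν => M * Y ν t + Y1 ν t)
    (B := M * Yi t)
    (fun ν ν' h1 h2 => (hP ν ν' h1 h2).k_nonneg t) (fun ν hν => by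
      have h1 := (hS ν hν).Y1_nonpos hco t
      have h2 := mul_le_mul_of_nonneg_left (hYle t ν hν) hM.le
      linarith)
  set Yi1 : ℝ → ℝ := fun t => Ki t - M * Yi t with hYi1
  have hY1lim : ∀ t, Tendsto (fun ν => Y1 ν t) atTop (𝓝 (Yi1 t)) := by
    intro t
    have := (hKi t).sub ((hYi t).const_mul M)
    refine this.congr fun ν => ?_
    ring
  have hpos : ∀ t, 0 < Yi t := fun t => ((hS 1 one_pos).pos t).trans_le (hYle t 1 one_pos)
  -- comparison with limits
  have hanti : ∀ ν, 0 < ν → ∀ a t, a ≤ t → Yi t - Y ν t ≤ Yi a - Y ν a := by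
    intro ν hν a t hat
    refine le_of_tendsto_of_tendsto ((hYi t).sub_const (Y ν t)) ((hYi a).sub_const (Y ν a)) ?_
    filter_upwards [eventually_gt_atTop ν] with ν' h' using (hP ν ν' hν h').anti hat
  have hd1 : ∀ ν, 0 < ν → ∀ t, Yi1 t ≤ Y1 ν t := by
    intro ν hν t
    refine le_of_tendsto (hY1lim t) ?_
    filter_upwards [eventually_gt_atTop ν] with ν' h' using (hP ν ν' hν h').d_nonpos t
  have hd2 : ∀ ν, 0 < ν → ∀ t, Y1 ν t - Yi1 t ≤ M * (Yi t - Y ν t) := by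
    intro ν hν t
    have h1 : M * Y ν t + Y1 ν t ≤ Ki t := hKle t ν hν
    simp only [hYi1]
    linarith
  have hq1 : ∀ ν, 0 < ν → ∀ t, exp (2 * t) * v t * Y ν t ^ p ≤ exp (2 * t) * v t * Yi t ^ p := by
    intro ν hν t
    have hv := hco.v0 t
    have := Real.rpow_le_rpow ((hS ν hν).pos t).le (hYle t ν hν) (by linarith : 0 ≤ p)
    gcongr
  have hYp : ∀ t, Tendsto (fun ν => Y ν t ^ p) atTop (𝓝 (Yi t ^ p)) := fun t =>
    (hYi t).rpow_const (Or.inl (hpos t).ne')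
  have hq2 : ∀ ν, 0 < ν → ∀ t, exp (2 * t) * v t * Yi t ^ p - exp (2 * t) * v t * Y ν t ^ p ≤
      p * C0 * (Yi t - Y ν t) := by
    intro ν hν t
    refine le_of_tendsto_of_tendsto (((hYp t).const_mul (exp (2 * t) * v t)).sub_const _)
      (((hYi t).sub_const (Y ν t)).const_mul (p * C0)) ?_
    filter_upwards [eventually_gt_atTop ν] with ν' h' using (hP ν ν' hν h').q_le t
  have hsmall : ∀ (a ε : ℝ), 0 < ε → ∀ᶠ ν in atTop, 0 < ν ∧ ∀ t, a ≤ t → Yi t - Y ν t < ε := by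
    intro a ε hε
    have h1 : Tendsto (fun ν => Yi a - Y ν a) atTop (𝓝 (Yi a - Yi a)) := (hYi a).const_sub _
    rw [sub_self] at h1
    filter_upwards [h1.eventually (gt_mem_nhds hε), eventually_gt_atTop 0] with ν h2 h3
    exact ⟨h3, fun t ht => (hanti ν h3 a t ht).trans_lt h2⟩
  refine ⟨Yi, Yi1, hYi, ⟨hpos, ?_, ?_⟩, fun ν hν t => hYle t ν hν⟩
  · intro t
    have hu : TendstoUniformlyOn Y1 Yi1 atTop (Ioi (t - 1)) := by
      rw [Metric.tendstoUniformlyOn_iff]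
      intro ε hε
      filter_upwards [hsmall (t - 1) (ε / M) (by positivity)] with ν hν s hs
      have h1 := hd1 ν hν.1 s
      have h2 := hd2 ν hν.1 s
      have h3 := hν.2 s (le_of_lt hs)
      rw [Real.dist_eq, abs_sub_comm, abs_of_nonneg (by linarith)]
      refine h2.trans_lt ?_
      calc M * (Yi s - Y ν s) < M * (ε / M) := mul_lt_mul_of_pos_left h3 hM
        _ = ε := by field_simp
    refine hasDerivAt_of_tendstoUniformlyOn isOpen_Ioi hu ?_ (fun s _ => hYi s)
      (show t ∈ Ioi (t - 1) by simp)
    filter_upwards [eventually_gt_atTop 0] with ν hν s _ using (hS ν hν).d0 s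
  · intro t
    have hu : TendstoUniformlyOn (fun ν s => -M * Y1 ν s - exp (2 * s) * v s * Y ν s ^ p)
        (fun s => -M * Yi1 s - exp (2 * s) * v s * Yi s ^ p) atTop (Ioi (t - 1)) := by
      rw [Metric.tendstoUniformlyOn_iff]
      intro ε hε
      set B := M * M + p * C0 with hB
      have hB0 : 0 < B := by positivity
      filter_upwards [hsmall (t - 1) (ε / B) (by positivity)] with ν hν s hs
      have h1 := hd1 ν hν.1 s
      have h2 := hd2 ν hν.1 s
      have h3 := hν.2 s (le_of_lt hs)
      have h4 := hq1 ν hν.1 s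
      have h5 := hq2 ν hν.1 s
      have h6 : B * (Yi s - Y ν s) < ε := by
        calc B * (Yi s - Y ν s) < B * (ε / B) := mul_lt_mul_of_pos_left h3 hB0
          _ = ε := by field_simp
      have h7 : 0 ≤ M * (Y1 ν s - Yi1 s) := mul_nonneg hM.le (by linarith)
      have h8 : M * (Y1 ν s - Yi1 s) ≤ M * (M * (Yi s - Y ν s)) := mul_le_mul_of_nonneg_left h2 hM.le
      have h9 : 0 ≤ Yi s - Y ν s := by linarith [hYle s ν hν.1]
      have h10 : 0 ≤ M * (M * (Yi s - Y ν s)) := by positivity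
      have h11 : 0 ≤ p * C0 * (Yi s - Y ν s) := by positivity
      rw [Real.dist_eq, abs_lt]
      rw [hB] at h6
      constructor <;> nlinarith
    refine hasDerivAt_of_tendstoUniformlyOn isOpen_Ioi hu ?_ (fun s _ => hY1lim s)
      (show t ∈ Ioi (t - 1) by simp)
    filter_upwards [eventually_gt_atTop 0] with ν hν s _ using (hS ν hν).d1 s

end ODE4

section ODE5

def GG (A p w : ℝ) : ℝ := w ^ (p + 1) / (p + 1) - A * w ^ 2 / 2

lemma GG_deriv {A p w : ℝ} (hp : 1 < p) (hw : 0 < w) :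
    HasDerivAt (GG A p) (w ^ p - A * w) w := by
  have h1 : HasDerivAt (fun w : ℝ => w ^ (p + 1)) ((p + 1) * w ^ (p + 1 - 1)) w :=
    Real.hasDerivAt_rpow_const (Or.inl hw.ne')
  have h2 : HasDerivAt (fun w : ℝ => w ^ 2) (2 * w) w := by
    simpa using hasDerivAt_pow 2 w
  have h3 := (h1.div_const (p + 1)).fun_sub ((h2.const_mul A).div_const 2)
  refine HasDerivAt.congr_deriv (f := GG A p) h3 ?_
  have : p + 1 ≠ 0 := by linarith
  rw [add_sub_cancel_right]
  field_simp

lemma GG_strictMono {A p c : ℝ} (hp : 1 < p) (hc : 0 < c) (hcA : c ^ (p - 1) = A) :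
    StrictMonoOn (GG A p) (Ici c) := by
  apply strictMonoOn_of_deriv_pos (convex_Ici c)
  · intro x hx
    exact (GG_deriv hp (hc.trans_le hx)).continuousAt.continuousWithinAt
  · intro x hx
    rw [interior_Ici] at hx
    have hx0 : 0 < x := hc.trans hx
    rw [(GG_deriv hp hx0).deriv, rpow_pm hx0, ← hcA]
    have := Real.rpow_lt_rpow hc.le hx (by linarith : 0 < p - 1)
    nlinarith

lemma energy_lim {κ A p c c0 τ B : ℝ} {W W1 v : ℝ → ℝ} (hκ : 0 < κ) (hp : 1 < p)
    (hc : 0 < c) (hcA : c ^ (p - 1) = A) (hc0 : 0 < c0) (hτ : 0 < τ)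
    (hW : ∀ s, 0 < W s) (h0 : ∀ s, HasDerivAt W (W1 s) s)
    (h1 : ∀ s, HasDerivAt W1 (-κ * W1 s + A * W s - v s * W s ^ p) s)
    (hB : ∀ s, 0 ≤ s → W s ≤ B) (hv1 : ∀ s, v s ≤ 1)
    (hv : ∀ s, 0 ≤ s → 1 - v s ≤ c0 * exp (-τ * s))
    (hlow : ∀ ε, 0 < ε → ∀ᶠ s in atTop, c - ε < W s) :
    Tendsto W atTop (𝓝 c) := by
  have hA : 0 < A := by rw [← hcA]; positivity
  have hexp : ∀ k : ℝ, 0 < k → Tendsto (fun s => exp (-k * s)) atTop (𝓝 0) := fun k hk =>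
    tendsto_exp_atBot.comp (tendsto_id.const_mul_atTop_of_neg (by linarith))
  rw [Metric.tendsto_nhds]
  suffices H : ∀ δ, 0 < δ → ∀ᶠ s in atTop, W s < c + 3 * δ by
    intro ε hε
    filter_upwards [hlow ε hε, H (ε / 3) (by positivity)] with s h2 h3
    rw [Real.dist_eq, abs_lt]
    constructor <;> linarith
  intro δ hδ
  by_contra hcon
  rw [Filter.not_eventually] at hcon
  have hBpos : 0 < B := (hW 0).trans_le (hB 0 le_rfl)
  by_cases hA' : ∀ᶠ s in atTop, c + δ ≤ W s
  · have hgap : A < (c + δ) ^ (p - 1) := by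
      rw [← hcA]; exact Real.rpow_lt_rpow hc.le (by linarith) (by linarith)
    set P := (c + δ) ^ (p - 1) with hP
    set η := (P - A) / 2 with hη
    have hη0 : 0 < η := by rw [hη]; linarith
    have hP0 : 0 < P := hA.trans hgap
    have he := ((hexp τ hτ).const_mul (c0 * P)).eventually (gt_mem_nhds (by simpa using hη0))
    obtain ⟨S, hS⟩ := eventually_atTop.mp (hA'.and (he.and (eventually_ge_atTop 0)))
    have hd : ∀ s, S ≤ s → A * W s - v s * W s ^ p ≤ -(η * c) := by
      intro s hs
      obtain ⟨h2, h3, h4⟩ := hS s hs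
      have h5 := hv s h4
      have h6 : P ≤ W s ^ (p - 1) := Real.rpow_le_rpow (by linarith) h2 (by linarith)
      have h7 : c0 * exp (-τ * s) * P < η := by linarith
      have h8 : (1 - v s) * P ≤ c0 * exp (-τ * s) * P := mul_le_mul_of_nonneg_right h5 hP0.le
      have hvpos : 0 < v s := by
        by_contra hh
        push Not at hh
        have : P ≤ (1 - v s) * P := by nlinarith
        rw [hη] at h7; linarith
      have h9 : v s * P ≤ v s * W s ^ (p - 1) := mul_le_mul_of_nonneg_left h6 hvpos.le
      have h10 : A - v s * W s ^ (p - 1) ≤ -η := by rw [hη] at *; linarith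
      rw [rpow_pm (hW s)]
      have h11 := mul_le_mul_of_nonneg_right h10 (hW s).le
      have h12 : η * c ≤ η * W s := mul_le_mul_of_nonneg_left (by linarith) hη0.le
      linarith
    have hK : AntitoneOn (fun s => W1 s + κ * W s + η * c * s) (Ici S) :=
      antitoneOn_of_hasDerivAt (convex_Ici S)
        (fun s => ((h1 s).fun_add ((h0 s).const_mul κ)).fun_add
          ((hasDerivAt_id s).const_mul (η * c))) fun s hs => by
        have := hd s hs
        simp only [mul_one]
        linarith
    have hηc : 0 < η * c := by positivity
    set Q := W1 S + κ * W S + η * c * S with hQ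
    set S2 := max S ((Q + 1) / (η * c)) with hS2
    have hW1 : ∀ s, S2 ≤ s → W1 s ≤ -1 := by
      intro s hs
      have hsS : S ≤ s := (le_max_left _ _).trans hs
      have h2 : W1 s + κ * W s + η * c * s ≤ Q := hK (le_refl S) hsS hsS
      have h3 : (Q + 1) / (η * c) ≤ s := (le_max_right _ _).trans hs
      rw [div_le_iff₀ hηc] at h3
      have := mul_pos hκ (hW s)
      linarith
    have hL : AntitoneOn (fun s => W s + s) (Ici S2) :=
      antitoneOn_of_hasDerivAt (convex_Ici S2)
        (fun s => (h0 s).fun_add (hasDerivAt_id s)) fun s hs => by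
        linarith [hW1 s hs]
    have h2 : S2 ≤ S2 + W S2 := by linarith [hW S2]
    have h3 : W (S2 + W S2) + (S2 + W S2) ≤ W S2 + S2 := hL (le_refl S2) h2 h2
    linarith [hW (S2 + W S2)]
  · rw [Filter.not_eventually] at hA'
    have hGm := GG_strictMono hp hc hcA
    have hg1 : GG A p c < GG A p (c + δ) := hGm (le_refl c) (by simp; linarith) (by linarith)
    have hg2 : GG A p (c + δ) < GG A p (c + 3 * δ) :=
      hGm (by simp; linarith) (by simp; linarith) (by linarith)
    obtain ⟨d, hd0, hd⟩ := Metric.eventually_nhds_iff.mp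
      ((GG_deriv (A := A) hp hc).continuousAt.eventually (gt_mem_nhds hg1))
    have hGle : ∀ w, c - d < w → w ≤ c + δ → GG A p w ≤ GG A p (c + δ) := by
      intro w h2 h3
      rcases le_total c w with h4 | h4
      · exact hGm.monotoneOn h4 (by simp; linarith) h3
      · refine (hd ?_).le
        rw [Real.dist_eq, abs_lt]; constructor <;> linarith
    set D := c0 ^ 2 * (B ^ p) ^ 2 / (4 * κ) with hD
    have hDE : ∀ s, HasDerivAt (fun s => W1 s ^ 2 / 2 + GG A p (W s) + D / (2 * τ) * exp (-(2 * τ) * s))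
        (-κ * W1 s ^ 2 + (1 - v s) * W s ^ p * W1 s - D * exp (-(2 * τ) * s)) s := by
      intro s
      have h2 := ((h1 s).fun_pow 2).div_const 2
      have h3 : HasDerivAt (fun s => GG A p (W s)) ((W s ^ p - A * W s) * W1 s) s :=
        (GG_deriv hp (hW s)).comp s (h0 s)
      have h4 := (hasDerivAt_expc (-(2 * τ)) s).const_mul (D / (2 * τ))
      refine HasDerivAt.congr_deriv ((h2.fun_add h3).fun_add h4) ?_
      field_simp
      simp
      ring
    have hE : AntitoneOn (fun s => W1 s ^ 2 / 2 + GG A p (W s) +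
        D / (2 * τ) * exp (-(2 * τ) * s)) (Ici 0) :=
      antitoneOn_of_hasDerivAt (convex_Ici 0) hDE fun s hs => by
        have hs0 : 0 ≤ s := hs
        have h2 := hv s hs0
        have h3 := hv1 s
        have hWp : 0 < W s ^ p := by have := hW s; positivity
        have h4 : W s ^ p ≤ B ^ p := Real.rpow_le_rpow (hW s).le (hB s hs0) (by linarith)
        set X := (1 - v s) * W s ^ p with hX
        have hX0 : 0 ≤ X := mul_nonneg (by linarith) hWp.le
        have hXle : X ≤ c0 * exp (-τ * s) * B ^ p :=
          mul_le_mul h2 h4 hWp.le (by positivity)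
        have h5 : X ^ 2 ≤ (c0 * exp (-τ * s) * B ^ p) ^ 2 := by gcongr
        have h6 : (c0 * exp (-τ * s) * B ^ p) ^ 2 = 4 * κ * (D * exp (-(2 * τ) * s)) := by
          have : exp (-(2 * τ) * s) = exp (-τ * s) ^ 2 := by
            rw [← Real.exp_nat_mul]; congr 1; push_cast; ring
          rw [this, hD]; field_simp
        rw [h6] at h5
        have h7 : 0 ≤ (2 * κ * W1 s - X) ^ 2 := sq_nonneg _
        have h8 : 4 * κ * (-κ * W1 s ^ 2 + X * W1 s - D * exp (-(2 * τ) * s)) ≤ 0 := by nlinarith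
        by_contra hh
        push Not at hh
        have := mul_pos (by linarith : 0 < 4 * κ) hh
        linarith
    have he := ((hexp (2 * τ) (by linarith)).const_mul (D / (2 * τ))).eventually
      (gt_mem_nhds (show D / (2 * τ) * 0 < GG A p (c + 3 * δ) - GG A p (c + δ) by
        rw [mul_zero]; linarith))
    obtain ⟨S, hS⟩ := eventually_atTop.mp ((hlow d hd0).and (he.and (eventually_ge_atTop 0)))
    obtain ⟨sa, hsa, ha⟩ := Filter.frequently_atTop.mp hcon S
    obtain ⟨sb, hsb, hb⟩ := Filter.frequently_atTop.mp hA' sa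
    obtain ⟨sc, hsc, hcc⟩ := Filter.frequently_atTop.mp hcon sb
    push Not at ha hb hcc
    have hcont : Continuous W := continuous_iff_continuousAt.mpr fun s => (h0 s).continuousAt
    obtain ⟨sm, hsm, hmin⟩ := isCompact_Icc.exists_isMinOn (⟨sb, hsb, hsc⟩ : (Icc sa sc).Nonempty)
      hcont.continuousOn
    have hmb : W sm ≤ W sb := hmin ⟨hsb, hsc⟩
    have hma : sm ≠ sa := by rintro rfl; linarith
    have hmc : sm ≠ sc := by rintro rfl; linarith
    have hlm : IsLocalMin W sm := hmin.isLocalMin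
      (Icc_mem_nhds (lt_of_le_of_ne hsm.1 hma.symm) (lt_of_le_of_ne hsm.2 hmc))
    have hz : W1 sm = 0 := hlm.hasDerivAt_eq_zero (h0 sm)
    obtain ⟨h2, h3, h4⟩ := hS sm (le_trans hsa hsm.1)
    have h5 := hE (show (0:ℝ) ≤ sm from h4) (show (0:ℝ) ≤ sc from h4.trans hsm.2) hsm.2
    simp only [hz] at h5
    have h6 := hGle (W sm) h2 (by linarith)
    have h7 : GG A p (c + 3 * δ) ≤ GG A p (W sc) :=
      hGm.monotoneOn (by simp; linarith) (by simp; linarith) hcc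
    have h8 : 0 ≤ D / (2 * τ) * exp (-(2 * τ) * sc) := by positivity
    have h9 := sq_nonneg (W1 sc)
    linarith

lemma sing_lim {M p m c c0 τ : ℝ} {v Y Y1 y : ℝ → ℝ} (hco : Coef M p v) (hY : Sol M p v Y Y1)
    (hm2 : M < 2 * m) (hpm : p * m = m + 2) (hc : 0 < c) (hcA : c ^ (p - 1) = m * (M - m))
    (hc0 : 0 < c0) (hτ : 0 < τ) (hv1 : ∀ t, v t ≤ 1)
    (hv : ∀ t, t ≤ 0 → |v t - 1| ≤ c0 * exp (τ * t))
    (hyY : ∀ t, y t ≤ Y t) (hy : Tendsto (fun t => y t * exp (m * t)) atBot (𝓝 c)) :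
    Tendsto (fun t => Y t * exp (m * t)) atBot (𝓝 c) := by
  have hp := hco.p1
  have hp0 : 0 < p - 1 := by linarith
  have hM := hco.M0
  have hmp : m * (p - 1) = 2 := by linarith
  set W : ℝ → ℝ := fun s => exp (-m * s) * Y (-s) with hWd
  set W1 : ℝ → ℝ := fun s => exp (-m * s) * (-m * Y (-s) - Y1 (-s)) with hW1d
  have hYn : ∀ s, HasDerivAt (fun s => Y (-s)) (-Y1 (-s)) s := fun s => by
    refine HasDerivAt.congr_deriv ((hY.d0 (-s)).comp s (hasDerivAt_neg s)) ?_
    ring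
  have hY1n : ∀ s, HasDerivAt (fun s => Y1 (-s))
      (-(-M * Y1 (-s) - exp (2 * -s) * v (-s) * Y (-s) ^ p)) s := fun s => by
    refine HasDerivAt.congr_deriv ((hY.d1 (-s)).comp s (hasDerivAt_neg s)) ?_
    ring
  have hW : ∀ s, 0 < W s := fun s => mul_pos (exp_pos _) (hY.pos _)
  have hWp : ∀ s k, W s ^ k = exp (-m * s * k) * Y (-s) ^ k := fun s k => by
    simp only [hWd]
    rw [Real.mul_rpow (exp_pos _).le (hY.pos _).le, ← Real.exp_mul]
  have h0 : ∀ s, HasDerivAt W (W1 s) s := fun s => by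
    refine HasDerivAt.congr_deriv ((hasDerivAt_expc (-m) s).fun_mul (hYn s)) ?_
    simp only [hW1d]; ring
  have h1 : ∀ s, HasDerivAt W1
      (-(2 * m - M) * W1 s + (m * (M - m)) * W s - v (-s) * W s ^ p) s := fun s => by
    refine HasDerivAt.congr_deriv ((hasDerivAt_expc (-m) s).fun_mul
      (((hYn s).const_mul (-m)).fun_sub (hY1n s))) ?_
    rw [hWp s p]
    have : exp (-m * s * p) = exp (-m * s) * exp (2 * -s) := by
      rw [← Real.exp_add]; congr 1; linear_combination (-s) * hpm
    rw [this]
    simp only [hW1d, hWd]; ring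
  set C0 := 2 * (M + 2) / (p - 1) with hC0
  have hC00 : 0 < C0 := by positivity
  have hB : ∀ s, 0 ≤ s → W s ≤ (C0 / v 0) ^ (1 / (p - 1)) := by
    intro s hs
    have hv0 := hco.v0 0
    have h2 : v 0 ≤ v (-s) := hco.va (by linarith)
    have h3 : v (-s) * W s ^ (p - 1) ≤ C0 := by
      have h4 := hY.O3 hco (-s)
      rw [hWp]
      have : exp (-m * s * (p - 1)) = exp (2 * -s) := by
        congr 1; linear_combination (-s) * hmp
      rw [this]; linarith
    have hWk : 0 < W s ^ (p - 1) := by have := hW s; positivity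
    have h5 : W s ^ (p - 1) ≤ C0 / v 0 := by
      rw [le_div_iff₀ hv0]; nlinarith
    have h6 := Real.rpow_le_rpow hWk.le h5 (by positivity : 0 ≤ 1 / (p - 1))
    rwa [← Real.rpow_mul (hW s).le, mul_one_div_cancel hp0.ne', Real.rpow_one] at h6
  have hlow : ∀ ε, 0 < ε → ∀ᶠ s in atTop, c - ε < W s := by
    intro ε hε
    have h2 := (hy.comp tendsto_neg_atTop_atBot).eventually (lt_mem_nhds (by linarith : c - ε < c))
    filter_upwards [h2] with s hs
    refine hs.trans_le ?_
    simp only [hWd, Function.comp]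
    have : exp (m * -s) = exp (-m * s) := by congr 1; ring
    rw [this, mul_comm]
    exact mul_le_mul_of_nonneg_left (hyY _) (exp_pos _).le
  have hlim := energy_lim (v := fun s => v (-s)) (by linarith : 0 < 2 * m - M) hp hc hcA hc0 hτ hW h0 h1 hB
    (fun s => hv1 _) (fun s hs => by
      have := hv (-s) (by linarith)
      rw [abs_sub_comm] at this
      have h2 := (le_abs_self _).trans this
      rwa [show τ * -s = -τ * s by ring] at h2) hlow
  refine (hlim.comp tendsto_neg_atBot_atTop).congr fun t => ?_
  simp only [hWd, Function.comp]
  rw [neg_neg, mul_comm]; congr 2; ring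

end ODE5

section Transl

lemma params {N : ℕ} (hN : 3 ≤ N) {p : ℝ} (hp : p ∈ Set.Ioo ((N:ℝ) / ((N:ℝ) - 2)) (pc N)) :
    1 < p ∧ 0 < 2 / (p - 1) ∧ 2 / (p - 1) < (N:ℝ) - 2 ∧ (N:ℝ) - 2 < 2 * (2 / (p - 1)) ∧
      p * (2 / (p - 1)) = 2 / (p - 1) + 2 ∧ 0 < cp N p ∧
      cp N p ^ (p - 1) = 2 / (p - 1) * (((N:ℝ) - 2) - 2 / (p - 1)) ∧ 0 ≤ tauStar N p ∧
      (N:ℝ) < ((N:ℝ) - 2) * p := by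
  have hN3 : (3:ℝ) ≤ N := by exact_mod_cast hN
  have hM : 0 < (N:ℝ) - 2 := by linarith
  obtain ⟨h1, h2⟩ := hp
  rw [div_lt_iff₀ hM] at h1
  have hp1 : 1 < p := by
    by_contra hh
    push Not at hh
    nlinarith
  have hp0 : 0 < p - 1 := by linarith
  have hm0 : 0 < 2 / (p - 1) := by positivity
  have hmM : 2 / (p - 1) < (N:ℝ) - 2 := by
    rw [div_lt_iff₀ hp0]; linarith
  have hs : 1 < Real.sqrt ((N:ℝ) - 1) := by
    rw [Real.lt_sqrt (by norm_num)]; linarith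
  have hm2 : (N:ℝ) - 2 < 2 * (2 / (p - 1)) := by
    unfold pc at h2
    have hd : 0 < (N:ℝ) - 4 + 2 * Real.sqrt ((N:ℝ) - 1) := by linarith
    have h3 : p - 1 < 4 / ((N:ℝ) - 4 + 2 * Real.sqrt ((N:ℝ) - 1)) := by linarith
    rw [lt_div_iff₀ hd] at h3
    rw [← mul_div_assoc, lt_div_iff₀ hp0]
    nlinarith
  have hA : 0 < 2 / (p - 1) * ((N:ℝ) - 2 - 2 / (p - 1)) := mul_pos hm0 (by linarith)
  refine ⟨hp1, hm0, hmM, hm2, ?_, ?_, ?_, ?_, by linarith⟩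
  · field_simp; ring
  · unfold cp; positivity
  · unfold cp
    rw [← Real.rpow_mul hA.le, one_div_mul_cancel hp0.ne', Real.rpow_one]
  · unfold tauStar
    set a := 2 / (p - 1) - ((N:ℝ) - 2) / 2 with ha
    have ha0 : 0 ≤ a := by rw [ha]; linarith
    have : Real.sqrt (a ^ 2 - 2 * ((N:ℝ) - 2 - 2 / (p - 1))) ≤ a := by
      apply Real.sqrt_le_iff.mpr
      exact ⟨ha0, by linarith⟩
    linarith

variable {N : ℕ}

lemma lap_log {x : EuclideanSpace ℝ (Fin N)} (hx : x ≠ 0) {Y Y1 : ℝ → ℝ} {Y2 : ℝ}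
    (h0 : ∀ t, HasDerivAt Y (Y1 t) t) (h1 : HasDerivAt Y1 Y2 (Real.log ‖x‖)) :
    lap (fun z : EuclideanSpace ℝ (Fin N) => Y (Real.log ‖z‖)) x =
      (Y2 + ((N:ℝ) - 2) * Y1 (Real.log ‖x‖)) / ‖x‖ ^ 2 := by
  have hn : 0 < ‖x‖ := norm_pos_iff.mpr hx
  have ha : ∀ s : ℝ, 0 < s → HasDerivAt (fun s => Y (Real.log s)) (Y1 (Real.log s) / s) s :=
    fun s hs => by
      refine HasDerivAt.congr_deriv ((h0 (Real.log s)).comp s (Real.hasDerivAt_log hs.ne')) ?_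
      rw [div_eq_mul_inv]
  have hb : HasDerivAt (fun s => Y1 (Real.log s) / s)
      ((Y2 - Y1 (Real.log ‖x‖)) / ‖x‖ ^ 2) ‖x‖ := by
    have hb1 : HasDerivAt (fun s => Y1 (Real.log s)) (Y2 * ‖x‖⁻¹) ‖x‖ :=
      h1.comp ‖x‖ (Real.hasDerivAt_log hn.ne')
    refine HasDerivAt.congr_deriv (hb1.fun_div (hasDerivAt_id ‖x‖) hn.ne') ?_
    field_simp
  rw [lap_radial (y := fun s => Y (Real.log s)) hx ha hb]
  field_simp
  ring

lemma to_ode {p : ℝ} {V u : EuclideanSpace ℝ (Fin N) → ℝ} {e : EuclideanSpace ℝ (Fin N)}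
    (he : ‖e‖ = 1) (hu : ContDiffOn ℝ 2 u {0}ᶜ) (hpos : ∀ x, x ≠ 0 → 0 < u x)
    (hrad : ∀ x y : EuclideanSpace ℝ (Fin N), x ≠ 0 → ‖x‖ = ‖y‖ → u x = u y)
    (hpde : ∀ x, x ≠ 0 → -lap u x = V x * u x ^ p) :
    Sol ((N:ℝ) - 2) p (fun t => V (exp t • e)) (fun t => u (exp t • e))
      (deriv (fun t : ℝ => u (exp t • e))) := by
  have he0 : e ≠ 0 := by rintro rfl; simp at he
  have hx0 : ∀ t : ℝ, exp t • e ≠ 0 := fun t => smul_ne_zero (exp_pos t).ne' he0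
  have hnorm : ∀ t : ℝ, ‖exp t • e‖ = exp t := fun t => by
    rw [norm_smul, he, mul_one, Real.norm_of_nonneg (exp_pos t).le]
  set Y : ℝ → ℝ := fun t => u (exp t • e) with hY
  have hYc : ContDiff ℝ 2 Y := by
    rw [contDiff_iff_contDiffAt]
    intro t
    have h1 : ContDiffAt ℝ 2 (fun t : ℝ => exp t • e) t :=
      (Real.contDiff_exp.contDiffAt).smul contDiffAt_const
    exact ContDiffAt.comp t (contDiffAt_of_off0 hu (hx0 t)) h1
  have hd0 : ∀ t, HasDerivAt Y (deriv Y t) t := fun t =>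
    (hYc.differentiable (by norm_num) t).hasDerivAt
  have hYc1 : ContDiff ℝ 1 (deriv Y) := by
    have : ContDiff ℝ (1 + 1) Y := by convert hYc using 1; norm_num
    exact (contDiff_succ_iff_deriv.mp this).2.2
  have hd1 : ∀ t, HasDerivAt (deriv Y) (deriv (deriv Y) t) t := fun t =>
    (hYc1.differentiable (by norm_num) t).hasDerivAt
  refine ⟨fun t => hpos _ (hx0 t), hd0, fun t => ?_⟩
  refine HasDerivAt.congr_deriv (hd1 t) ?_
  have hc : u =ᶠ[𝓝 (exp t • e)] fun z => Y (Real.log ‖z‖) := by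
    filter_upwards [isOpen_compl_singleton.mem_nhds (hx0 t)] with z hz
    have hz0 : z ≠ 0 := hz
    refine hrad z _ hz0 ?_
    rw [hnorm, Real.exp_log (norm_pos_iff.mpr hz0)]
  have h1 := hpde _ (hx0 t)
  rw [lap_congr hc, lap_log (hx0 t) hd0 (hd1 _), hnorm, Real.log_exp] at h1
  have h2 : exp (2 * t) = exp t ^ 2 := by rw [← Real.exp_nat_mul]; norm_cast
  rw [h2]
  have h3 := exp_pos t
  field_simp at h1
  linarith

lemma holder_cont {V : EuclideanSpace ℝ (Fin N) → ℝ} (h : LocHolderOn V {0}ᶜ) :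
    ContinuousOn V {0}ᶜ := by
  intro x hx
  obtain ⟨C, a, r, hr, ha, ha1, hH⟩ := h x hx
  have h1 := (hH.continuousOn ha) x ⟨mem_ball_self hr, hx⟩
  exact h1.mono_of_mem_nhdsWithin
    (inter_mem (mem_nhdsWithin_of_mem_nhds (ball_mem_nhds x hr)) self_mem_nhdsWithin)

lemma strict_mono {p M ν ν2 : ℝ} (hM : M = (N:ℝ) - 2) (hM0 : 0 < M) (hp : 1 < p) (hν : ν < ν2)
    {V w W : EuclideanSpace ℝ (Fin N) → ℝ} (hV : ∀ x, x ≠ 0 → 0 ≤ V x)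
    (hw : FastDecaySol N p V w ν) (hW : FastDecaySol N p V W ν2)
    (hle : ∀ x, x ≠ 0 → w x ≤ W x) : ∀ x, x ≠ 0 → w x < W x := by
  obtain ⟨w1, w2, w3, w4⟩ := hw
  obtain ⟨W1, W2, W3, W4⟩ := hW
  rw [← hM] at w4 W4
  have := pos_of_superharmonic (ψ := fun x => W x - w x) hM hM0 (a := ν2 - ν) (by linarith) (W1.sub w1)
    (fun x hx => by linarith [hle x hx]) (fun x hx => by
      rw [lap_sub (contDiffAt_of_off0 W1 hx) (contDiffAt_of_off0 w1 hx)]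
      have h1 := w3 x hx
      have h2 := W3 x hx
      have h3 : w x ^ p ≤ W x ^ p := Real.rpow_le_rpow (w2 x hx).le (hle x hx) (by linarith)
      have h4 := mul_le_mul_of_nonneg_left h3 (hV x hx)
      linarith) ((W4.sub w4).congr fun x => by ring)
  intro x hx
  linarith [this x hx]

lemma Sol.contDiff2 {M p : ℝ} {v Y Y1 : ℝ → ℝ} (hv : Continuous v) (h : Sol M p v Y Y1) :
    ContDiff ℝ 2 Y := by
  have e0 : deriv Y = Y1 := funext fun t => (h.d0 t).deriv
  have e1 : deriv Y1 = fun t => -M * Y1 t - exp (2 * t) * v t * Y t ^ p :=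
    funext fun t => (h.d1 t).deriv
  have c0 : Continuous Y := continuous_iff_continuousAt.mpr fun t => (h.d0 t).continuousAt
  have c1 : Continuous Y1 := continuous_iff_continuousAt.mpr fun t => (h.d1 t).continuousAt
  have c2 : Continuous (fun t => Y t ^ p) := c0.rpow_const fun t => Or.inl (h.pos t).ne'
  have hY1 : ContDiff ℝ 1 Y1 := by
    rw [contDiff_one_iff_deriv]
    refine ⟨fun t => (h.d1 t).differentiableAt, ?_⟩
    rw [e1]; fun_prop
  have : ContDiff ℝ (1 + 1) Y := by
    rw [contDiff_succ_iff_deriv]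
    refine ⟨fun t => (h.d0 t).differentiableAt, by simp, ?_⟩
    rw [e0]; exact hY1
  convert this using 1; norm_num

end Transl

end Helpers

/-- Theorem 1.3, the slow decaying solution as the limit of the
fast decaying solutions. -/
theorem statement_2 (N : ℕ) (hN : 3 ≤ N) (p : ℝ)
    (hp : p ∈ Set.Ioo ((N:ℝ) / ((N:ℝ) - 2)) (pc N))
    (V : EuclideanSpace ℝ (Fin N) → ℝ)
    -- `(V₀)(i)`: behavior near the origin
    (c₀ τ₀ : ℝ) (hc₀ : 0 < c₀) (hτ₀ : tauStar N p < τ₀)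
    (hVnear : ∀ x : EuclideanSpace ℝ (Fin N), x ≠ 0 → ‖x‖ ≤ 1 →
      |V x - 1| ≤ c₀ * ‖x‖ ^ τ₀)
    -- `(V₁)` part (II)
    (hVreg : LocHolderOn V {0}ᶜ)
    (hVnonneg : ∀ x : EuclideanSpace ℝ (Fin N), x ≠ 0 → 0 ≤ V x)
    (hVle1 : ∀ x : EuclideanSpace ℝ (Fin N), x ≠ 0 → V x ≤ 1)
    (α₂ l₂ : ℝ) (hα₂ : α₂ ≤ 0) (hl₂ : 1 < l₂)
    (hVscale : ∀ x : EuclideanSpace ℝ (Fin N), x ≠ 0 → V (l₂⁻¹ • x) ≤ l₂ ^ (-α₂) * V x)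
    -- `(V_∞)`: radial symmetry, monotonicity and power behavior at infinity
    (hVrad : ∀ x y : EuclideanSpace ℝ (Fin N), x ≠ 0 → ‖x‖ = ‖y‖ → V x = V y)
    (hVdecr : ∀ x y : EuclideanSpace ℝ (Fin N), x ≠ 0 → ‖x‖ ≤ ‖y‖ → V y ≤ V x)
    (γ α : ℝ) (hγ : 1 < γ) (hα₁ : ((N:ℝ) - 2) * pc N - N - 2 < α) (hα₂' : α ≤ 0)
    (hVinf : ∀ x : EuclideanSpace ℝ (Fin N), 1 < ‖x‖ →
      (1/γ) * ‖x‖ ^ α ≤ V x ∧ V x ≤ γ * ‖x‖ ^ α)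
    -- the family of fast decaying solutions
    (u : ℝ → EuclideanSpace ℝ (Fin N) → ℝ)
    (hfam : ∀ ν : ℝ, 0 < ν → FastDecaySol N p V (u ν) ν ∧ SingAtOrigin N p (u ν))
    (hmono : ∀ ν ν' : ℝ, 0 < ν → ν ≤ ν' →
      ∀ x : EuclideanSpace ℝ (Fin N), x ≠ 0 → u ν x ≤ u ν' x) :
    ∃ uinf : EuclideanSpace ℝ (Fin N) → ℝ,
      (∀ x : EuclideanSpace ℝ (Fin N), x ≠ 0 →
        Tendsto (fun ν => u ν x) Filter.atTop (nhds (uinf x))) ∧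
      ContDiffOn ℝ 2 uinf {0}ᶜ ∧
      (∀ x : EuclideanSpace ℝ (Fin N), x ≠ 0 → 0 < uinf x) ∧
      (∀ x : EuclideanSpace ℝ (Fin N), x ≠ 0 → -lap uinf x = V x * uinf x ^ p) ∧
      SingAtOrigin N p uinf ∧
      ∃ c₁ : ℝ, 1 < c₁ ∧ ∀ x : EuclideanSpace ℝ (Fin N), 1 ≤ ‖x‖ →
        1 / c₁ ≤ uinf x * ‖x‖ ^ ((2 + α) / (p - 1)) ∧
        uinf x * ‖x‖ ^ ((2 + α) / (p - 1)) ≤ c₁ := by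
  obtain ⟨hp1, hm0, hmM, hm2, hpm, hcp, hcpA, hts, hNp⟩ := params hN hp
  have hN3 : (3:ℝ) ≤ N := by exact_mod_cast hN
  set M : ℝ := (N:ℝ) - 2 with hM
  set m : ℝ := 2 / (p - 1) with hm
  set m' : ℝ := (2 + α) / (p - 1) with hm'
  set c := cp N p with hc
  have hp0 : 0 < p - 1 := by linarith
  have hM0 : 0 < M := by linarith
  have hτ : 0 < τ₀ := by linarith
  have hα : -2 < α := by
    have := mul_lt_mul_of_pos_left hp.2 hM0
    linarith
  have hm'0 : 0 < m' := div_pos (by linarith) hp0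
  have hm'M : m' < M := lt_of_le_of_lt (by rw [hm', hm]; gcongr; linarith) hmM
  have hm'p : m' * (p - 1) = 2 + α := by rw [hm']; field_simp
  -- the unit vector
  obtain ⟨e, he⟩ : ∃ e : EuclideanSpace ℝ (Fin N), ‖e‖ = 1 :=
    ⟨EuclideanSpace.single ⟨0, by omega⟩ 1, by simp⟩
  have he0 : e ≠ 0 := by rintro rfl; simp at he
  have hx0 : ∀ t : ℝ, exp t • e ≠ 0 := fun t => smul_ne_zero (exp_pos t).ne' he0
  have hnorm : ∀ t : ℝ, ‖exp t • e‖ = exp t := fun t => by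
    rw [norm_smul, he, mul_one, Real.norm_of_nonneg (exp_pos t).le]
  have hrpow : ∀ t k : ℝ, (exp t) ^ k = exp (k * t) := fun t k => by
    rw [← Real.exp_mul]; congr 1; ring
  -- the potential
  have hVc := holder_cont hVreg
  have hVpos : ∀ x : EuclideanSpace ℝ (Fin N), x ≠ 0 → 0 < V x := by
    intro x hx
    have hn : 0 < ‖x‖ := norm_pos_iff.mpr hx
    set t := max 1 (Real.log ‖x‖) with ht
    have h1 : ‖x‖ ≤ ‖exp t • e‖ := by
      rw [hnorm]
      calc ‖x‖ = exp (Real.log ‖x‖) := (Real.exp_log hn).symm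
        _ ≤ exp t := exp_le_exp.mpr (le_max_right _ _)
    have h2 : 1 < ‖exp t • e‖ := by
      rw [hnorm]
      exact Real.one_lt_exp_iff.mpr (lt_of_lt_of_le one_pos (le_max_left _ _))
    have h3 := (hVinf _ h2).1
    have h4 := hVdecr _ _ hx h1
    have h5 : 0 < (1 / γ) * ‖exp t • e‖ ^ α := by
      rw [hnorm]
      have := exp_pos t
      positivity
    linarith
  set v : ℝ → ℝ := fun t => V (exp t • e) with hv
  have hco : Coef M p v := by
    refine ⟨hM0, hp1, ?_, ?_, fun t => hVpos _ (hx0 t)⟩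
    · exact hVc.comp_continuous (by fun_prop) (fun t => hx0 t)
    · intro a b hab
      refine hVdecr _ _ (hx0 a) ?_
      rw [hnorm, hnorm]; exact exp_le_exp.mpr hab
  have hv1 : ∀ t, v t ≤ 1 := fun t => hVle1 _ (hx0 t)
  have hvup : ∀ t, 0 ≤ t → v t ≤ γ * exp (α * t) := by
    intro t ht
    rcases ht.lt_or_eq with h | h
    · have h1 := (hVinf (exp t • e) (by rw [hnorm]; exact Real.one_lt_exp_iff.mpr h)).2
      rwa [hnorm, hrpow] at h1
    · rw [← h, mul_zero, Real.exp_zero, mul_one]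
      linarith [hv1 0]
  have hvlow : ∀ t, 0 ≤ t → v 0 / γ * exp (α * t) ≤ v t := by
    intro t ht
    rcases ht.lt_or_eq with h | h
    · have h1 := (hVinf (exp t • e) (by rw [hnorm]; exact Real.one_lt_exp_iff.mpr h)).1
      rw [hnorm, hrpow] at h1
      refine le_trans ?_ h1
      have := hv1 0
      gcongr
    · rw [← h, mul_zero, Real.exp_zero, mul_one]
      exact div_le_self (hco.v0 0).le hγ.le
  have hvnear : ∀ t, t ≤ 0 → |v t - 1| ≤ c₀ * exp (τ₀ * t) := by
    intro t ht
    have h1 := hVnear (exp t • e) (hx0 t) (by rw [hnorm]; exact Real.exp_le_one_iff.mpr ht)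
    rwa [hnorm, hrpow] at h1
  -- strict monotonicity and radial symmetry of the family
  have hstrict : ∀ ν ν' : ℝ, 0 < ν → ν < ν' → ∀ x : EuclideanSpace ℝ (Fin N), x ≠ 0 →
      u ν x < u ν' x := fun ν ν' h1 h2 =>
    strict_mono hM hM0 hp1 h2 hVnonneg (hfam ν h1).1 (hfam ν' (h1.trans h2)).1
      (hmono ν ν' h1 h2.le)
  have hrad : ∀ ν : ℝ, 0 < ν → ∀ x y : EuclideanSpace ℝ (Fin N), x ≠ 0 → ‖x‖ = ‖y‖ →
      u ν x = u ν y := by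
    intro ν hν
    obtain ⟨⟨w1, w2, w3, w4⟩, w5⟩ := hfam ν hν
    obtain ⟨⟨W1, W2, W3, W4⟩, W5⟩ := hfam (ν + 1) (by linarith)
    exact radial_sym hM hm0 hmM hm2 hp1 hpm hcp hcpA hVc hVpos hVle1 hVrad W1 w1 w2
      (hstrict ν (ν + 1) hν (by linarith)) W3 w3 w5 w4 W4 (by linarith)
  -- translation to the ODE
  set Y : ℝ → ℝ → ℝ := fun ν t => u ν (exp t • e) with hY
  set Y1 : ℝ → ℝ → ℝ := fun ν => deriv (Y ν) with hY1
  have hS : ∀ ν, 0 < ν → Sol M p v (Y ν) (Y1 ν) := by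
    intro ν hν
    obtain ⟨⟨w1, w2, w3, w4⟩, w5⟩ := hfam ν hν
    exact to_ode he w1 w2 (hrad ν hν) w3
  have hlimtop : ∀ ν, 0 < ν → Tendsto (fun t => Y ν t * exp (M * t)) atTop (nhds ν) := by
    intro ν hν
    obtain ⟨⟨w1, w2, w3, w4⟩, w5⟩ := hfam ν hν
    have h1 : Tendsto (fun t : ℝ => exp t • e) atTop
        (Filter.comap (fun x : EuclideanSpace ℝ (Fin N) => ‖x‖) Filter.atTop) := by
      rw [tendsto_comap_iff]
      exact tendsto_exp_atTop.congr fun t => (hnorm t).symm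
    refine (w4.comp h1).congr fun t => ?_
    simp only [Function.comp, hnorm, hrpow, hY]
    rfl
  have hlimbot : ∀ ν, 0 < ν → Tendsto (fun t => Y ν t * exp (m * t)) atBot (nhds c) := by
    intro ν hν
    have w5 := (hfam ν hν).2
    have h1 : Tendsto (fun t : ℝ => exp t • e) atBot
        (nhdsWithin (0 : EuclideanSpace ℝ (Fin N)) {0}ᶜ) := by
      rw [tendsto_nhdsWithin_iff]
      refine ⟨?_, Eventually.of_forall fun t => hx0 t⟩
      have := tendsto_exp_atBot.smul_const e
      rwa [zero_smul] at this
    refine (Tendsto.comp w5 h1).congr fun t => ?_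
    simp only [Function.comp, hnorm, hrpow, hY]
    rfl
  have hP : ∀ ν ν', 0 < ν → ν < ν' → Pair M p v (Y ν) (Y1 ν) (Y ν') (Y1 ν') ν ν' :=
    fun ν ν' h1 h2 => ⟨hco, hS ν h1, hS ν' (h1.trans h2),
      fun t => hstrict ν ν' h1 h2 _ (hx0 t), hlimtop ν h1, hlimtop ν' (h1.trans h2), h2⟩
  obtain ⟨Yi, Yi1, hYi, hSi, hYle⟩ := limit_sol hP
  have hpolar : ∀ x : EuclideanSpace ℝ (Fin N), x ≠ 0 → ‖x‖ = ‖exp (Real.log ‖x‖) • e‖ :=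
    fun x hx => by rw [hnorm, Real.exp_log (norm_pos_iff.mpr hx)]
  have hpow : ∀ (x : EuclideanSpace ℝ (Fin N)) (k : ℝ), x ≠ 0 →
      ‖x‖ ^ k = exp (k * Real.log ‖x‖) := fun x k hx => by
    rw [Real.rpow_def_of_pos (norm_pos_iff.mpr hx), mul_comm]
  refine ⟨fun x => Yi (Real.log ‖x‖), ?_, ?_, fun x hx => hSi.pos _, ?_, ?_, ?_⟩
  · intro x hx
    refine (hYi (Real.log ‖x‖)).congr' ?_
    filter_upwards [eventually_gt_atTop 0] with ν hν
    exact (hrad ν hν x _ hx (hpolar x hx)).symm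
  · intro x hx
    have hx' : x ≠ 0 := hx
    have h1 : ContDiffAt ℝ 2 (fun x : EuclideanSpace ℝ (Fin N) => Real.log ‖x‖) x :=
      (contDiffAt_norm ℝ hx').log (norm_ne_zero_iff.mpr hx')
    exact ((hSi.contDiff2 hco.vc).contDiffAt.comp x h1).contDiffWithinAt
  · intro x hx
    have hn : 0 < ‖x‖ := norm_pos_iff.mpr hx
    rw [lap_log hx hSi.d0 (hSi.d1 _)]
    have h1 : exp (2 * Real.log ‖x‖) = ‖x‖ ^ 2 := by
      rw [← hpow x 2 hx]; norm_cast
    have h2 : V x = v (Real.log ‖x‖) := hVrad x _ hx (hpolar x hx)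
    rw [h1, h2]
    field_simp
    ring
  · have hsl := sing_lim hco hSi hm2 hpm hcp hcpA hc₀ hτ hv1 hvnear (hYle 1 one_pos)
      (hlimbot 1 one_pos)
    have h1 : Tendsto (fun x : EuclideanSpace ℝ (Fin N) => Real.log ‖x‖) (nhdsWithin 0 {0}ᶜ) atBot :=
      Real.tendsto_log_nhdsGT_zero.comp tendsto_norm_nhdsNE_zero
    refine Tendsto.congr' ?_ (hsl.comp h1)
    filter_upwards [self_mem_nhdsWithin] with x hx
    simp only [Function.comp]
    rw [hpow x _ hx]
  · obtain ⟨ε0, K, hε0, hK⟩ := lower_mech (α := α) (γ := γ) hM0 hp1 (by linarith) hm'0 hm'M hm'p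
    have hlow : ∀ t, 0 ≤ t → ε0 ≤ Yi t * exp (m' * t) := by
      intro t ht
      obtain ⟨ν, hν⟩ := ((eventually_gt_atTop (0:ℝ)).and
        (eventually_gt_atTop (|K| * exp (M * t) * Yi t))).exists
      have h1 : ε0 ≤ Y ν t * exp (m' * t) := by
        by_contra hh
        push Not at hh
        have h2 := hK v _ _ _ _ ν (ν + 1) (hP ν (ν + 1) hν.1 (by linarith)) hvup t ht hh.le
        have h3 := (hS ν hν.1).pos t
        have h4 := hYle ν hν.1 t
        have h5 : K * exp (M * t) * Y ν t ≤ |K| * exp (M * t) * Yi t := by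
          have := le_abs_self K
          gcongr
        linarith [hν.2]
      exact h1.trans (mul_le_mul_of_nonneg_right (hYle ν hν.1 t) (exp_pos _).le)
    set C0 := 2 * (M + 2) / (p - 1) with hC0
    have hC00 : 0 < C0 := by positivity
    have hv0 := hco.v0 0
    have hup : ∀ t, 0 ≤ t → Yi t * exp (m' * t) ≤ (C0 / (v 0 / γ)) ^ (1 / (p - 1)) := by
      intro t ht
      have hYp := hSi.pos t
      have h1 := hSi.O3 hco t
      have h2 := hvlow t ht
      have h3 : (Yi t * exp (m' * t)) ^ (p - 1) ≤ C0 / (v 0 / γ) := by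
        rw [Real.mul_rpow hYp.le (exp_pos _).le, hrpow (m' * t), le_div_iff₀ (by positivity)]
        have h4 : exp ((p - 1) * (m' * t)) = exp (2 * t) * exp (α * t) := by
          rw [← Real.exp_add]; congr 1; linear_combination t * hm'p
        rw [h4]
        calc Yi t ^ (p - 1) * (exp (2 * t) * exp (α * t)) * (v 0 / γ)
            = exp (2 * t) * (v 0 / γ * exp (α * t)) * Yi t ^ (p - 1) := by ring
          _ ≤ exp (2 * t) * v t * Yi t ^ (p - 1) := by gcongr
          _ ≤ C0 := h1
      have h6 := Real.rpow_le_rpow (by positivity) h3 (by positivity : 0 ≤ 1 / (p - 1))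
      rwa [← Real.rpow_mul (by positivity), mul_one_div_cancel hp0.ne', Real.rpow_one] at h6
    set U := (C0 / (v 0 / γ)) ^ (1 / (p - 1)) with hU
    have hU0 : 0 < U := by positivity
    have he' : 0 < 1 / ε0 := by positivity
    refine ⟨1 + U + 1 / ε0, by linarith, fun x hx => ?_⟩
    have hx' : x ≠ 0 := by rintro rfl; simp at hx; linarith
    have hlog : 0 ≤ Real.log ‖x‖ := Real.log_nonneg hx
    rw [hpow x _ hx']
    refine ⟨le_trans ?_ (hlow _ hlog), (hup _ hlog).trans (by linarith)⟩
    rw [div_le_iff₀ (by linarith)]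
    have : ε0 * (1 / ε0) = 1 := by field_simp
    nlinarith
end
end

section
/- Let N ≥ 3 be an integer and 0 < θ < N-2. Then there exists r* ∈ (0, 1/2) such that for every r ∈ (0, r*] and every x ∈ ℝ^N\{0}: ∫_{B_r(0)} |y|^{-2-θ} |x-y|^{2-N} dy ≤ (2^{N-2} / (c_N · θ(N-2-θ))) · |x|^{-θ}(1+|x|)^{2-N+θ}, where c_N = 1/((N-2)·σ_{N-1}) and σ_{N-1} is the surface measure of the unit sphere in ℝ^N. -/
open Real MeasureTheory Filter Metric Set

noncomputable section

lemma aux_gamma {a r : ℝ} (ha : 0 < a) (hr : 0 < r) :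
    ∫⁻ t in Ioi (0:ℝ), ENNReal.ofReal (t ^ (a - 1) * rexp (-(r * t))) =
      ENNReal.ofReal ((1 / r) ^ a * Real.Gamma a) := by
  have key := Real.integral_rpow_mul_exp_neg_mul_Ioi ha hr
  have hG := Real.Gamma_pos_of_pos ha
  have hint : IntegrableOn (fun x : ℝ ↦ x ^ (a - 1) * rexp (-(r * x))) (Ioi 0) :=
    .of_integral_ne_zero (by rw [key]; positivity)
  rw [← key, ofReal_integral_eq_lintegral_ofReal hint]
  refine (ae_restrict_iff' measurableSet_Ioi).mpr <| ae_of_all _ fun x (hx : 0 < x) ↦ ?_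
  simp only [Pi.zero_apply]
  positivity

lemma aux_tail {q : ℝ} (hq : 1 < q) :
    ∫⁻ v in Ioi (0:ℝ), ENNReal.ofReal ((1 + v) ^ (-q)) = ENNReal.ofReal (1 / (q - 1)) := by
  have hint : IntegrableOn (fun v : ℝ ↦ (v + 1) ^ (-q)) (Ioi 0) :=
    integrableOn_add_rpow_Ioi_of_lt (by linarith) (by norm_num)
  have hval : ∫ v in Ioi (0:ℝ), (v + 1) ^ (-q) = 1 / (q - 1) := by
    have hd : ∀ x ∈ Ici (0:ℝ), HasDerivAt (fun t : ℝ => (t + 1) ^ (-q + 1) / (-q + 1)) ((x + 1) ^ (-q)) x := by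
      intro x hx
      have hx' : (0:ℝ) ≤ x := hx
      have h1 := (((hasDerivAt_id x).add_const (1:ℝ)).rpow_const (p := -q + 1)
        (Or.inl (by simp only [id]; positivity))).div_const (-q + 1)
      convert! h1 using 1
      have : -q + 1 ≠ 0 := by linarith
      rw [add_sub_cancel_right]
      simp only [id]
      field_simp
    have ht : Tendsto (fun t : ℝ => (t + 1) ^ (-q + 1) / (-q + 1)) atTop (nhds (0 / (-q + 1))) := by
      refine Tendsto.div_const ?_ _
      have h2 := (tendsto_rpow_neg_atTop (y := q - 1) (by linarith)).comp
        (tendsto_atTop_add_const_right atTop (1:ℝ) tendsto_id)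
      refine h2.congr fun t => ?_
      simp only [Function.comp, id]
      congr 1; ring
    rw [integral_Ioi_of_hasDerivAt_of_tendsto' hd hint ht]
    have : -q + 1 ≠ 0 := by linarith
    have : q - 1 ≠ 0 := by linarith
    simp only [zero_add, Real.one_rpow]
    rw [show -q + 1 = -(q - 1) by ring, div_neg, div_neg, zero_div]
    ring
  simp_rw [add_comm (1:ℝ)]
  rw [← hval, ofReal_integral_eq_lintegral_ofReal hint]
  refine (ae_restrict_iff' measurableSet_Ioi).mpr <| ae_of_all _ fun x (hx : 0 < x) ↦ ?_
  simp only [Pi.zero_apply]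
  positivity

lemma aux_gauss {N : ℕ} (hN : 3 ≤ N) {t v : ℝ} (ht : 0 < t) (hv : 0 < v) (x : EuclideanSpace ℝ (Fin N)) :
    ∫⁻ y : EuclideanSpace ℝ (Fin N),
      ENNReal.ofReal (rexp (-(‖x - y‖ ^ 2 * t)) * rexp (-((t * ‖y‖ ^ 2) * v))) =
    ENNReal.ofReal ((π / (t * (1 + v))) ^ ((N:ℝ) / 2) * rexp (-((v / (1 + v) * ‖x‖ ^ 2) * t))) := by
  have hb : 0 < t * (1 + v) := by positivity
  have hN0 : (0:ℝ) < N := by positivity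
  have key := GaussianFourier.integral_rexp_neg_mul_sq_norm (V := EuclideanSpace ℝ (Fin N)) hb
  rw [finrank_euclideanSpace, Fintype.card_fin] at key
  have hint : Integrable (fun y : EuclideanSpace ℝ (Fin N) => rexp (-(t * (1 + v)) * ‖y‖ ^ 2)) :=
    .of_integral_ne_zero (by rw [key]; positivity)
  have e : ∀ y : EuclideanSpace ℝ (Fin N),
      rexp (-(‖x - y‖ ^ 2 * t)) * rexp (-((t * ‖y‖ ^ 2) * v)) =
      rexp (-(t * (1 + v)) * ‖y - (1 + v)⁻¹ • x‖ ^ 2) * rexp (-((v / (1 + v) * ‖x‖ ^ 2) * t)) := by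
    intro y
    rw [← Real.exp_add, ← Real.exp_add, norm_sub_sq_real, norm_sub_sq_real, inner_smul_right,
      norm_smul, real_inner_comm, Real.norm_of_nonneg (by positivity)]
    congr 1
    field_simp
    ring
  simp_rw [e]
  rw [← key, ENNReal.ofReal_mul (by positivity), ofReal_integral_eq_lintegral_ofReal hint
    (ae_of_all _ fun _ => by positivity), ← lintegral_sub_right_eq_self
      (fun y : EuclideanSpace ℝ (Fin N) => ENNReal.ofReal (rexp (-(t * (1 + v)) * ‖y‖ ^ 2))) ((1 + v)⁻¹ • x),
    ← lintegral_mul_const]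
  · refine lintegral_congr fun y => ?_
    rw [ENNReal.ofReal_mul (by positivity)]
  · fun_prop

lemma aux_const {N : ℕ} (hN : 3 ≤ N) :
    1 / cGreen N = 4 * π ^ ((N:ℝ) / 2) / Real.Gamma ((N:ℝ) / 2 - 1) := by
  have h3 : (3:ℝ) ≤ N := by exact_mod_cast hN
  have : Nonempty (Fin N) := ⟨⟨0, by omega⟩⟩
  have g1 : Real.Gamma ((N:ℝ) / 2 + 1) = (N:ℝ) / 2 * Real.Gamma ((N:ℝ) / 2) :=
    Real.Gamma_add_one (by positivity)
  have g2 : Real.Gamma ((N:ℝ) / 2) = ((N:ℝ) / 2 - 1) * Real.Gamma ((N:ℝ) / 2 - 1) := by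
    have := Real.Gamma_add_one (s := (N:ℝ) / 2 - 1) (by linarith)
    rwa [sub_add_cancel] at this
  have hG : 0 < Real.Gamma ((N:ℝ) / 2 - 1) := Real.Gamma_pos_of_pos (by linarith)
  have hpi : √π ^ N = π ^ ((N:ℝ) / 2) := by
    rw [Real.sqrt_eq_rpow, ← Real.rpow_natCast, ← Real.rpow_mul Real.pi_pos.le]
    congr 1; ring
  have hG2 : 0 < Real.Gamma ((N:ℝ) / 2 + 1) := Real.Gamma_pos_of_pos (by linarith)
  unfold cGreen sphereArea
  rw [EuclideanSpace.volume_ball, Fintype.card_fin]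
  simp only [ENNReal.ofReal_one, one_pow, one_mul, one_div, inv_inv]
  rw [ENNReal.toReal_ofReal (by positivity), g1, g2, hpi]
  have : (N:ℝ) / 2 - 1 = ((N:ℝ) - 2) / 2 := by ring
  have h2 : (N:ℝ) - 2 ≠ 0 := by linarith
  generalize Real.Gamma ((N:ℝ) / 2 - 1) = G at *
  rw [this]
  field_simp
  norm_num

lemma aux_swap {N : ℕ} (F : ℝ → ℝ → EuclideanSpace ℝ (Fin N) → ENNReal)
    (hF : Measurable fun p : ℝ × ℝ × EuclideanSpace ℝ (Fin N) => F p.1 p.2.1 p.2.2) :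
    ∫⁻ y, ∫⁻ t in Ioi (0:ℝ), ∫⁻ v in Ioi (0:ℝ), F t v y =
    ∫⁻ v in Ioi (0:ℝ), ∫⁻ t in Ioi (0:ℝ), ∫⁻ y, F t v y := by
  have m1 : Measurable fun q : (EuclideanSpace ℝ (Fin N) × ℝ) × ℝ => F q.1.2 q.2 q.1.1 :=
    hF.comp (f := fun q : (EuclideanSpace ℝ (Fin N) × ℝ) × ℝ => (q.1.2, q.2, q.1.1)) (by fun_prop)
  have m2 : Measurable fun q : (ℝ × ℝ) × EuclideanSpace ℝ (Fin N) => F q.1.1 q.1.2 q.2 :=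
    hF.comp (f := fun q : (ℝ × ℝ) × EuclideanSpace ℝ (Fin N) => (q.1.1, q.1.2, q.2)) (by fun_prop)
  have m3 : ∀ t, Measurable fun q : EuclideanSpace ℝ (Fin N) × ℝ => F t q.2 q.1 := fun t =>
    hF.comp (f := fun q : EuclideanSpace ℝ (Fin N) × ℝ => (t, q.2, q.1)) (by fun_prop)
  rw [lintegral_lintegral_swap (Measurable.aemeasurable (m1.lintegral_prod_right'))]
  have h : ∀ t : ℝ, (∫⁻ y, ∫⁻ v in Ioi (0:ℝ), F t v y) = ∫⁻ v in Ioi (0:ℝ), ∫⁻ y, F t v y :=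
    fun t => lintegral_lintegral_swap (m3 t).aemeasurable
  simp_rw [h]
  exact lintegral_lintegral_swap (Measurable.aemeasurable (m2.lintegral_prod_right'))

lemma aux_pot {N : ℕ} (hN : 3 ≤ N) {θ : ℝ} (hθ : 0 < θ) (hθ' : θ < (N:ℝ) - 2)
    {x : EuclideanSpace ℝ (Fin N)} (hx : x ≠ 0) :
    ∫⁻ y : EuclideanSpace ℝ (Fin N),
      ENNReal.ofReal (‖y‖ ^ (-2 - θ) * ‖x - y‖ ^ ((2:ℝ) - (N:ℝ))) =
    ENNReal.ofReal (1 / (cGreen N * (θ * ((N:ℝ) - 2 - θ))) * ‖x‖ ^ (-θ)) := by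
  have h3 : (3:ℝ) ≤ N := by exact_mod_cast hN
  have hne : Nonempty (Fin N) := ⟨⟨0, by omega⟩⟩
  have hx0 : 0 < ‖x‖ := norm_pos_iff.mpr hx
  set a : ℝ := 1 + θ / 2 with ha
  set b : ℝ := (N:ℝ) / 2 - 1 with hb
  have ha0 : 0 < a := by positivity
  have hb0 : 0 < b := by rw [hb]; linarith
  have hGa := Real.Gamma_pos_of_pos ha0
  have hGb := Real.Gamma_pos_of_pos hb0
  have hGt := Real.Gamma_pos_of_pos (half_pos hθ)
  -- representation
  have rep : ∀ y : EuclideanSpace ℝ (Fin N), y ≠ 0 → y ≠ x →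
      ENNReal.ofReal (Real.Gamma a * Real.Gamma b) *
        ENNReal.ofReal (‖y‖ ^ (-2 - θ) * ‖x - y‖ ^ ((2:ℝ) - (N:ℝ))) =
      ∫⁻ t in Ioi (0:ℝ), ∫⁻ v in Ioi (0:ℝ), ENNReal.ofReal (t ^ (a + b - 1) * v ^ (a - 1)) *
        ENNReal.ofReal (rexp (-(‖x - y‖ ^ 2 * t)) * rexp (-((t * ‖y‖ ^ 2) * v))) := by
    intro y hy hyx
    have hy0 : 0 < ‖y‖ := norm_pos_iff.mpr hy
    have hxy0 : 0 < ‖x - y‖ := norm_pos_iff.mpr (sub_ne_zero.mpr (Ne.symm hyx))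
    have s1 : ∀ t ∈ Ioi (0:ℝ), (∫⁻ v in Ioi (0:ℝ), ENNReal.ofReal (t ^ (a + b - 1) * v ^ (a - 1)) *
        ENNReal.ofReal (rexp (-(‖x - y‖ ^ 2 * t)) * rexp (-((t * ‖y‖ ^ 2) * v)))) =
        ENNReal.ofReal (t ^ (b - 1) * rexp (-(‖x - y‖ ^ 2 * t))) *
          ENNReal.ofReal (‖y‖ ^ (-2 - θ) * Real.Gamma a) := by
      intro t (ht : 0 < t)
      have g := aux_gamma ha0 (r := t * ‖y‖ ^ 2) (by positivity)
      have e1 : ∀ v ∈ Ioi (0:ℝ), ENNReal.ofReal (t ^ (a + b - 1) * v ^ (a - 1)) *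
        ENNReal.ofReal (rexp (-(‖x - y‖ ^ 2 * t)) * rexp (-((t * ‖y‖ ^ 2) * v))) =
        ENNReal.ofReal (t ^ (a + b - 1) * rexp (-(‖x - y‖ ^ 2 * t))) *
          ENNReal.ofReal (v ^ (a - 1) * rexp (-((t * ‖y‖ ^ 2) * v))) := by
        intro v (hv : 0 < v)
        rw [← ENNReal.ofReal_mul (by positivity), ← ENNReal.ofReal_mul (by positivity)]
        congr 1; ring
      rw [setLIntegral_congr_fun measurableSet_Ioi e1, lintegral_const_mul _ (by fun_prop), g,
        ← ENNReal.ofReal_mul (by positivity), ← ENNReal.ofReal_mul (by positivity)]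
      congr 1
      have e2 : (1 / (t * ‖y‖ ^ 2)) ^ a = t ^ (-a) * ‖y‖ ^ (-2 - θ) := by
        rw [one_div, Real.inv_rpow (by positivity), ← Real.rpow_neg (by positivity),
          Real.mul_rpow ht.le (by positivity), ← Real.rpow_natCast, ← Real.rpow_mul hy0.le]
        congr 2; rw [ha]; push_cast; ring
      have e3 : t ^ (a + b - 1) * t ^ (-a) = t ^ (b - 1) := by
        rw [← Real.rpow_add ht]; congr 1; ring
      rw [e2, ← e3]; ring
    rw [setLIntegral_congr_fun measurableSet_Ioi s1, lintegral_mul_const _ (by fun_prop),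
      aux_gamma hb0 (r := ‖x - y‖ ^ 2) (by positivity),
      ← ENNReal.ofReal_mul (by positivity), ← ENNReal.ofReal_mul (by positivity)]
    congr 1
    have e2 : (1 / (‖x - y‖ ^ 2)) ^ b = ‖x - y‖ ^ ((2:ℝ) - N) := by
      rw [one_div, Real.inv_rpow (by positivity), ← Real.rpow_neg (by positivity),
        ← Real.rpow_natCast, ← Real.rpow_mul hxy0.le]
      congr 1; rw [hb]; push_cast; ring
    rw [e2]; ring
  -- evaluation
  have ev : ∀ v ∈ Ioi (0:ℝ), (∫⁻ t in Ioi (0:ℝ), ∫⁻ y : EuclideanSpace ℝ (Fin N),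
      ENNReal.ofReal (t ^ (a + b - 1) * v ^ (a - 1)) *
        ENNReal.ofReal (rexp (-(‖x - y‖ ^ 2 * t)) * rexp (-((t * ‖y‖ ^ 2) * v)))) =
      ENNReal.ofReal (π ^ ((N:ℝ) / 2) * Real.Gamma (θ / 2) * ‖x‖ ^ (-θ)) *
        ENNReal.ofReal ((1 + v) ^ (-(((N:ℝ) - θ) / 2))) := by
    intro v (hv : 0 < v)
    have e1 : ∀ t ∈ Ioi (0:ℝ), (∫⁻ y : EuclideanSpace ℝ (Fin N),
      ENNReal.ofReal (t ^ (a + b - 1) * v ^ (a - 1)) *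
        ENNReal.ofReal (rexp (-(‖x - y‖ ^ 2 * t)) * rexp (-((t * ‖y‖ ^ 2) * v)))) =
        ENNReal.ofReal (v ^ (a - 1) * (π ^ ((N:ℝ) / 2) * (1 + v) ^ (-((N:ℝ) / 2)))) *
        ENNReal.ofReal (t ^ (θ / 2 - 1) * rexp (-((v / (1 + v) * ‖x‖ ^ 2) * t))) := by
      intro t (ht : 0 < t)
      rw [lintegral_const_mul _ (by fun_prop), aux_gauss hN ht hv x,
        ← ENNReal.ofReal_mul (by positivity), ← ENNReal.ofReal_mul (by positivity)]
      congr 1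
      rw [Real.div_rpow (by positivity) (by positivity), Real.mul_rpow ht.le (by positivity),
        Real.rpow_neg (by positivity)]
      have e3 : t ^ (a + b - 1) = t ^ (θ / 2 - 1) * t ^ ((N:ℝ) / 2) := by
        rw [← Real.rpow_add ht]; congr 1; rw [ha, hb]; ring
      rw [e3]
      field_simp
    rw [setLIntegral_congr_fun measurableSet_Ioi e1, lintegral_const_mul _ (by fun_prop),
      aux_gamma (half_pos hθ) (by positivity), ← ENNReal.ofReal_mul (by positivity),
      ← ENNReal.ofReal_mul (by positivity)]
    congr 1
    have e2 : (1 / (v / (1 + v) * ‖x‖ ^ 2)) ^ (θ / 2) =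
        v ^ (-(θ / 2)) * (1 + v) ^ (θ / 2) * ‖x‖ ^ (-θ) := by
      rw [one_div, Real.inv_rpow (by positivity), 
        Real.mul_rpow (by positivity) (by positivity), Real.div_rpow (by positivity) (by positivity),
        ← Real.rpow_natCast, ← Real.rpow_mul hx0.le, Real.rpow_neg hv.le, Real.rpow_neg hx0.le,
        show ((2:ℕ):ℝ) * (θ / 2) = θ by push_cast; ring]
      field_simp
    have e3 : v ^ (a - 1) * v ^ (-(θ / 2)) = 1 := by
      rw [← Real.rpow_add hv, ha]; ring_nf; simp
    have e4 : (1 + v) ^ (-(((N:ℝ) - θ) / 2)) = (1 + v) ^ (-((N:ℝ) / 2)) * (1 + v) ^ (θ / 2) := by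
      rw [← Real.rpow_add (by positivity)]; congr 1; ring
    rw [e2, e4]
    linear_combination (π ^ ((N:ℝ) / 2) * Real.Gamma (θ / 2) * ‖x‖ ^ (-θ) *
      ((1 + v) ^ (-((N:ℝ) / 2)) * (1 + v) ^ (θ / 2))) * e3
  have tot : ENNReal.ofReal (Real.Gamma a * Real.Gamma b) * ∫⁻ y : EuclideanSpace ℝ (Fin N),
        ENNReal.ofReal (‖y‖ ^ (-2 - θ) * ‖x - y‖ ^ ((2:ℝ) - (N:ℝ))) =
      ENNReal.ofReal (Real.Gamma a * Real.Gamma b) *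
        ENNReal.ofReal (1 / (cGreen N * (θ * ((N:ℝ) - 2 - θ))) * ‖x‖ ^ (-θ)) := by
    have hae : ∀ᵐ y : EuclideanSpace ℝ (Fin N), y ≠ 0 ∧ y ≠ x :=
      (Measure.ae_ne volume 0).and (Measure.ae_ne volume x)
    rw [← lintegral_const_mul _ (by fun_prop)]
    rw [lintegral_congr_ae (hae.mono fun y hy => rep y hy.1 hy.2), aux_swap _ (by fun_prop),
      setLIntegral_congr_fun measurableSet_Ioi ev, lintegral_const_mul _ (by fun_prop),
      aux_tail (by linarith), ← ENNReal.ofReal_mul (by positivity),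
      ← ENNReal.ofReal_mul (by positivity)]
    congr 1
    have hc := aux_const hN
    have hGa' : Real.Gamma a = θ / 2 * Real.Gamma (θ / 2) := by
      rw [ha, add_comm]; exact Real.Gamma_add_one (by positivity)
    rw [hGa', ← div_div, hc, ← hb]
    have : (N:ℝ) - 2 - θ ≠ 0 := by linarith
    have h' : ((N:ℝ) - θ) / 2 - 1 = ((N:ℝ) - 2 - θ) / 2 := by ring
    rw [h']
    field_simp
    norm_num
  have hp : 0 < Real.Gamma a * Real.Gamma b := by positivity
  exact (ENNReal.mul_right_inj (by simpa using hp) ENNReal.ofReal_ne_top).mp tot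

/-- estimate for the Newtonian potential of `|y|^{-2-θ}χ_{B_r}`. -/
theorem statement_5 (N : ℕ) (hN : 3 ≤ N) (θ : ℝ) (hθ : 0 < θ) (hθ' : θ < (N:ℝ) - 2) :
    ∃ rstar : ℝ, rstar ∈ Set.Ioo (0:ℝ) (1/2) ∧
      ∀ r ∈ Set.Ioc (0:ℝ) rstar, ∀ x : EuclideanSpace ℝ (Fin N), x ≠ 0 →
        ∫ y in Metric.ball (0 : EuclideanSpace ℝ (Fin N)) r,
            ‖y‖ ^ (-2 - θ) * ‖x - y‖ ^ ((2:ℝ) - (N:ℝ)) ≤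
          ((2:ℝ) ^ ((N:ℝ) - 2) / (cGreen N * (θ * ((N:ℝ) - 2 - θ)))) *
            (‖x‖ ^ (-θ) * (1 + ‖x‖) ^ ((2:ℝ) - (N:ℝ) + θ)) := by
  have h3 : (3:ℝ) ≤ N := by exact_mod_cast hN
  have hne : Nonempty (Fin N) := ⟨⟨0, by omega⟩⟩
  have hN2 : (0:ℝ) < (N:ℝ) - 2 := by linarith
  have hq : (0:ℝ) < (N:ℝ) - 2 - θ := by linarith
  have hc : 0 < cGreen N := by
    have h := aux_const hN
    have hG := Real.Gamma_pos_of_pos (s := (N:ℝ) / 2 - 1) (by linarith)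
    have : 0 < 1 / cGreen N := by rw [h]; positivity
    exact one_div_pos.mp this
  set K : ℝ := 1 / (cGreen N * (θ * ((N:ℝ) - 2 - θ))) with hK
  have hK0 : 0 < K := by positivity
  have hKe : (2:ℝ) ^ ((N:ℝ) - 2) / (cGreen N * (θ * ((N:ℝ) - 2 - θ))) = 2 ^ ((N:ℝ) - 2) * K := by
    rw [hK]; ring
  rw [hKe]
  have hnn : ∀ x y : EuclideanSpace ℝ (Fin N),
      0 ≤ ‖y‖ ^ (-2 - θ) * ‖x - y‖ ^ ((2:ℝ) - (N:ℝ)) := fun x y => by positivity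
  have hmeas : ∀ x : EuclideanSpace ℝ (Fin N), Measurable
      (fun y : EuclideanSpace ℝ (Fin N) => ‖y‖ ^ (-2 - θ) * ‖x - y‖ ^ ((2:ℝ) - (N:ℝ))) :=
    fun x => by fun_prop
  have hint : ∀ x : EuclideanSpace ℝ (Fin N), x ≠ 0 → Integrable
      (fun y : EuclideanSpace ℝ (Fin N) => ‖y‖ ^ (-2 - θ) * ‖x - y‖ ^ ((2:ℝ) - (N:ℝ))) := by
    intro x hx
    refine ⟨(hmeas x).aestronglyMeasurable, ?_⟩
    rw [hasFiniteIntegral_iff_ofReal (ae_of_all _ (hnn x)), aux_pot hN hθ hθ' hx]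
    exact ENNReal.ofReal_lt_top
  have hle : ∀ (r : ℝ) (x : EuclideanSpace ℝ (Fin N)), x ≠ 0 →
      ∫ y in Metric.ball (0 : EuclideanSpace ℝ (Fin N)) r,
        ‖y‖ ^ (-2 - θ) * ‖x - y‖ ^ ((2:ℝ) - (N:ℝ)) ≤ K * ‖x‖ ^ (-θ) := by
    intro r x hx
    refine (setIntegral_le_integral (hint x hx) (ae_of_all _ (hnn x))).trans ?_
    rw [integral_eq_lintegral_of_nonneg_ae (ae_of_all _ (hnn x))
      (hmeas x).aestronglyMeasurable, aux_pot hN hθ hθ' hx, ENNReal.toReal_ofReal (by positivity)]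
  set q : ℝ := 2 ^ (θ / ((N:ℝ) - 2)) with hqd
  have hq1 : 1 < q := Real.one_lt_rpow (by norm_num) (by positivity)
  have hq2 : q < 2 := by
    have : q < 2 ^ (1:ℝ) :=
      Real.rpow_lt_rpow_of_exponent_lt (by norm_num) ((div_lt_one hN2).mpr hθ')
    simpa using this
  have hqp : q ^ ((N:ℝ) - 2) = 2 ^ θ := by
    rw [hqd, ← Real.rpow_mul (by norm_num), div_mul_cancel₀ _ hN2.ne']
  refine ⟨(q - 1) / (q + 1), ⟨by apply div_pos <;> linarith, ?_⟩, ?_⟩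
  · rw [div_lt_div_iff₀ (by linarith) (by norm_num)]; linarith
  rintro r ⟨hr0, hr⟩ x hx
  have hx0 : 0 < ‖x‖ := norm_pos_iff.mpr hx
  rw [le_div_iff₀ (by linarith)] at hr
  have hr1 : r < 1 := by nlinarith
  rcases le_total ‖x‖ 1 with h1 | h1
  · refine (hle r x hx).trans ?_
    have e : (1:ℝ) ≤ 2 ^ ((N:ℝ) - 2) * (1 + ‖x‖) ^ ((2:ℝ) - N + θ) := by
      have a1 : (2:ℝ) ^ ((2:ℝ) - N + θ) ≤ (1 + ‖x‖) ^ ((2:ℝ) - N + θ) :=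
        Real.rpow_le_rpow_of_nonpos (by positivity) (by linarith) (by linarith)
      calc (1:ℝ) ≤ 2 ^ θ := Real.one_le_rpow (by norm_num) hθ.le
        _ = 2 ^ ((N:ℝ) - 2) * 2 ^ ((2:ℝ) - N + θ) := by
          rw [← Real.rpow_add (by norm_num)]; congr 1; ring
        _ ≤ _ := by gcongr
    have := mul_le_mul_of_nonneg_left e (show 0 ≤ K * ‖x‖ ^ (-θ) by positivity)
    linarith
  · set e : EuclideanSpace ℝ (Fin N) := ‖x‖⁻¹ • x with he
    have hen : ‖e‖ = 1 := by rw [he, norm_smul, norm_inv, norm_norm, inv_mul_cancel₀ hx0.ne']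
    have he0 : e ≠ 0 := norm_pos_iff.mp (by rw [hen]; norm_num)
    have hcomp : ∀ y ∈ Metric.ball (0 : EuclideanSpace ℝ (Fin N)) r,
        ‖y‖ ^ (-2 - θ) * ‖x - y‖ ^ ((2:ℝ) - (N:ℝ)) ≤
        (2 ^ θ * ‖x‖ ^ ((2:ℝ) - N)) * (‖y‖ ^ (-2 - θ) * ‖e - y‖ ^ ((2:ℝ) - (N:ℝ))) := by
      intro y hy
      have hyr : ‖y‖ < r := by simpa using hy
      have b1 : ‖x‖ - ‖y‖ ≤ ‖x - y‖ := norm_sub_norm_le x y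
      have b2 : ‖e - y‖ ≤ 1 + r := (norm_sub_le e y).trans (by rw [hen]; linarith)
      have b2' : 0 < ‖e - y‖ := by
        have := norm_sub_norm_le e y
        rw [hen] at this; linarith
      have b3 : ‖x‖ * (1 - r) ≤ ‖x - y‖ := by nlinarith
      have b4 : ‖x‖ * ‖e - y‖ * q⁻¹ ≤ ‖x - y‖ := by
        refine le_trans ?_ b3
        rw [mul_assoc]
        gcongr
        rw [← div_eq_mul_inv, div_le_iff₀ (by linarith)]
        linarith
      have b5 : ‖x - y‖ ^ ((2:ℝ) - N) ≤ (‖x‖ * ‖e - y‖ * q⁻¹) ^ ((2:ℝ) - N) :=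
        Real.rpow_le_rpow_of_nonpos (by positivity) b4 (by linarith)
      have b6 : (q⁻¹) ^ ((2:ℝ) - N) = 2 ^ θ := by
        rw [Real.inv_rpow (by positivity), ← Real.rpow_neg (by positivity), ← hqp]
        congr 1; ring
      rw [Real.mul_rpow (by positivity) (by positivity),
        Real.mul_rpow (by positivity) (by positivity), b6] at b5
      have := mul_le_mul_of_nonneg_left b5 (show 0 ≤ ‖y‖ ^ (-2 - θ) by positivity)
      linarith
    have h2 := setIntegral_mono_on (hint x hx).integrableOn
      ((hint e he0).const_mul (2 ^ θ * ‖x‖ ^ ((2:ℝ) - N))).integrableOn measurableSet_ball hcomp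
    rw [integral_const_mul] at h2
    have h4 := hle r e he0
    rw [hen, Real.one_rpow, mul_one] at h4
    refine h2.trans ((mul_le_mul_of_nonneg_left h4 (by positivity)).trans ?_)
    have a1 : (2 * ‖x‖) ^ ((2:ℝ) - N + θ) ≤ (1 + ‖x‖) ^ ((2:ℝ) - N + θ) :=
      Real.rpow_le_rpow_of_nonpos (by positivity) (by linarith) (by linarith)
    have a2 : 2 ^ θ * ‖x‖ ^ ((2:ℝ) - N) =
        2 ^ ((N:ℝ) - 2) * (‖x‖ ^ (-θ) * (2 * ‖x‖) ^ ((2:ℝ) - N + θ)) := by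
      rw [Real.mul_rpow (by norm_num) hx0.le]
      have c1 : (2:ℝ) ^ θ = 2 ^ ((N:ℝ) - 2) * 2 ^ ((2:ℝ) - N + θ) := by
        rw [← Real.rpow_add (by norm_num)]; congr 1; ring
      have c2 : ‖x‖ ^ ((2:ℝ) - N) = ‖x‖ ^ (-θ) * ‖x‖ ^ ((2:ℝ) - N + θ) := by
        rw [← Real.rpow_add hx0]; congr 1; ring
      rw [c1, c2]; ring
    rw [a2]
    calc _ = 2 ^ ((N:ℝ) - 2) * K * (‖x‖ ^ (-θ) * (2 * ‖x‖) ^ ((2:ℝ) - N + θ)) := by ring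
      _ ≤ _ := by gcongr
end
end
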